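/- Let ⟨S | R⟩ be a classical C'(1/6) presentation with S finite and group G. Then every infinite cyclic subgroup of G is at finite Hausdorff distance in (G, d_S) from a periodic bi-infinite geodesic: for every infinite-order g ∈ G there exist an isometric embedding γ : ℤ → (G, d_S), an element h ∈ G, and an integer τ ≥ 1 such that h·γ(n) = γ(n+τ) for all n ∈ ℤ, and the Hausdorff distance between γ(ℤ) and the subgroup ⟨g⟩ is finite. -/

import Mathlib

/- Common definitions: words, classical C'(1/6) presentations, word metrics,
   contraction, Morse property, etc. -/

namespace GSC

open Filter

/-- A word over the alphabet `S`: a list of letters with an exponent `±1`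
(`true` = the letter, `false` = its formal inverse). -/
abbrev Word (S : Type) := List (S × Bool)

/-- The formal inverse of a word. -/
def wordInv {S : Type} (w : Word S) : Word S := (w.map fun l => (l.1, !l.2)).reverse

/-- A word is (freely) reduced if no letter is followed by its formal inverse. -/
def Reduced {S : Type} (w : Word S) : Prop :=
  List.Chain' (fun a b => a.1 ≠ b.1 ∨ a.2 = b.2) w

/-- A word is cyclically reduced if its square is reduced. -/
def CyclicallyReduced {S : Type} (w : Word S) : Prop := Reduced (w ++ w)

/-- A piece with respect to a set of relators `R`: a word occurring as a prefix of
two distinct elements of `R`. -/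
def IsPiece {S : Type} (R : Set (Word S)) (p : Word S) : Prop :=
  ∃ r₁ ∈ R, ∃ r₂ ∈ R, r₁ ≠ r₂ ∧ p <+: r₁ ∧ p <+: r₂

/-- Closure of a set of words under inversion and cyclic permutation. -/
def symmClosure {S : Type} (R : Set (Word S)) : Set (Word S) :=
  {w | ∃ r ∈ R, ∃ n : ℕ, w = r.rotate n ∨ w = wordInv (r.rotate n)}

/-- A classical `C'(1/den)` collection of cyclically reduced words: after closing under
inversion and cyclic permutation, every piece `p` contained in a relator `r` satisfies
`den * |p| < |r|`. -/
def CprimeCollection {S : Type} (den : ℕ) (R : Set (Word S)) : Prop :=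
  (∀ r ∈ R, CyclicallyReduced r) ∧
  ∀ r ∈ symmClosure R, ∀ p : Word S, p <+: r → IsPiece (symmClosure R) p →
    den * p.length < r.length

/-- A classical `C'(1/6)` presentation: a set of cyclically reduced relators, closed under
inversion and cyclic permutation, in which every piece contained in a relator `r` has
length `< |r|/6`. -/
structure C6Presentation (S : Type) where
  rels : Set (Word S)
  cyclically_reduced : ∀ r ∈ rels, CyclicallyReduced r
  inv_mem : ∀ r ∈ rels, wordInv r ∈ rels
  rotate_mem : ∀ r ∈ rels, ∀ n : ℕ, r.rotate n ∈ rels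
  small_cancellation : ∀ r ∈ rels, ∀ p : Word S, p <+: r → IsPiece rels p →
    6 * p.length < r.length

/-- The element of the free group represented by a word. -/
def wordVal {S : Type} (w : Word S) : FreeGroup S :=
  (w.map fun l => (FreeGroup.of l.1) ^ (if l.2 then (1 : ℤ) else -1)).prod

/-- The group defined by a `C'(1/6)` presentation. -/
abbrev C6Presentation.Grp {S : Type} (P : C6Presentation S) : Type :=
  PresentedGroup (wordVal '' P.rels)

/-- The generating set of the presented group (the images of the letters of `S`). -/
def C6Presentation.gens {S : Type} (P : C6Presentation S) : Set P.Grp :=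
  Set.range fun a : S => (PresentedGroup.of a : P.Grp)

/-- The element of the presented group represented by a word. -/
def C6Presentation.elt {S : Type} (P : C6Presentation S) (w : Word S) : P.Grp :=
  (w.map fun l => (PresentedGroup.of l.1 : P.Grp) ^ (if l.2 then (1 : ℤ) else -1)).prod

/-- The word length of `g` with respect to a generating set `S ⊆ G`: the least `n`
such that `g` is a product of `n` elements of `S ∪ S⁻¹`. -/
noncomputable def wordLength {G : Type*} [Group G] (S : Set G) (g : G) : ℕ :=
  sInf {n : ℕ | ∃ l : List G, l.length = n ∧ (∀ x ∈ l, x ∈ S ∨ x⁻¹ ∈ S) ∧ l.prod = g}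

/-- The word metric on `G` with respect to `S`, as a real-valued function. -/
noncomputable def wdist {G : Type*} [Group G] (S : Set G) (g h : G) : ℝ :=
  (wordLength S (g⁻¹ * h) : ℝ)

/-- Distance from a point to a subset, in the word metric. -/
noncomputable def setDist {G : Type*} [Group G] (S : Set G) (x : G) (Y : Set G) : ℝ :=
  sInf (wdist S x '' Y)

/-- Closest point projection to a subset `Y`, in the word metric. -/
def proj {G : Type*} [Group G] (S : Set G) (Y : Set G) (x : G) : Set G :=
  {y ∈ Y | wdist S x y = setDist S x Y}

/-- Diameter of a subset, in the word metric. -/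
noncomputable def setDiam {G : Type*} [Group G] (S : Set G) (A : Set G) : ℝ :=
  sSup {d : ℝ | ∃ x ∈ A, ∃ y ∈ A, d = wdist S x y}

/-- Admissibility of a pair of contraction gauges `(ρ₁, ρ₂)`: both non-decreasing and
eventually non-negative, `ρ₁ r ≤ r`, `ρ₁` unbounded, and `ρ₂/ρ₁ → 0` at infinity. -/
def Admissible (ρ₁ ρ₂ : ℝ → ℝ) : Prop :=
  Monotone ρ₁ ∧ Monotone ρ₂ ∧
  (∀ᶠ r in atTop, 0 ≤ ρ₁ r) ∧ (∀ᶠ r in atTop, 0 ≤ ρ₂ r) ∧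
  (∀ r : ℝ, ρ₁ r ≤ r) ∧ (∀ M : ℝ, ∃ r : ℝ, M ≤ ρ₁ r) ∧
  Tendsto (fun r => ρ₂ r / ρ₁ r) atTop (nhds 0)

/-- `Y` is `(ρ₁,ρ₂)`-contracting inside the subspace `X` (with the metric induced by the
word metric of `S`): whenever `x, x' ∈ X` satisfy `d(x,x') ≤ ρ₁(d(x,Y))`, the projections
`π(x) ∪ π(x')` have diameter at most `ρ₂(d(x,Y))`. -/
def ContractingIn {G : Type*} [Group G] (S : Set G) (X Y : Set G) (ρ₁ ρ₂ : ℝ → ℝ) : Prop :=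
  Admissible ρ₁ ρ₂ ∧
  ∀ x ∈ X, ∀ x' ∈ X, wdist S x x' ≤ ρ₁ (setDist S x Y) →
    ∀ y ∈ proj S Y x ∪ proj S Y x', ∀ y' ∈ proj S Y x ∪ proj S Y x',
      wdist S y y' ≤ ρ₂ (setDist S x Y)

/-- `Y` is `(ρ₁,ρ₂)`-contracting in `Cay(G,S)`. -/
def ContractingWith {G : Type*} [Group G] (S : Set G) (ρ₁ ρ₂ : ℝ → ℝ) (Y : Set G) : Prop :=
  ContractingIn S Set.univ Y ρ₁ ρ₂

/-- `Y` is strongly contracting: `(r, C)`-contracting for some constant `C`. -/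
def StronglyContracting {G : Type*} [Group G] (S : Set G) (Y : Set G) : Prop :=
  ∃ C : ℝ, ContractingWith S (fun r => r) (fun _ => C) Y

/-- A sublinear function: non-decreasing, eventually non-negative, `f(r)/r → 0`. -/
def Sublinear (f : ℝ → ℝ) : Prop :=
  Monotone f ∧ (∀ᶠ r in atTop, 0 ≤ f r) ∧ Tendsto (fun r => f r / r) atTop (nhds 0)

/-- `f ⪯ g`: there are constants `C₁, C₂ > 0` and `C₃, C₄ ≥ 0` with
`f(x) ≤ C₁ g(C₂ x + C₃) + C₄` for all `x`. -/
def Preceq (f g : ℝ → ℝ) : Prop :=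
  ∃ C₁ C₂ C₃ C₄ : ℝ, 0 < C₁ ∧ 0 < C₂ ∧ 0 ≤ C₃ ∧ 0 ≤ C₄ ∧
    ∀ x : ℝ, f x ≤ C₁ * g (C₂ * x + C₃) + C₄

/-- `f ≍ g`: `f ⪯ g` and `g ⪯ f`. -/
def Asymp (f g : ℝ → ℝ) : Prop := Preceq f g ∧ Preceq g f

/-- `α ⊆ G` is a geodesic of `Cay(G,S)`: the image of an isometric embedding of a
subinterval of `ℤ` into `(G, d_S)`. -/
def IsGeodesic {G : Type*} [Group G] (S : Set G) (α : Set G) : Prop :=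
  ∃ (I : Set ℤ) (γ : ℤ → G), I.OrdConnected ∧
    (∀ m ∈ I, ∀ n ∈ I, wdist S (γ m) (γ n) = |(m : ℝ) - (n : ℝ)|) ∧ α = γ '' I

/-- `α ⊆ G` is a bi-infinite geodesic of `Cay(G,S)`. -/
def IsBiInfGeodesic {G : Type*} [Group G] (S : Set G) (α : Set G) : Prop :=
  ∃ γ : ℤ → G, (∀ m n : ℤ, wdist S (γ m) (γ n) = |(m : ℝ) - (n : ℝ)|) ∧ α = Set.range γ

/-- `Y` is Morse: there is `μ` such that every `(L,A)`-quasi-geodesic with endpoints on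
`Y` stays in the `μ(L,A)`-neighborhood of `Y`. -/
def IsMorse {G : Type*} [Group G] (S : Set G) (Y : Set G) : Prop :=
  ∃ μ : ℝ → ℝ → ℝ, ∀ L A : ℝ, 1 ≤ L → 0 ≤ A →
    ∀ (q : ℤ → G) (m n : ℤ), m ≤ n → q m ∈ Y → q n ∈ Y →
    (∀ i j : ℤ, m ≤ i → i ≤ n → m ≤ j → j ≤ n →
      L⁻¹ * |(i : ℝ) - (j : ℝ)| - A ≤ wdist S (q i) (q j) ∧
      wdist S (q i) (q j) ≤ L * |(i : ℝ) - (j : ℝ)| + A) →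
    ∀ i : ℤ, m ≤ i → i ≤ n → setDist S (q i) Y ≤ μ L A

/-- Two subsets are at finite Hausdorff distance in the word metric. -/
def FinHausdorffDist {G : Type*} [Group G] (S : Set G) (A B : Set G) : Prop :=
  ∃ ε : ℝ, (∀ a ∈ A, ∃ b ∈ B, wdist S a b ≤ ε) ∧ ∀ b ∈ B, ∃ a ∈ A, wdist S a b ≤ ε

/-- The embedded relator cycle determined by `g ∈ G(Γ)` and a relator `r`:
the set `{g ⋅ p̄ : p a prefix of r}`. -/
def relatorCycle {S : Type} (P : C6Presentation S) (g : P.Grp) (r : Word S) :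
    Set P.Grp :=
  {x | ∃ p : Word S, p <+: r ∧ x = g * P.elt p}

/-- A geodesic `α` is locally `(ρ₁,ρ₂)`-contracting: for every embedded relator cycle
`Γ₀` meeting `α`, the set `Γ₀ ∩ α` is `(ρ₁,ρ₂)`-contracting as a subspace of `Γ₀`. -/
def LocallyContracting {S : Type} (P : C6Presentation S) (α : Set P.Grp)
    (ρ₁ ρ₂ : ℝ → ℝ) : Prop :=
  ∀ (g : P.Grp) (r : Word S), r ∈ P.rels → (relatorCycle P g r ∩ α).Nonempty →
    ContractingIn P.gens (relatorCycle P g r) (relatorCycle P g r ∩ α) ρ₁ ρ₂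

/-- The generating set `S ∪ W` of the coned-off space: `W` is the set of elements
represented by subwords of cyclic permutations of relators (equivalently, by prefixes
of relators, since the relator set is closed under cyclic permutation). -/
def conedGens {S : Type} (P : C6Presentation S) : Set P.Grp :=
  P.gens ∪ {x | ∃ r ∈ P.rels, ∃ p : Word S, p <+: r ∧ x = P.elt p}

/-- The exponential growth rate of `(G,S)`. -/
noncomputable def growthRate {G : Type*} [Group G] (S : Set G) : ℝ :=
  limsup (fun n : ℕ => Real.log (Nat.card {g : G // wordLength S g ≤ n}) / (n : ℝ)) atTop

/-- Quasi-isometry of marked groups `(G,S)` and `(H,T)` via word metrics. -/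
def QIsom {G H : Type*} [Group G] [Group H] (S : Set G) (T : Set H) : Prop :=
  ∃ (f : G → H) (L A : ℝ), 1 ≤ L ∧ 0 ≤ A ∧
    (∀ x y : G, L⁻¹ * wdist S x y - A ≤ wdist T (f x) (f y) ∧
      wdist T (f x) (f y) ≤ L * wdist S x y + A) ∧
    ∀ h : H, ∃ x : G, wdist T (f x) h ≤ A

/-- A subgroup is virtually cyclic if it contains a cyclic subgroup of finite index. -/
def VirtuallyCyclic {G : Type*} [Group G] (E : Subgroup G) : Prop :=
  ∃ g : G, Subgroup.zpowers g ≤ E ∧ ((Subgroup.zpowers g).subgroupOf E).index ≠ 0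

end GSC
namespace GSC

section FreeWords

variable {S : Type}

/-- The formal inverse of a letter. -/
def letterInv (s : S × Bool) : S × Bool := (s.1, !s.2)

@[simp] lemma letterInv_letterInv (s : S × Bool) : letterInv (letterInv s) = s := by
  simp [letterInv]

lemma letterInv_ne (s : S × Bool) : letterInv s ≠ s := by
  intro h
  have := congrArg Prod.snd h
  simp [letterInv] at this

lemma letterInv_eq_comm {s t : S × Bool} : letterInv s = t ↔ s = letterInv t := by
  constructor <;> rintro rfl <;> simp

/-- Freely reduced words, phrased through `letterInv`. -/
def Rd (w : Word S) : Prop := w.IsChain fun a b => b ≠ letterInv a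

lemma rd_iff_isReduced {w : Word S} : Rd w ↔ FreeGroup.IsReduced w := by
  unfold Rd FreeGroup.IsReduced
  have : (fun a b : S × Bool => b ≠ letterInv a) = fun a b => a.1 = b.1 → a.2 = b.2 := by
    funext a b
    rcases a with ⟨a, x⟩
    rcases b with ⟨b, y⟩
    cases x <;> cases y <;> simp [letterInv, eq_comm]
  rw [this]

lemma reduced_iff_rd {w : Word S} : Reduced w ↔ Rd w := by
  unfold Rd Reduced
  have : (fun a b : S × Bool => b ≠ letterInv a) = fun a b => a.1 ≠ b.1 ∨ a.2 = b.2 := by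
    funext a b
    rcases a with ⟨a, x⟩
    rcases b with ⟨b, y⟩
    cases x <;> cases y <;> simp [letterInv, eq_comm]
  rw [this]
  rfl

@[simp] lemma rd_nil : Rd ([] : Word S) := List.isChain_nil
@[simp] lemma rd_singleton (s : S × Bool) : Rd [s] := List.isChain_singleton s

lemma rd_append {u v : Word S} :
    Rd (u ++ v) ↔ Rd u ∧ Rd v ∧ ∀ x ∈ u.getLast?, ∀ y ∈ v.head?, y ≠ letterInv x :=
  List.isChain_append

lemma rd_cons {s : S × Bool} {v : Word S} :
    Rd (s :: v) ↔ (∀ y ∈ v.head?, y ≠ letterInv s) ∧ Rd v := List.isChain_cons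

lemma rd_cons_cons {s t : S × Bool} {v : Word S} :
    Rd (s :: t :: v) ↔ t ≠ letterInv s ∧ Rd (t :: v) := List.isChain_cons_cons

lemma Rd.infix {u v : Word S} (h : Rd v) (huv : u <:+: v) : Rd u :=
  List.IsChain.infix h huv

lemma Rd.left {u v : Word S} (h : Rd (u ++ v)) : Rd u := (rd_append.1 h).1
lemma Rd.right {u v : Word S} (h : Rd (u ++ v)) : Rd v := (rd_append.1 h).2.1

lemma Rd.append_overlap {u v w : Word S} (h₁ : Rd (u ++ v)) (h₂ : Rd (v ++ w)) (hv : v ≠ []) :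
    Rd (u ++ v ++ w) := by
  rw [rd_append] at h₁ h₂ ⊢
  refine ⟨rd_append.2 h₁, h₂.2.1, fun x hx => h₂.2.2 x ?_⟩
  rwa [List.getLast?_append_of_ne_nil _ hv] at hx

@[simp] lemma wordInv_nil : wordInv ([] : Word S) = [] := rfl

@[simp] lemma wordInv_append (u v : Word S) : wordInv (u ++ v) = wordInv v ++ wordInv u := by
  simp [wordInv]

@[simp] lemma wordInv_cons (s : S × Bool) (v : Word S) :
    wordInv (s :: v) = wordInv v ++ [letterInv s] := by
  simp [wordInv, letterInv]

@[simp] lemma wordInv_wordInv (u : Word S) : wordInv (wordInv u) = u := by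
  induction u with
  | nil => rfl
  | cons s u ih => simp [ih]

@[simp] lemma length_wordInv (u : Word S) : (wordInv u).length = u.length := by
  simp [wordInv]

@[simp] lemma wordInv_eq_nil {u : Word S} : wordInv u = [] ↔ u = [] := by
  rw [← List.length_eq_zero_iff, length_wordInv, List.length_eq_zero_iff]

@[simp] lemma head?_wordInv (u : Word S) : (wordInv u).head? = u.getLast?.map letterInv := by
  induction u using List.reverseRecOn with
  | nil => rfl
  | append_singleton u s ih => simp

@[simp] lemma getLast?_wordInv (u : Word S) : (wordInv u).getLast? = u.head?.map letterInv := by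
  cases u <;> simp

lemma Rd.wordInv {u : Word S} (h : Rd u) : Rd (wordInv u) := by
  induction u with
  | nil => simp
  | cons s u ih =>
    rw [rd_cons] at h
    rw [wordInv_cons, rd_append]
    refine ⟨ih h.2, by simp, ?_⟩
    simp only [getLast?_wordInv, Option.mem_def, Option.map_eq_some_iff, List.head?_cons,
      Option.some.injEq]
    rintro x ⟨y, hy, rfl⟩ _ rfl
    simpa [eq_comm] using h.1 y hy

@[simp] lemma rd_wordInv {u : Word S} : Rd (GSC.wordInv u) ↔ Rd u :=
  ⟨fun h => by simpa using h.wordInv, Rd.wordInv⟩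

/-- The free group element of a word. -/
def fg (w : Word S) : FreeGroup S := FreeGroup.mk w

lemma fg_append (u v : Word S) : fg (u ++ v) = fg u * fg v := (FreeGroup.mul_mk).symm
lemma fg_nil : fg ([] : Word S) = 1 := rfl
lemma fg_cons (s : S × Bool) (v : Word S) : fg (s :: v) = fg [s] * fg v := fg_append [s] v
lemma fg_wordInv (u : Word S) : fg (wordInv u) = (fg u)⁻¹ := FreeGroup.inv_mk.symm
lemma fg_letterInv (s : S × Bool) : fg [letterInv s] = (fg [s])⁻¹ := fg_wordInv [s]

open scoped Classical in
/-- The normal form of a free group element. -/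
noncomputable def nf (x : FreeGroup S) : Word S := x.toWord

@[simp] lemma fg_nf (x : FreeGroup S) : fg (nf x) = x := by
  classical exact FreeGroup.mk_toWord
lemma rd_nf (x : FreeGroup S) : Rd (nf x) := by
  classical exact rd_iff_isReduced.2 FreeGroup.isReduced_toWord

lemma Rd.eq_of_fg_eq {u v : Word S} (hu : Rd u) (hv : Rd v) (h : fg u = fg v) : u = v := by
  classical
  rw [← (rd_iff_isReduced.1 hu).reduce_eq, ← (rd_iff_isReduced.1 hv).reduce_eq]
  exact FreeGroup.reduce.sound h

/-- A letter surviving in the normal form comes from a letter of the word preceded by a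
trivial word. -/
lemma exists_split_of_fg_eq_cons (X : Word S) {s : S × Bool} {t : Word S} (hst : Rd (s :: t))
    (h : fg X = fg (s :: t)) : ∃ A B, X = A ++ s :: B ∧ fg A = 1 ∧ fg B = fg t := by
  induction hn : X.length using Nat.strong_induction_on generalizing X s t with
  | _ n ih =>
  subst hn
  rcases X with _ | ⟨a, X⟩
  · exact absurd (rd_nil.eq_of_fg_eq hst h) (by simp)
  have hu := rd_nf (fg X)
  have hX : fg X = fg (nf (fg X)) := by simp
  generalize nf (fg X) = u at hu hX
  by_cases hc : u.head? = some (letterInv a)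
  · obtain ⟨u', rfl⟩ : ∃ u', u = letterInv a :: u' := by
      cases u with
      | nil => simp at hc
      | cons b u => exact ⟨u, by simpa using hc⟩
    obtain ⟨A, B, rfl, hA, hB⟩ := ih X.length (by simp) X hu hX rfl
    have hB' : fg B = fg (s :: t) := by
      rw [← h, fg_cons, fg_append, fg_cons (letterInv a) B, hA, fg_letterInv]
      group
    obtain ⟨A', B', rfl, hA', hB''⟩ := ih B.length (by simp; omega) B hst hB' rfl
    refine ⟨a :: A ++ letterInv a :: A', B', by simp, ?_, hB''⟩
    rw [fg_append, fg_cons, fg_cons (letterInv a), hA, hA', fg_letterInv]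
    group
  · have hau : Rd (a :: u) := by
      rw [rd_cons]
      refine ⟨fun y hy e => hc ?_, hu⟩
      rw [← e]; exact hy
    have e : fg (a :: u) = fg (s :: t) := by rw [← h, fg_cons, ← hX, ← fg_cons]
    have := hau.eq_of_fg_eq hst e
    obtain ⟨rfl, rfl⟩ := by simpa using this
    exact ⟨[], X, rfl, rfl, hX⟩

/-- Maximal cancellation between a word and another one. -/
lemma exists_common_prefix {α : Type*} (u v : List α) :
    ∃ b c d, u = b ++ c ∧ v = b ++ d ∧ ∀ x ∈ c.head?, ∀ y ∈ d.head?, x ≠ y := by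
  induction u generalizing v with
  | nil => exact ⟨[], [], v, by simp⟩
  | cons x u ih =>
    cases v with
    | nil => exact ⟨[], x :: u, [], by simp⟩
    | cons y v =>
      by_cases h : x = y
      · obtain ⟨b, c, d, rfl, rfl, hcd⟩ := ih v
        exact ⟨x :: b, c, d, by simp, by simp [h], hcd⟩
      · exact ⟨[], x :: u, y :: v, by simp [h]⟩

end FreeWords

section Area

variable {S : Type} (R : Set (Word S))

/-- The free group element of a list of conjugates of relators. -/
def conjWord (l : List (Word S × Word S)) : Word S :=
  l.flatMap fun e => e.1 ++ e.2 ++ wordInv e.1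

/-- `x` is a product of at most `n` conjugates of relators with conjugators of total length at
most `m`. -/
def AreaLen (n m : ℕ) (x : FreeGroup S) : Prop :=
  ∃ l : List (Word S × Word S), (∀ e ∈ l, e.2 ∈ R) ∧ l.length ≤ n ∧
    (l.map fun e => e.1.length).sum ≤ m ∧ fg (conjWord l) = x

/-- `x` is a product of at most `n` conjugates of relators. -/
def Ar (n : ℕ) (x : FreeGroup S) : Prop := ∃ m, AreaLen R n m x

variable {R}

lemma AreaLen.one : AreaLen R 0 0 1 := ⟨[], by simp [conjWord, fg_nil]⟩

lemma AreaLen.mono {n m n' m' : ℕ} {x : FreeGroup S} (h : AreaLen R n m x) (hn : n ≤ n')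
    (hm : m ≤ m') : AreaLen R n' m' x := by
  obtain ⟨l, h1, h2, h3, h4⟩ := h
  exact ⟨l, h1, h2.trans hn, h3.trans hm, h4⟩

lemma AreaLen.mul {n m n' m' : ℕ} {x y : FreeGroup S} (h : AreaLen R n m x)
    (h' : AreaLen R n' m' y) : AreaLen R (n + n') (m + m') (x * y) := by
  obtain ⟨l, h1, h2, h3, h4⟩ := h
  obtain ⟨l', h1', h2', h3', h4'⟩ := h'
  refine ⟨l ++ l', ?_, by simp; omega, by simp; omega, ?_⟩
  · intro e he
    rcases List.mem_append.1 he with he | he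
    exacts [h1 e he, h1' e he]
  · rw [conjWord, List.flatMap_append, fg_append, ← h4, ← h4']; rfl

lemma areaLen_conj {r : Word S} (hr : r ∈ R) (f : Word S) :
    AreaLen R 1 f.length (fg f * fg r * (fg f)⁻¹) :=
  ⟨[(f, r)], by simpa, by simp, by simp, by simp [conjWord, fg_append, fg_wordInv, mul_assoc]⟩

lemma AreaLen.inv (hR : ∀ r ∈ R, wordInv r ∈ R) {n m : ℕ} {x : FreeGroup S}
    (h : AreaLen R n m x) : AreaLen R n m x⁻¹ := by
  obtain ⟨l, h1, h2, h3, rfl⟩ := h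
  refine AreaLen.mono ?_ h2 h3
  clear h2 h3
  induction l with
  | nil => simpa [conjWord, fg_nil] using AreaLen.one
  | cons e l ih =>
    have h := (ih fun e he => h1 e (by simp [he])).mul
      (areaLen_conj (hR _ (h1 e (by simp))) e.1)
    convert h using 1
    · simp
    · simp [add_comm]
    · simp [conjWord, fg_append, fg_wordInv, mul_assoc]

lemma Ar.one : Ar R 0 1 := ⟨0, AreaLen.one⟩
lemma Ar.mono {n n' : ℕ} {x : FreeGroup S} (h : Ar R n x) (hn : n ≤ n') : Ar R n' x :=
  h.imp fun _ h => h.mono hn le_rfl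
lemma Ar.mul {n n' : ℕ} {x y : FreeGroup S} (h : Ar R n x) (h' : Ar R n' y) :
    Ar R (n + n') (x * y) := by
  obtain ⟨m, h⟩ := h
  obtain ⟨m', h'⟩ := h'
  exact ⟨_, h.mul h'⟩
lemma Ar.inv (hR : ∀ r ∈ R, wordInv r ∈ R) {n : ℕ} {x : FreeGroup S} (h : Ar R n x) :
    Ar R n x⁻¹ := h.imp fun _ h => h.inv hR
lemma ar_of_mem {r : Word S} (hr : r ∈ R) : Ar R 1 (fg r) :=
  ⟨0, by simpa [fg_nil] using areaLen_conj hr []⟩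

lemma Ar.conj {n : ℕ} {x : FreeGroup S} (h : Ar R n x) (f : FreeGroup S) :
    Ar R n (f * x * f⁻¹) := by
  obtain ⟨m, l, h1, h2, h3, rfl⟩ := h
  refine Ar.mono ?_ h2
  clear h2 h3
  induction l with
  | nil => simpa [conjWord, fg_nil] using Ar.one
  | cons e l ih =>
    have h : Ar R _ _ := ⟨_, areaLen_conj (h1 e (by simp)) (nf f ++ e.1)⟩
    convert h.mul (ih fun e he => h1 e (by simp [he])) using 1
    · simp [add_comm]
    · simp only [conjWord, List.flatMap_cons, fg_append, fg_wordInv, fg_nf]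
      group

lemma exists_conjWord_split {l : List (Word S × Word S)} {P Q : Word S} {s : S × Bool}
    (h : conjWord l = P ++ s :: Q) : ∃ l₁ e l₂ P' Q', l = l₁ ++ e :: l₂ ∧
      e.1 ++ e.2 ++ wordInv e.1 = P' ++ s :: Q' ∧ P = conjWord l₁ ++ P' ∧
      Q = Q' ++ conjWord l₂ := by
  induction l generalizing P with
  | nil => simp [conjWord] at h
  | cons e l ih =>
    have h' : (e.1 ++ e.2 ++ wordInv e.1) ++ conjWord l = P ++ s :: Q := by
      rw [← h]; simp [conjWord]
    rcases List.append_eq_append_iff.1 h' with ⟨a, rfl, ha⟩ | ⟨a, ha, hb⟩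
    · obtain ⟨l₁, e', l₂, P', Q', rfl, h1, rfl, h3⟩ := ih ha
      exact ⟨e :: l₁, e', l₂, P', Q', rfl, h1, by simp [conjWord], h3⟩
    · rcases a with _ | ⟨b, a⟩
      · obtain ⟨l₁, e', l₂, P', Q', rfl, h1, h2, h3⟩ := ih (P := []) (by simpa using hb.symm)
        refine ⟨e :: l₁, e', l₂, P', Q', rfl, h1, ?_, h3⟩
        simp only [List.append_nil] at ha
        rw [← ha, show conjWord (e :: l₁) = (e.1 ++ e.2 ++ wordInv e.1) ++ conjWord l₁ from by
          simp [conjWord], List.append_assoc, List.append_assoc, ← h2, List.append_nil]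
      · simp only [List.cons_append, List.cons.injEq] at hb
        obtain ⟨rfl, rfl⟩ := hb
        exact ⟨[], e, l, P, a, rfl, ha, by simp [conjWord], rfl⟩

end Area

end GSC

namespace GSC

section FirstLetter

variable {S : Type} (P : C6Presentation S)

/-- The two ways in which the first letter of a word of bounded area arises: from a relator, or
from a conjugating letter. -/
def FirstLetter (n m : ℕ) (s : S × Bool) (t : Word S) : Prop :=
  (∃ r', s :: r' ∈ P.rels ∧ ∃ n' < n, Ar P.rels n' ((fg (s :: r'))⁻¹ * fg (s :: t))) ∨
  ∃ b c i j m₁ m₂, t = b ++ letterInv s :: c ∧ b ≠ [] ∧ i + j ≤ n ∧ m₁ + m₂ < m ∧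
    AreaLen P.rels i m₁ (fg b) ∧ AreaLen P.rels j m₂ (fg c)

variable {P}

lemma rotate_mem' {a b : Word S} (h : a ++ b ∈ P.rels) : b ++ a ∈ P.rels := by
  simpa using P.rotate_mem _ h a.length

lemma firstLetter_of_conj {m : ℕ}
    (ih : ∀ m' < m, ∀ n s (t : Word S), Rd (s :: t) → AreaLen P.rels n m' (fg (s :: t)) →
      FirstLetter P n m' s t)
    {n i j m₁ m₂ : ℕ} {s : S × Bool} {t b c : Word S} (hst : Rd (s :: t)) (hb : Rd b) (hc : Rd c)
    (hx : fg (s :: t) = fg [s] * fg b * (fg [s])⁻¹ * fg c)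
    (hij : i + j ≤ n) (hm : m₁ + m₂ < m) (hbi : AreaLen P.rels i m₁ (fg b))
    (hcj : AreaLen P.rels j m₂ (fg c)) : FirstLetter P n m s t := by
  induction hM : m₁ + m₂ using Nat.strong_induction_on generalizing i j m₁ m₂ b c with
  | _ M IH =>
  subst hM
  by_cases h1 : c.head? = some s
  · obtain ⟨c', rfl⟩ : ∃ c', c = s :: c' := by
      cases c with
      | nil => simp at h1
      | cons a c => exact ⟨c, by simpa using h1⟩
    rcases ih m₂ (by omega) j s c' hc hcj with ⟨r', hr, n', hn', hA⟩ |
      ⟨b₁, c₁, i₁, j₁, μ₁, μ₂, rfl, -, hij', hμ, hA₁, hA₂⟩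
    · refine Or.inl ⟨r', hr, i + n', by omega, ?_⟩
      have := (Ar.conj ⟨m₁, hbi⟩ ((fg (s :: r'))⁻¹ * fg [s])).mul hA
      convert this using 1
      rw [hx]
      group
    · refine IH _ ?_ (rd_nf (fg b * fg b₁)) (rd_nf (fg c₁)) ?_ ?_ ?_
        (by rw [fg_nf]; exact hbi.mul hA₁) (by rw [fg_nf]; exact hA₂) rfl
      · omega
      · rw [hx, fg_nf, fg_nf, fg_cons s (b₁ ++ _), fg_append, fg_cons (letterInv s) c₁, fg_letterInv]
        group
      · omega
      · omega
  have hcs : Rd (letterInv s :: c) := by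
    rw [rd_cons]
    refine ⟨fun y hy e => h1 ?_, hc⟩
    rw [letterInv_letterInv] at e
    rw [← e]; exact hy
  by_cases h3 : b.getLast? = some s
  · obtain ⟨b', hb'⟩ : ∃ b', wordInv b = letterInv s :: b' := by
      have : (wordInv b).head? = some (letterInv s) := by simp [h3]
      cases hw : wordInv b with
      | nil => simp [hw] at this
      | cons a c => exact ⟨c, by simpa [hw] using this⟩
    have hbi' := hbi.inv P.inv_mem
    rw [← fg_wordInv, hb'] at hbi'
    have hbe : fg b = (fg (letterInv s :: b'))⁻¹ := by rw [← hb', fg_wordInv, inv_inv]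
    rcases ih m₁ (by omega) i (letterInv s) b' (hb' ▸ hb.wordInv) hbi' with
      ⟨r', hr, n', hn', hA⟩ | ⟨b₁, c₁, i₁, j₁, μ₁, μ₂, rfl, -, hij', hμ, hA₁, hA₂⟩
    · have hr' : s :: wordInv r' ∈ P.rels := by
        have := P.inv_mem _ hr
        rw [wordInv_cons, letterInv_letterInv] at this
        simpa using rotate_mem' this
      refine Or.inl ⟨wordInv r', hr', n' + j, by omega, ?_⟩
      have := ((hA.inv P.inv_mem).conj ((fg (s :: wordInv r'))⁻¹ * fg [s])).mul ⟨m₂, hcj⟩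
      convert this using 1
      rw [hx, hbe, fg_cons _ r', fg_cons s (wordInv r'), fg_letterInv, fg_wordInv]
      group
    · rw [letterInv_letterInv, fg_cons _ (b₁ ++ _), fg_append, fg_cons s c₁, fg_letterInv] at hbe
      refine IH (μ₂ + (μ₁ + m₂)) ?_ (b := nf ((fg c₁)⁻¹)) (c := nf ((fg b₁)⁻¹ * fg c))
        (i := j₁) (j := i₁ + j) (rd_nf _) (rd_nf _) ?_ ?_ ?_
        (by rw [fg_nf]; exact hA₂.inv P.inv_mem)
        (by rw [fg_nf]; exact (hA₁.inv P.inv_mem).mul hcj) rfl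
      · omega
      · rw [hx, hbe, fg_nf, fg_nf]
        group
      · omega
      · omega
  have hbs : Rd (b ++ [letterInv s]) := by
    rw [rd_append]
    refine ⟨hb, by simp, fun x hx y hy e => h3 ?_⟩
    simp only [List.head?_cons, Option.mem_def, Option.some.injEq] at hy
    subst hy
    rw [letterInv_eq_comm, letterInv_letterInv] at e
    rw [e]; exact hx
  have hbsc : Rd (b ++ letterInv s :: c) := by
    simpa using hbs.append_overlap hcs (by simp)
  have key : fg (s :: t) = fg (s :: (b ++ letterInv s :: c)) := by
    rw [hx, fg_cons s (b ++ _), fg_append, fg_cons (letterInv s) c, fg_letterInv]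
    group
  rcases b with _ | ⟨a, b⟩
  · exfalso
    have e : fg (s :: t) = fg c := by rw [hx, fg_nil]; group
    rw [← hst.eq_of_fg_eq hc e] at h1
    simp at h1
  by_cases h4 : a = letterInv s
  · exfalso
    subst h4
    have e : fg (s :: t) = fg (b ++ letterInv s :: c) := by
      rw [key, List.cons_append, fg_cons s (letterInv s :: _), fg_cons (letterInv s) (b ++ _), fg_letterInv]
      group
    have := hst.eq_of_fg_eq (Rd.infix hbsc ⟨[letterInv s], [], by simp⟩) e
    cases b with
    | nil => simp at this; exact letterInv_ne s this.1.symm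
    | cons a b =>
      simp at this
      rw [rd_cons_cons, letterInv_letterInv] at hb
      exact hb.1 this.1.symm
  · have : Rd (s :: (a :: b ++ letterInv s :: c)) := by
      rw [List.cons_append, rd_cons_cons]
      exact ⟨h4, hbsc⟩
    have := hst.eq_of_fg_eq this key
    refine Or.inr ⟨a :: b, c, i, j, m₁, m₂, ?_, by simp, hij, hm, hbi, hcj⟩
    simpa using this

theorem firstLetter (m n : ℕ) {s : S × Bool} {t : Word S} (hst : Rd (s :: t))
    (h : AreaLen P.rels n m (fg (s :: t))) : FirstLetter P n m s t := by
  induction m using Nat.strong_induction_on generalizing n s t with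
  | _ m ih =>
  obtain ⟨l, h1, h2, h3, h4⟩ := h
  obtain ⟨A, B, hAB, hA, hB⟩ := exists_split_of_fg_eq_cons _ hst h4
  obtain ⟨l₁, ⟨f, r⟩, l₂, P', Q', rfl, he, rfl, rfl⟩ := exists_conjWord_split hAB
  simp only [List.length_append, List.length_cons, List.map_append, List.map_cons, List.sum_append,
    List.sum_cons] at h2 h3
  simp only at he
  have hr : r ∈ P.rels := h1 (f, r) (by simp)
  have hl₁ : AreaLen P.rels _ _ _ := ⟨l₁, fun e he => h1 e (by simp [he]), le_rfl, le_rfl, rfl⟩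
  have hl₂ : AreaLen P.rels _ _ _ := ⟨l₂, fun e he => h1 e (by simp [he]), le_rfl, le_rfl, rfl⟩
  rw [fg_append] at hA hB
  generalize fg (conjWord l₁) = a at *
  generalize fg (conjWord l₂) = b at *
  have hx : fg (s :: t) = fg [s] * fg Q' * b := by rw [fg_cons, ← hB]; group
  have ha : a = (fg P')⁻¹ := eq_inv_of_mul_eq_one_left hA
  set n₁ := l₁.length
  set n₂ := l₂.length
  set m₁ := (l₁.map fun e => e.1.length).sum
  set m₂ := (l₂.map fun e => e.1.length).sum
  have inRel : ∀ g₁ g₂ : Word S, r = g₁ ++ s :: g₂ → P' = f ++ g₁ → Q' = g₂ ++ wordInv f →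
      FirstLetter P n m s t := by
    rintro g₁ g₂ rfl rfl rfl
    refine Or.inl ⟨g₂ ++ g₁, by simpa using rotate_mem' hr, n₁ + n₂, by omega, ?_⟩
    convert Ar.mul ⟨_, hl₁⟩ ⟨_, hl₂⟩ using 1
    rw [hx, ha, fg_cons, fg_append, fg_append, fg_append, fg_wordInv]
    group
  have inLeft : ∀ g₁ g₂ : Word S, f = g₁ ++ s :: g₂ → P' = g₁ → Q' = g₂ ++ r ++ wordInv f →
      FirstLetter P n m s t := by
    rintro g₁ g₂ rfl rfl rfl
    simp only [List.length_append, List.length_cons] at h3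
    refine firstLetter_of_conj (fun m' hm' n s t => ih m' hm' n) hst
      (rd_nf (fg g₂ * fg r * (fg g₂)⁻¹)) (rd_nf (a * b)) (i := 1) (j := n₁ + n₂)
      (m₁ := g₂.length) (m₂ := m₁ + m₂) ?_ (by omega) (by omega) ?_ ?_
    · rw [hx, fg_nf, fg_nf, ha]
      simp only [fg_append, fg_wordInv, fg_cons s g₂]
      group
    · rw [fg_nf]; exact areaLen_conj hr _
    · rw [fg_nf]; exact hl₁.mul hl₂
  have inRight : ∀ g₁ g₂ : Word S, wordInv f = g₁ ++ s :: g₂ → P' = f ++ r ++ g₁ → Q' = g₂ →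
      FirstLetter P n m s t := by
    rintro g₁ g₂ hf rfl rfl
    have hlen := congrArg List.length hf
    simp only [List.length_append, List.length_cons, length_wordInv] at hlen
    have hff : fg f = (fg g₁ * fg [s] * fg Q')⁻¹ := by
      rw [← inv_inj, ← fg_wordInv, hf, fg_append, fg_cons]; group
    have hA : AreaLen P.rels n (g₁.length + (m₁ + m₂)) (fg (s :: t)) := by
      have := (areaLen_conj hr (wordInv g₁)).mul (hl₁.mul hl₂)
      refine AreaLen.mono (?_ : AreaLen P.rels (1 + (n₁ + n₂)) (g₁.length + (m₁ + m₂)) _)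
        (by omega) le_rfl
      convert this using 1
      · simp
      · rw [hx, ha, fg_append, fg_append, hff, fg_wordInv]
        group
    rcases ih _ (by omega) n hst hA with h | ⟨b, c, i, j, m₁, m₂, h1, h2, h3, h4, h5, h6⟩
    · exact Or.inl h
    · exact Or.inr ⟨b, c, i, j, m₁, m₂, h1, h2, h3, by omega, h5, h6⟩
  rw [List.append_assoc, List.append_eq_append_iff] at he
  rcases he with ⟨u, hu, hv⟩ | ⟨u, hu, hv⟩
  · rw [List.append_eq_append_iff] at hv
    rcases hv with ⟨v, rfl, hw⟩ | ⟨v, hv', hw⟩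
    · exact inRight v Q' hw (by simpa using hu) rfl
    · cases v with
      | nil => exact inRight [] Q' (by simpa using hw.symm) (by simp [hu, hv']) rfl
      | cons y v =>
        obtain ⟨rfl, rfl⟩ := by simpa using hw
        exact inRel u v hv' hu rfl
  · cases u with
    | nil =>
      simp only [List.append_nil] at hu
      cases hrr : r with
      | nil =>
        rw [hrr] at hv
        exact inRight [] Q' (by simpa using hv.symm) (by simp [hu, hrr]) rfl
      | cons y v =>
        rw [hrr] at hv
        obtain ⟨rfl, rfl⟩ := by simpa using hv
        exact inRel [] v hrr (by simp [hu]) rfl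
    | cons y u =>
      obtain ⟨rfl, rfl⟩ := by simpa using hv
      exact inLeft P' u hu rfl (by simp)

end FirstLetter

end GSC

namespace GSC

section Presentation

variable {S : Type} (P : C6Presentation S)

lemma wordVal_eq_fg (w : Word S) : wordVal w = fg w := by
  induction w with
  | nil => rfl
  | cons s w ih =>
    rw [fg_cons, ← ih, wordVal, wordVal, List.map_cons, List.prod_cons]
    congr 1
    rcases s with ⟨a, _ | _⟩ <;> simp [fg, FreeGroup.of, FreeGroup.invRev]

/-- The projection of the free group onto the presented group. -/
def C6Presentation.pi : FreeGroup S →* P.Grp := PresentedGroup.mk _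

lemma elt_eq_pi (w : Word S) : P.elt w = P.pi (fg w) := by
  rw [← wordVal_eq_fg, wordVal, map_list_prod, C6Presentation.elt, List.map_map]
  congr 1

@[simp] lemma elt_nil : P.elt [] = 1 := rfl
lemma elt_append (u v : Word S) : P.elt (u ++ v) = P.elt u * P.elt v := by
  simp [elt_eq_pi, fg_append]
lemma elt_wordInv (u : Word S) : P.elt (wordInv u) = (P.elt u)⁻¹ := by
  simp [elt_eq_pi, fg_wordInv]
lemma elt_surjective (x : P.Grp) : ∃ w, P.elt w = x := by
  obtain ⟨y, rfl⟩ := PresentedGroup.mk_surjective _ x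
  exact ⟨nf y, by rw [elt_eq_pi, fg_nf]; rfl⟩

lemma pi_eq_one_iff {x : FreeGroup S} : P.pi x = 1 ↔ ∃ n, Ar P.rels n x := by
  constructor
  · intro h
    have h := PresentedGroup.mk_eq_one_iff.1 h
    let N : Subgroup (FreeGroup S) :=
      { carrier := {x | ∃ n, Ar P.rels n x}
        one_mem' := ⟨0, Ar.one⟩
        mul_mem' := fun ⟨_, hx⟩ ⟨_, hy⟩ => ⟨_, hx.mul hy⟩
        inv_mem' := fun ⟨n, hx⟩ => ⟨n, hx.inv P.inv_mem⟩ }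
    have hN : N.Normal := ⟨fun x ⟨n, hx⟩ g => ⟨n, hx.conj g⟩⟩
    refine (Subgroup.normalClosure_le_normal (N := N) ?_) h
    rintro _ ⟨r, hr, rfl⟩
    exact ⟨1, by rw [wordVal_eq_fg]; exact ar_of_mem hr⟩
  · rintro ⟨n, m, l, h1, -, -, rfl⟩
    induction l with
    | nil => rfl
    | cons e l ih =>
      have he : P.pi (fg e.2) = 1 := by
        rw [← wordVal_eq_fg]
        exact PresentedGroup.mk_eq_one_iff.2
          (Subgroup.subset_normalClosure ⟨_, h1 e (by simp), rfl⟩)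
      have : conjWord (e :: l) = e.1 ++ e.2 ++ wordInv e.1 ++ conjWord l := by simp [conjWord]
      rw [this, fg_append, fg_append, fg_append, fg_wordInv, map_mul, map_mul, map_mul, he,
        ih fun e he => h1 e (by simp [he])]
      simp

variable {P}

lemma Ar.pi_eq_one {n : ℕ} {x : FreeGroup S} (h : Ar P.rels n x) : P.pi x = 1 :=
  (pi_eq_one_iff P).2 ⟨n, h⟩

lemma pi_rel {r : Word S} (hr : r ∈ P.rels) : P.pi (fg r) = 1 := (ar_of_mem hr).pi_eq_one

lemma elt_rel {r : Word S} (hr : r ∈ P.rels) : P.elt r = 1 := by rw [elt_eq_pi, pi_rel hr]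

lemma rd_rel_append {r : Word S} (hr : r ∈ P.rels) : Rd (r ++ r) :=
  reduced_iff_rd.1 (P.cyclically_reduced r hr)

lemma rd_rel {r : Word S} (hr : r ∈ P.rels) : Rd r := (rd_rel_append hr).left

lemma eq_nil_of_wordInv_eq {w : Word S} (hw : Rd w) (h : wordInv w = w) : w = [] := by
  have h2 : (fg w) ^ 2 = 1 := by
    rw [pow_two]
    nth_rewrite 1 [← h]
    rw [fg_wordInv, inv_mul_cancel]
  have : fg w = 1 := (pow_eq_one_iff_left two_ne_zero).1 h2
  exact hw.eq_of_fg_eq rd_nil this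

lemma ne_rotate_wordInv {u v : Word S} (hr : u ++ v ∈ P.rels) (hne : u ++ v ≠ []) :
    v ++ u ≠ wordInv (u ++ v) := by
  intro h
  rw [wordInv_append] at h
  obtain ⟨h1, h2⟩ := List.append_inj h (by simp)
  have hu := eq_nil_of_wordInv_eq (rd_rel hr).left h2.symm
  have hv := eq_nil_of_wordInv_eq (rd_rel hr).right h1.symm
  exact hne (by rw [hu, hv]; rfl)

lemma piece_lt {r₁ r₂ c : Word S} (h₁ : r₁ ∈ P.rels) (h₂ : r₂ ∈ P.rels) (hne : r₁ ≠ r₂)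
    (hc₁ : c <+: r₁) (hc₂ : c <+: r₂) : 6 * c.length < r₁.length ∧ 6 * c.length < r₂.length :=
  ⟨P.small_cancellation _ h₁ _ hc₁ ⟨_, h₁, _, h₂, hne, hc₁, hc₂⟩,
    P.small_cancellation _ h₂ _ hc₂ ⟨_, h₁, _, h₂, hne, hc₁, hc₂⟩⟩

variable (P) in
/-- The vertex at position `k` of the relator cycle `r` based at `g`. -/
def vx (g : P.Grp) (r : Word S) (k : ℕ) : P.Grp := g * P.elt (r.take (k % r.length))

lemma vx_add {g : P.Grp} {r : Word S} (hr : r ∈ P.rels) (o : ℕ) {j : ℕ} (hj : j ≤ r.length) :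
    vx P g r (o + j) = vx P g r o * P.elt ((r.rotate o).take j) := by
  rcases eq_or_ne r [] with rfl | hne
  · simp [vx]
  have hL : 0 < r.length := List.length_pos_iff.2 hne
  rw [← List.rotate_mod]
  unfold vx
  rw [Nat.add_mod]
  have ho : o % r.length < r.length := Nat.mod_lt _ hL
  generalize o % r.length = o at *
  rw [List.rotate_eq_drop_append_take ho.le, mul_assoc, ← elt_append]
  by_cases h : o + j < r.length
  · rw [Nat.mod_eq_of_lt (show j < r.length by omega), Nat.mod_eq_of_lt h, List.take_add,
      List.take_append_of_le_length (by simp; omega)]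
  · have h1 : (o + j % r.length) % r.length = o + j - r.length := by
      rw [Nat.add_mod_mod, Nat.mod_eq_sub_mod (by omega), Nat.mod_eq_of_lt (by omega)]
    rw [h1, List.take_append, List.take_of_length_le (l := r.drop o) (by simp; omega),
      ← List.append_assoc, List.take_append_drop, elt_append, elt_rel hr, one_mul, List.take_take]
    congr 3
    simp
    omega

end Presentation

/-- A word with the structure of a sequence of boundary arcs of cells and of filaments
`h · inner · h⁻¹`. An arc records the cell, the starting position in the relator, the subword read
and the remainder of the relator. -/
inductive Fo (S ι : Type)
  | nil : Fo S ι
  | arc (id : ι) (o : ℕ) (a e : Word S) (rest : Fo S ι) : Fo S ι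
  | fil (h : Word S) (inner rest : Fo S ι) : Fo S ι

namespace Fo

variable {S ι κ : Type}

/-- The underlying word. -/
def word : Fo S ι → Word S
  | nil => []
  | arc _ _ a _ rest => a ++ rest.word
  | fil h inner rest => h ++ inner.word ++ wordInv h ++ rest.word

/-- Concatenation. -/
def append : Fo S ι → Fo S ι → Fo S ι
  | nil, G => G
  | arc j o a e rest, G => arc j o a e (rest.append G)
  | fil h inner rest, G => fil h inner (rest.append G)

/-- Relabelling of the cells. -/
def map (f : ι → κ) : Fo S ι → Fo S κ
  | nil => nil
  | arc j o a e rest => arc (f j) o a e (rest.map f)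
  | fil h inner rest => fil h (inner.map f) (rest.map f)

/-- The number of arcs of a cell. -/
def cnt [DecidableEq ι] (k : ι) : Fo S ι → ℕ
  | nil => 0
  | arc j _ _ _ rest => (if k = j then 1 else 0) + rest.cnt k
  | fil _ inner rest => inner.cnt k + rest.cnt k

/-- The total length of the arcs of a cell. -/
def expo [DecidableEq ι] (k : ι) : Fo S ι → ℕ
  | nil => 0
  | arc j _ a _ rest => (if k = j then a.length else 0) + rest.expo k
  | fil _ inner rest => inner.expo k + rest.expo k

/-- Twice the number of arcs and filaments. -/
def cost : Fo S ι → ℕ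
  | nil => 0
  | arc _ _ _ _ rest => 2 + rest.cost
  | fil _ inner rest => 2 + inner.cost + rest.cost

@[simp] lemma word_append (F G : Fo S ι) : (F.append G).word = F.word ++ G.word := by
  induction F with
  | nil => rfl
  | arc j o a e rest ih => simp [append, word, ih]
  | fil h inner rest _ ih => simp [append, word, ih]

@[simp] lemma word_map (f : ι → κ) (F : Fo S ι) : (F.map f).word = F.word := by
  induction F with
  | nil => rfl
  | arc j o a e rest ih => simp [map, word, ih]
  | fil h inner rest ih' ih => simp [map, word, ih, ih']

@[simp] lemma cost_append (F G : Fo S ι) : (F.append G).cost = F.cost + G.cost := by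
  induction F with
  | nil => simp [append, cost]
  | arc j o a e rest ih => simp [append, cost, ih]; omega
  | fil h inner rest _ ih => simp [append, cost, ih]; omega

@[simp] lemma cost_map (f : ι → κ) (F : Fo S ι) : (F.map f).cost = F.cost := by
  induction F with
  | nil => rfl
  | arc j o a e rest ih => simp [map, cost, ih]
  | fil h inner rest ih' ih => simp [map, cost, ih, ih']

section Count
variable [DecidableEq ι] [DecidableEq κ]

@[simp] lemma cnt_append (k : ι) (F G : Fo S ι) : (F.append G).cnt k = F.cnt k + G.cnt k := by
  induction F with
  | nil => simp [append, cnt]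
  | arc j o a e rest ih => simp [append, cnt, ih]; omega
  | fil h inner rest _ ih => simp [append, cnt, ih]; omega

@[simp] lemma expo_append (k : ι) (F G : Fo S ι) : (F.append G).expo k = F.expo k + G.expo k := by
  induction F with
  | nil => simp [append, expo]
  | arc j o a e rest ih => simp [append, expo, ih]; omega
  | fil h inner rest _ ih => simp [append, expo, ih]; omega

lemma cnt_map {f : ι → κ} (hf : f.Injective) (k : ι) (F : Fo S ι) :
    (F.map f).cnt (f k) = F.cnt k := by
  induction F with
  | nil => rfl
  | arc j o a e rest ih => simp [map, cnt, ih, hf.eq_iff]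
  | fil h inner rest ih' ih => simp [map, cnt, ih, ih']

lemma expo_map {f : ι → κ} (hf : f.Injective) (k : ι) (F : Fo S ι) :
    (F.map f).expo (f k) = F.expo k := by
  induction F with
  | nil => rfl
  | arc j o a e rest ih => simp [map, expo, ih, hf.eq_iff]
  | fil h inner rest ih' ih => simp [map, expo, ih, ih']

end Count

lemma cnt_map_of_notMem [DecidableEq κ] {f : ι → κ} {k : κ} (hk : ∀ j, k ≠ f j) (F : Fo S ι) :
    (F.map f).cnt k = 0 := by
  induction F with
  | nil => rfl
  | arc j o a e rest ih => simp [map, cnt, ih, hk]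
  | fil h inner rest ih' ih => simp [map, cnt, ih, ih']

lemma expo_map_of_notMem [DecidableEq κ] {f : ι → κ} {k : κ} (hk : ∀ j, k ≠ f j) (F : Fo S ι) :
    (F.map f).expo k = 0 := by
  induction F with
  | nil => rfl
  | arc j o a e rest ih => simp [map, expo, ih, hk]
  | fil h inner rest ih' ih => simp [map, expo, ih, ih']

end Fo

section Validity

variable {S ι κ : Type} (P : C6Presentation S)

/-- Compatibility of an arc with the table of cells. -/
structure Tok (R : ι → Word S) (g : ι → P.Grp) (B : ι → Finset ℕ) (Q : ι → FreeGroup S → Prop)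
    (j : ι) (o : ℕ) (a e : Word S) (α ρ : FreeGroup S) : Prop where
  ne_nil : a ≠ []
  append_eq : a ++ e = (R j).rotate o
  start_mem : o % (R j).length ∈ B j
  end_mem : (o + a.length) % (R j).length ∈ B j
  vertex : P.pi α = vx P (g j) (R j) o
  area : Q j (α * (fg e)⁻¹ * ρ)

/-- Validity of all arcs and filaments, relative to the group elements read on the left and on the
right. -/
def Val (R : ι → Word S) (g : ι → P.Grp) (B : ι → Finset ℕ) (Q : ι → FreeGroup S → Prop)
    (T : FreeGroup S → FreeGroup S → Prop) : FreeGroup S → Fo S ι → FreeGroup S → Prop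
  | _, .nil, _ => True
  | α, .arc j o a e rest, γ =>
    Tok P R g B Q j o a e α (fg rest.word * γ) ∧ Val R g B Q T (α * fg a) rest γ
  | α, .fil h inner rest, γ => h ≠ [] ∧ T (fg inner.word) (α * fg rest.word * γ) ∧
    Val R g B Q T (α * fg h) inner ((fg h)⁻¹ * fg rest.word * γ) ∧
    Val R g B Q T (α * fg h * fg inner.word * (fg h)⁻¹) rest γ

variable {P}

lemma Val.map {R : ι → Word S} {g : ι → P.Grp} {B : ι → Finset ℕ} {Q : ι → FreeGroup S → Prop}
    {T : FreeGroup S → FreeGroup S → Prop} {R' : κ → Word S} {g' : κ → P.Grp}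
    {B' : κ → Finset ℕ} {Q' : κ → FreeGroup S → Prop}
    {T' : FreeGroup S → FreeGroup S → Prop} (f : ι → κ) (l k : FreeGroup S)
    (hR : ∀ j, R' (f j) = R j) (hg : ∀ j, g' (f j) = P.pi l * g j) (hB : ∀ j, B j ⊆ B' (f j))
    (hQ : ∀ j x, Q j x → Q' (f j) (l * x * k)) (hT : ∀ u x, T u x → T' u (l * x * k))
    {α γ : FreeGroup S} {F : Fo S ι} (h : Val P R g B Q T α F γ) :
    Val P R' g' B' Q' T' (l * α) (F.map f) (γ * k) := by
  induction F generalizing α γ with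
  | nil => trivial
  | arc j o a e rest ih =>
    obtain ⟨ht, h⟩ := h
    refine ⟨⟨ht.ne_nil, by rw [hR, ht.append_eq], ?_, ?_, ?_, ?_⟩, ?_⟩
    · rw [hR]; exact hB _ ht.start_mem
    · rw [hR]; exact hB _ ht.end_mem
    · rw [map_mul, ht.vertex, vx, vx, hR, hg, mul_assoc]
    · have := hQ _ _ ht.area
      simpa [mul_assoc] using this
    · simpa [mul_assoc] using ih h
  | fil h inner rest ih' ih =>
    obtain ⟨h0, ht, h1, h2⟩ := h
    refine ⟨h0, ?_, ?_, ?_⟩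
    · simpa [mul_assoc] using hT _ _ ht
    · simpa [mul_assoc] using ih' h1
    · simpa [mul_assoc] using ih h2

lemma Fo.map_id (F : Fo S ι) : F.map id = F := by
  induction F with
  | nil => rfl
  | arc j o a e rest ih => simp [Fo.map, ih]
  | fil h inner rest ih' ih => simp [Fo.map, ih, ih']

lemma Val.mono {R : ι → Word S} {g : ι → P.Grp} {B B' : ι → Finset ℕ}
    {Q : ι → FreeGroup S → Prop} {T : FreeGroup S → FreeGroup S → Prop} (hB : ∀ j, B j ⊆ B' j)
    {α γ : FreeGroup S} {F : Fo S ι} (h : Val P R g B Q T α F γ) : Val P R g B' Q T α F γ := by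
  have := h.map (R' := R) (g' := g) (B' := B') (Q' := Q) (T' := T) id 1 1 (by simp) (by simp)
    hB (by simp) (by simp)
  simpa [Fo.map_id] using this

lemma val_append {R : ι → Word S} {g : ι → P.Grp} {B : ι → Finset ℕ}
    {Q : ι → FreeGroup S → Prop} {T : FreeGroup S → FreeGroup S → Prop} {α γ : FreeGroup S}
    {F G : Fo S ι} : Val P R g B Q T α (F.append G) γ ↔
      Val P R g B Q T α F (fg G.word * γ) ∧ Val P R g B Q T (α * fg F.word) G γ := by
  induction F generalizing α with
  | nil => simp [Val, Fo.append, Fo.word, fg_nil]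
  | arc j o a e rest ih =>
    simp only [Val, Fo.append, ih, Fo.word, Fo.word_append, fg_append, mul_assoc, and_assoc]
  | fil h inner rest ih' ih =>
    simp only [Val, Fo.append, ih, Fo.word, Fo.word_append, fg_append, mul_assoc, and_assoc,
      fg_wordInv]

/-- The numerical constraints on the arcs of a structured word; `c` and `x` account for arcs kept
outside. -/
structure Counts [DecidableEq ι] (R : ι → Word S) (F : Fo S ι) (i : ι → ℕ) (B : ι → Finset ℕ)
    (c x : ι → ℕ) : Prop where
  card_le : ∀ j, (B j).card ≤ i j + F.cnt j + c j
  length_eq : ∀ j, ∃ gl, F.expo j + x j + gl = (R j).length ∧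
    (gl = 0 ∨ 6 * gl < i j * (R j).length)

end Validity

end GSC

namespace GSC

section Zip

variable {S ι : Type} {P : C6Presentation S}

/-- The area condition on arcs during the gluing of the cell `D` with relator `r`. -/
def ZipArea (P : C6Presentation S) (n : ℕ) (D : ι) (r : Word S) (j : ι) (z : FreeGroup S) : Prop :=
  (j = D → ∃ m < n, Ar P.rels m (fg r * z)) ∧ (j ≠ D → ∃ m, m + 1 < n ∧ Ar P.rels m z)

/-- The area condition on filaments during the gluing of a cell. -/
def ZipFil (P : C6Presentation S) (n : ℕ) (u v : FreeGroup S) : Prop :=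
  ∃ i j, i + j + 1 ≤ n ∧ Ar P.rels i u ∧ Ar P.rels j v

lemma glued_piece_lt {R : ι → Word S} (hR : ∀ j, R j ∈ P.rels) {n : ℕ} {D E : ι}
    {β σ p γ a e c : Word S} {o : ℕ} {z : FreeGroup S}
    (hmin : ∀ m < n, ¬ Ar P.rels m (fg (β ++ γ)))
    (hD : R D = β ++ wordInv σ ++ wordInv p) (hDne : R D ≠ [])
    (hae : a ++ e = (R E).rotate o) (hz : fg a * z = fg σ * fg γ)
    (hQ : ZipArea P n D (R D) E (fg p * (fg e)⁻¹ * z)) (hca : c <+: a) (hcσ : c <+: σ) :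
    6 * c.length < (R E).length ∧ 6 * c.length < (R D).length := by
  have hρ : wordInv (R D) = p ++ (σ ++ wordInv β) := by rw [hD]; simp
  have hρm : σ ++ wordInv β ++ p ∈ P.rels := rotate_mem' (hρ ▸ P.inv_mem _ (hR D))
  have hae' : a ++ e ∈ P.rels := hae ▸ P.rotate_mem _ (hR E) o
  have hl : (R E).length = (a ++ e).length := by rw [hae]; simp
  have hl' : (R D).length = (σ ++ wordInv β ++ p).length := by rw [hD]; simp; omega
  rw [hl, hl']
  refine piece_lt hae' hρm ?_ (hca.trans (List.prefix_append _ _))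
    (hcσ.trans ⟨wordInv β ++ p, by simp⟩)
  intro heq
  by_cases hED : E = D
  · subst hED
    obtain ⟨u, v, huv, hvu⟩ : ∃ u v, R E = u ++ v ∧ wordInv (R E) = v ++ u := by
      have h1 : (R E).rotate o = σ ++ wordInv β ++ p := hae ▸ heq
      have h2 : wordInv (R E) = ((R E).rotate o).rotate (σ ++ wordInv β).length := by
        rw [h1, hρ, List.rotate_append_length_eq]
      rw [List.rotate_rotate, ← List.rotate_mod] at h2
      have hlt : (o + (σ ++ wordInv β).length) % (R E).length < (R E).length :=
        Nat.mod_lt _ (List.length_pos_iff.2 hDne)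
      rw [List.rotate_eq_drop_append_take hlt.le] at h2
      exact ⟨_, _, (List.take_append_drop _ _).symm, h2⟩
    have := ne_rotate_wordInv (huv ▸ hR E) (huv ▸ hDne)
    rw [← huv] at this
    exact this hvu.symm
  · obtain ⟨m, hm, hA⟩ := hQ.2 hED
    refine hmin m (by omega) ?_
    convert hA using 1
    have h3 : z = (fg a)⁻¹ * (fg σ * fg γ) := by rw [← hz]; group
    have h4 : fg a * fg e = fg σ * (fg β)⁻¹ * fg p := by
      rw [← fg_append, heq, fg_append, fg_append, fg_wordInv]
    have h5 : (fg e)⁻¹ * (fg a)⁻¹ = (fg p)⁻¹ * fg β * (fg σ)⁻¹ := by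
      rw [← mul_inv_rev, h4]; group
    rw [h3, fg_append]
    calc fg β * fg γ = fg p * ((fg p)⁻¹ * fg β * (fg σ)⁻¹) * fg σ * fg γ := by group
      _ = _ := by rw [← h5]; group

/-- Gluing the cell `D` along the word `σ` onto a structured word. -/
theorem zip [Fintype ι] [DecidableEq ι] {R : ι → Word S} (hR : ∀ j, R j ∈ P.rels)
    {g : ι → P.Grp} {n : ℕ} {D : ι} (hg : g D = 1) {β γ : Word S}
    (hmin : ∀ m < n, ¬ Ar P.rels m (fg (β ++ γ))) (hDne : R D ≠ []) {F : Fo S ι} {σ p : Word S}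
    {i : ι → ℕ} {B : ι → Finset ℕ}
    (hD : R D = β ++ wordInv σ ++ wordInv p) (hF : F.word = σ ++ γ)
    (hV : Val P R g B (ZipArea P n D (R D)) (ZipFil P n) (fg p) F 1)
    (hC : Counts R F i B (Pi.single D 1) (Pi.single D (β.length + σ.length)))
    (hB : (β.length + σ.length) % (R D).length ∈ B D) :
    ∃ (F' : Fo S ι) (i' : ι → ℕ) (B' : ι → Finset ℕ), F'.word = γ ∧
      Val P R g B' (ZipArea P n D (R D)) (ZipFil P n) (fg (p ++ σ)) F' 1 ∧
      Counts R F' i' B' (Pi.single D 1) (Pi.single D β.length) ∧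
      β.length % (R D).length ∈ B' D ∧ (∀ j, B j ⊆ B' j) ∧
      F'.cost + ∑ j, i' j ≤ F.cost + ∑ j, i j + if γ = [] then 0 else 2 := by
  induction hn : σ.length using Nat.strong_induction_on generalizing σ p F i B with
  | _ N IH =>
  subst hn
  rcases eq_or_ne σ [] with rfl | hσ
  · exact ⟨F, i, B, by simpa using hF, by simpa using hV, by simpa using hC, by simpa using hB,
      fun j => subset_rfl, by omega⟩
  cases F with
  | nil => simp [Fo.word, hσ] at hF
  | arc E o a e rest =>
    obtain ⟨ht, hV⟩ := hV
    rw [mul_one] at ht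
    have hz : fg a * fg rest.word = fg σ * fg γ := by rw [← fg_append, ← fg_append, ← hF]; rfl
    have hpiece : ∀ c, c <+: a → c <+: σ → 6 * c.length < (R E).length ∧
        6 * c.length < (R D).length := fun c =>
      glued_piece_lt hR hmin hD hDne ht.append_eq hz ht.area
    have hsum : ∑ j, (i j + (Pi.single E 1 : ι → ℕ) j + (Pi.single D 1 : ι → ℕ) j)
        = ∑ j, i j + 2 := by
      simp [Finset.sum_add_distrib]
    have hcases : (∃ a', σ = a ++ a' ∧ rest.word = a' ++ γ) ∨
        ∃ c', c' ≠ [] ∧ a = σ ++ c' ∧ γ = c' ++ rest.word := by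
      rcases List.append_eq_append_iff.1 hF with h | ⟨c', h1, h2⟩
      · exact Or.inl h
      · rcases eq_or_ne c' [] with rfl | hc'
        · exact Or.inl ⟨[], by simpa using h1.symm, by simpa using h2.symm⟩
        · exact Or.inr ⟨c', hc', h1, h2⟩
    rcases hcases with ⟨a', rfl, hw⟩ | ⟨c', hc', rfl, rfl⟩
    · have hlt : a'.length < (a ++ a').length := by
        have := List.length_pos_iff.2 ht.ne_nil
        simp; omega
      obtain ⟨hpE, hpD⟩ := hpiece a (List.prefix_refl _) (List.prefix_append _ _)
      let B₁ : ι → Finset ℕ := Function.update B D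
        (insert ((β.length + a'.length) % (R D).length) (B D))
      have hB₁ : ∀ j, B j ⊆ B₁ j := fun j => by
        by_cases h : j = D
        · subst h; simp [B₁]
        · simp [B₁, h]
      have hcounts : Counts R rest
          (fun j => i j + (Pi.single E 1 : ι → ℕ) j + (Pi.single D 1 : ι → ℕ) j) B₁
          (Pi.single D 1) (Pi.single D (β.length + a'.length)) := by
        refine ⟨fun j => ?_, fun j => ?_⟩
        · have h1 := hC.card_le j
          simp only [Fo.cnt] at h1
          by_cases h : j = D
          · subst h
            have := Finset.card_insert_le ((β.length + a'.length) % (R j).length) (B j)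
            simp only [B₁, Function.update_self, Pi.single_eq_same, Pi.single_apply] at h1 ⊢
            split_ifs at h1 ⊢ <;> omega
          · simp only [B₁, Function.update_of_ne h, Pi.single_apply, h, if_false] at h1 ⊢
            split_ifs at h1 ⊢ <;> omega
        · obtain ⟨gl, h1, h2⟩ := hC.length_eq j
          refine ⟨gl + (if j = E then a.length else 0) + if j = D then a.length else 0, ?_, ?_⟩
          · simp only [Fo.expo, Pi.single_apply, List.length_append] at h1 ⊢
            split_ifs at h1 ⊢ <;> omega
          · simp only [Pi.single_apply]
            by_cases hE : j = E <;> by_cases hD : j = D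
            · subst hE; subst hD; simp only [if_true]; rcases h2 with h2 | h2 <;> right <;> nlinarith
            · subst hE; simp only [if_true, hD, if_false]
              rcases h2 with h2 | h2 <;> right <;> nlinarith
            · subst hD; simp only [if_true, hE, if_false]
              rcases h2 with h2 | h2 <;> right <;> nlinarith
            · simpa [hE, hD] using h2
      obtain ⟨F', i', B', h1, h2, h3, h4, h5, h6⟩ := IH _ hlt (p := p ++ a)
        (i := fun j => i j + (Pi.single E 1 : ι → ℕ) j + (Pi.single D 1 : ι → ℕ) j) (B := B₁)
        (by rw [hD]; simp) hw (by rw [fg_append]; exact hV.mono hB₁)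
        hcounts (by simp [B₁]) rfl
      refine ⟨F', i', B', h1, by simpa using h2, h3, h4, fun j => (hB₁ j).trans (h5 j), ?_⟩
      rw [hsum] at h6
      simp only [Fo.cost]
      omega
    · obtain ⟨hpE, hpD⟩ := hpiece σ (List.prefix_append _ _) (List.prefix_refl _)
      let B₁ : ι → Finset ℕ := fun j => B j ∪
        ((if j = E then {(o + σ.length) % (R E).length} else ∅) ∪
          if j = D then {β.length % (R D).length} else ∅)
      have hB₁ : ∀ j, B j ⊆ B₁ j := fun j => Finset.subset_union_left
      refine ⟨.arc E (o + σ.length) c' (e ++ σ) rest,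
        fun j => i j + (Pi.single E 1 : ι → ℕ) j + (Pi.single D 1 : ι → ℕ) j, B₁, rfl,
        ⟨⟨hc', ?_, by simp [B₁], ?_, ?_, ?_⟩, ?_⟩, ⟨fun j => ?_, fun j => ?_⟩, by simp [B₁], hB₁, ?_⟩
      · rw [← List.rotate_rotate, ← ht.append_eq, List.append_assoc, List.rotate_append_length_eq]
        simp
      · have := hB₁ _ ht.end_mem
        rwa [List.length_append, ← add_assoc] at this
      · have hle : σ.length ≤ (R E).length := by omega
        rw [vx_add (hR E) o hle, ← ht.vertex, ← ht.append_eq, List.append_assoc, List.take_left,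
          fg_append, map_mul, elt_eq_pi]
      · have := ht.area
        convert this using 2
        simp only [fg_append]; group
      · rw [fg_append, mul_assoc, ← fg_append σ c']; exact hV.mono hB₁
      · have h1 := hC.card_le j
        have h4 : (B₁ j).card ≤
            (B j).card + ((if j = E then 1 else 0) + if j = D then 1 else 0) := by
          refine (Finset.card_union_le _ _).trans (Nat.add_le_add_left ?_ _)
          refine (Finset.card_union_le _ _).trans (Nat.add_le_add ?_ ?_) <;> split_ifs <;> simp
        simp only [Fo.cnt, Pi.single_apply] at h1 ⊢
        split_ifs at h1 h4 ⊢ <;> omega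
      · obtain ⟨gl, h1, h2⟩ := hC.length_eq j
        refine ⟨gl + (if j = E then σ.length else 0) + if j = D then σ.length else 0, ?_, ?_⟩
        · simp only [Fo.expo, Pi.single_apply, List.length_append] at h1 ⊢
          split_ifs at h1 ⊢ <;> omega
        · simp only [Pi.single_apply]
          by_cases hE : j = E <;> by_cases hD : j = D
          · subst hE; subst hD; simp only [if_true]; rcases h2 with h2 | h2 <;> right <;> nlinarith
          · subst hE; simp only [if_true, hD, if_false]
            rcases h2 with h2 | h2 <;> right <;> nlinarith
          · subst hD; simp only [if_true, hE, if_false]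
            rcases h2 with h2 | h2 <;> right <;> nlinarith
          · simpa [hE, hD] using h2
      · rw [hsum, if_neg (by simp [hc'])]
        simp only [Fo.cost]
        omega
  | fil h inner rest =>
    obtain ⟨hne, hT, hV₁, hV₂⟩ := hV
    have hT' := hT
    obtain ⟨i₁, j₁, hij, hA₁, hA₂⟩ := hT'
    have hcases : (∃ σ', σ = h ++ σ' ∧ inner.word ++ (wordInv h ++ rest.word) = σ' ++ γ) ∨
        ∃ h', h' ≠ [] ∧ h = σ ++ h' ∧
          γ = h' ++ (inner.word ++ (wordInv h ++ rest.word)) := by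
      rw [Fo.word, List.append_assoc, List.append_assoc] at hF
      rcases List.append_eq_append_iff.1 hF with h | ⟨c', h1, h2⟩
      · exact Or.inl h
      · rcases eq_or_ne c' [] with rfl | hc'
        · exact Or.inl ⟨[], by simpa using h1.symm, by simpa using h2.symm⟩
        · exact Or.inr ⟨c', hc', h1, h2⟩
    rw [mul_one] at hA₂
    rcases hcases with ⟨σ', rfl, hw⟩ | ⟨h', hh', rfl, rfl⟩
    · have hlt : σ'.length < (h ++ σ').length := by
        have := List.length_pos_iff.2 hne
        simp; omega
      have hDr : R D = β ++ wordInv σ' ++ wordInv (p ++ h) := by rw [hD]; simp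
      have hrot : wordInv h ++ (wordInv p ++ β ++ wordInv σ') =
          (R D).rotate (β.length + σ'.length) := by
        have : (β ++ wordInv σ').length = β.length + σ'.length := by simp
        rw [← this, hDr, List.rotate_append_length_eq]
        simp
      have hBl : β.length + (h ++ σ').length = β.length + σ'.length + (wordInv h).length := by
        simp; omega
      have hrel := pi_rel (hR D)
      rw [hDr] at hrel
      simp only [fg_append, fg_wordInv, map_mul, map_inv] at hrel
      let B₁ : ι → Finset ℕ := Function.update B D
        (insert ((β.length + σ'.length) % (R D).length) (B D))
      have hB₁ : ∀ j, B j ⊆ B₁ j := fun j => by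
        by_cases h : j = D
        · subst h; simp [B₁]
        · simp [B₁, h]
      have hlen : (R D).length = β.length + σ'.length + h.length + p.length := by
        rw [hDr]; simp; omega
      have hhl := List.length_pos_iff.2 hne
      let F₁ : Fo S ι := inner.append (.arc D (β.length + σ'.length) (wordInv h)
        (wordInv p ++ β ++ wordInv σ') rest)
      have hval : Val P R g B₁ (ZipArea P n D (R D)) (ZipFil P n) (fg (p ++ h)) F₁ 1 := by
        rw [val_append]
        refine ⟨?_, ⟨by simpa using hne, hrot, by simp [B₁], ?_, ?_, ?_, ?_⟩, ?_⟩
        · simpa [Fo.word, fg_append, fg_wordInv] using hV₁.mono hB₁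
        · rw [← hBl]
          refine hB₁ _ ?_
          simpa using hB
        · rw [vx, hg, one_mul, Nat.mod_eq_of_lt (by omega), map_mul, hA₁.pi_eq_one, mul_one, hDr,
            List.take_append_of_le_length (by simp), List.take_of_length_le (by simp), elt_eq_pi]
          simp only [fg_append, fg_wordInv, map_mul, map_inv]
          rw [mul_inv_eq_one] at hrel
          exact hrel.symm
        · intro _
          refine ⟨i₁ + j₁, by omega, ?_⟩
          have hconj := (hA₁.conj (fg (R D) * fg p * fg h)).mul hA₂
          convert hconj using 1
          rw [hDr]
          simp only [fg_append, fg_wordInv]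
          group
        · exact fun h => absurd rfl h
        · have := hV₂.mono hB₁
          simpa [fg_append, fg_wordInv] using this
      have hcounts : Counts R F₁ i B₁ (Pi.single D 1) (Pi.single D (β.length + σ'.length)) := by
        refine ⟨fun j => ?_, fun j => ?_⟩
        · have h1 := hC.card_le j
          simp only [F₁, Fo.cnt, Fo.cnt_append] at h1 ⊢
          by_cases h : j = D
          · subst h
            have := Finset.card_insert_le ((β.length + σ'.length) % (R j).length) (B j)
            simp only [B₁, Function.update_self, if_true] at h1 ⊢
            omega
          · simp only [B₁, Function.update_of_ne h, h, if_false] at h1 ⊢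
            omega
        · obtain ⟨gl, h1, h2⟩ := hC.length_eq j
          refine ⟨gl, ?_, h2⟩
          simp only [F₁, Fo.expo, Fo.expo_append, Pi.single_apply, List.length_append, length_wordInv]
            at h1 ⊢
          split_ifs at h1 ⊢ <;> omega
      obtain ⟨F', i', B', h1, h2, h3, h4, h5, h6⟩ := IH _ hlt (p := p ++ h) (i := i) (B := B₁)
        (F := F₁) hDr (by simpa [F₁, Fo.word] using hw) hval hcounts (by simp [B₁]) rfl
      refine ⟨F', i', B', h1, by simpa using h2, h3, h4, fun j => (hB₁ j).trans (h5 j), ?_⟩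
      simp only [F₁, Fo.cost, Fo.cost_append] at h6 ⊢
      omega
    · have hrot : wordInv σ ++ (wordInv p ++ β) = (R D).rotate β.length := by
        rw [hD, List.append_assoc, List.rotate_append_length_eq]
        simp
      let B₁ : ι → Finset ℕ := Function.update B D (insert (β.length % (R D).length) (B D))
      have hB₁ : ∀ j, B j ⊆ B₁ j := fun j => by
        by_cases h : j = D
        · subst h; simp [B₁]
        · simp [B₁, h]
      have hrel := pi_rel (hR D)
      rw [hD] at hrel
      simp only [fg_append, fg_wordInv, map_mul, map_inv] at hrel
      have hlen : (R D).length = β.length + σ.length + p.length := by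
        rw [hD]; simp; omega
      have hσl := List.length_pos_iff.2 hσ
      refine ⟨.fil h' inner (.arc D β.length (wordInv σ) (wordInv p ++ β) rest), i, B₁,
        by simp [Fo.word], ⟨hh', ?_, ?_, ⟨by simpa using hσ, hrot, by simp [B₁], ?_, ?_, ?_, ?_⟩, ?_⟩,
        ⟨fun j => ?_, fun j => ?_⟩, by simp [B₁], hB₁, ?_⟩
      · convert hT using 1
        simp only [Fo.word, fg_append, fg_wordInv]
        group
      · have := hV₁.mono hB₁
        simpa [fg_append, fg_wordInv, Fo.word, mul_assoc] using this
      · rw [length_wordInv]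
        exact hB₁ _ hB
      · rw [vx, hg, one_mul, Nat.mod_eq_of_lt (by omega)]
        simp only [fg_append, map_mul, map_inv]
        rw [hA₁.pi_eq_one, hD, List.append_assoc, List.take_left, elt_eq_pi]
        rw [mul_inv_eq_one, mul_inv_eq_iff_eq_mul] at hrel
        rw [hrel]
        group
      · intro _
        refine ⟨i₁ + j₁, by omega, ?_⟩
        have hconj := (hA₁.conj (fg (R D) * fg p * fg σ * fg h')).mul hA₂
        convert hconj using 1
        rw [hD]
        simp only [fg_append, fg_wordInv]
        group
      · exact fun h => absurd rfl h
      · have := hV₂.mono hB₁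
        simpa [fg_append, fg_wordInv, mul_assoc] using this
      · have h1 := hC.card_le j
        simp only [Fo.cnt] at h1 ⊢
        by_cases h : j = D
        · subst h
          have := Finset.card_insert_le (β.length % (R j).length) (B j)
          simp only [B₁, Function.update_self, if_true] at h1 ⊢
          omega
        · simp only [B₁, Function.update_of_ne h, h, if_false] at h1 ⊢
          omega
      · obtain ⟨gl, h1, h2⟩ := hC.length_eq j
        refine ⟨gl, ?_, h2⟩
        simp only [Fo.expo, Pi.single_apply, length_wordInv] at h1 ⊢
        split_ifs at h1 ⊢ <;> omega
      · rw [if_neg (by simp [hh'])]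
        simp only [Fo.cost]
        omega

end Zip

end GSC

namespace GSC

variable {S : Type} {P : C6Presentation S}

variable (P) in
/-- A word decomposed into boundary arcs of relator cells and filaments, of area at most `n`. -/
structure Forest (n : ℕ) (x : Word S) where
  /-- the cells -/
  ι : Type
  [fin : Fintype ι]
  [dec : DecidableEq ι]
  /-- the relators -/
  R : ι → Word S
  /-- the base points -/
  g : ι → P.Grp
  /-- the number of interior pieces -/
  i : ι → ℕ
  /-- the boundary positions -/
  B : ι → Finset ℕ
  /-- the decomposition -/
  F : Fo S ι
  word_eq : F.word = x
  rel : ∀ j, R j ∈ P.rels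
  rel_ne_nil : ∀ j, R j ≠ []
  val : Val P R g B (fun _ z => ∃ m < n, Ar P.rels m z)
    (fun u v => ∃ i j, i + j ≤ n ∧ Ar P.rels i u ∧ Ar P.rels j v) 1 F 1
  counts : Counts R F i B 0 0

namespace Forest

attribute [instance] Forest.fin Forest.dec

variable {n : ℕ} {x : Word S}

/-- The curvature. -/
def phi (f : Forest P n x) : ℤ := 6 * Fintype.card f.ι - f.F.cost - ∑ j, (f.i j : ℤ)

variable (P) in
/-- The empty forest. -/
def nil (n : ℕ) : Forest P n ([] : Word S) where
  ι := Empty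
  R := Empty.elim
  g := Empty.elim
  i := Empty.elim
  B := Empty.elim
  F := .nil
  word_eq := rfl
  rel := fun j => j.elim
  rel_ne_nil := fun j => j.elim
  val := trivial
  counts := ⟨fun j => j.elim, fun j => j.elim⟩

@[simp] lemma phi_nil : (nil P n).phi = 0 := by
  have : IsEmpty (nil P n).ι := inferInstanceAs (IsEmpty Empty)
  have hF : (nil P n).F.cost = 0 := rfl
  simp [phi, hF, Fintype.card_eq_zero]

theorem exists_cell {m : ℕ} {β γ δ : Word S} (hβ : β ≠ []) (hr : β ++ δ ∈ P.rels)
    (hmin : ∀ m < n, ¬ Ar P.rels m (fg (β ++ γ))) (hmn : m < n)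
    (hA : Ar P.rels m (fg (wordInv δ ++ γ))) (f : Forest P m (wordInv δ ++ γ)) :
    ∃ f' : Forest P n (β ++ γ), f.phi + 4 - (if γ = [] then 0 else 2) ≤ f'.phi ∧
      ∀ h inner, f'.F ≠ .fil h inner .nil := by
  let R : Option f.ι → Word S := fun o => o.elim (β ++ δ) f.R
  let g : Option f.ι → P.Grp := fun o => o.elim 1 f.g
  let B : Option f.ι → Finset ℕ := fun o => o.elim {0} f.B
  let i : Option f.ι → ℕ := fun o => o.elim 0 f.i
  have hR : ∀ j, R j ∈ P.rels := by
    rintro (_ | j)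
    · exact hr
    · exact f.rel j
  have hV : Val P R g B (ZipArea P n none (R none)) (ZipFil P n) (fg []) (f.F.map some) 1 := by
    have := f.val.map (R' := R) (g' := g) (B' := B) (Q' := ZipArea P n none (R none))
      (T' := ZipFil P n) some 1 1 (fun _ => rfl) (fun j => by simp [g]) (fun _ => subset_rfl)
      (fun j z ⟨k, hk, hz⟩ => ⟨fun h => by simp at h, fun _ => ⟨k, by omega, by simpa using hz⟩⟩)
      (fun u v ⟨a, b, hab, h1, h2⟩ => ⟨a, b, by omega, h1, by simpa using h2⟩)
    simpa [fg_nil] using this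
  have hC : Counts R (f.F.map some) i B (Pi.single none 1)
      (Pi.single none (β.length + (wordInv δ).length)) := by
    have hs := Option.some_injective f.ι
    refine ⟨?_, ?_⟩
    · rintro (_ | j)
      · simp [B, i]
      · have := f.counts.card_le j
        simpa [B, i, Fo.cnt_map hs] using this
    · rintro (_ | j)
      · refine ⟨0, ?_, Or.inl rfl⟩
        rw [Fo.expo_map_of_notMem (by simp)]
        simp [R, length_wordInv]
      · have := f.counts.length_eq j
        simpa [R, i, Fo.expo_map hs] using this
  obtain ⟨F', i', B', h1, h2, h3, h4, h5, h6⟩ := zip hR (D := none) rfl hmin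
    (by simp [R, hβ]) (σ := wordInv δ) (p := []) (F := f.F.map some) (by simp [R])
    (by simp [f.word_eq]) hV hC (by simp [R, B])
  let g' : Option f.ι → P.Grp := fun j => P.pi (fg (β ++ δ)) * g j
  have hval := h2.map (R' := R) (g' := g') (B' := B')
    (Q' := fun _ z => ∃ m < n, Ar P.rels m z)
    (T' := fun u v => ∃ i j, i + j ≤ n ∧ Ar P.rels i u ∧ Ar P.rels j v) id (fg (β ++ δ)) 1
    (fun _ => rfl) (fun _ => rfl) (fun _ => subset_rfl)
    (fun j z hz => by
      by_cases hj : j = none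
      · simpa [R] using hz.1 hj
      · obtain ⟨m, hm, h⟩ := hz.2 hj
        exact ⟨1 + m, by omega, by simpa using (ar_of_mem hr).mul h⟩)
    (fun u v ⟨a, b, hab, h1, h2⟩ => ⟨a, 1 + b, by omega, h1, by
      simpa using (ar_of_mem hr).mul h2⟩)
  rw [Fo.map_id] at hval
  refine ⟨{
    ι := Option f.ι
    R := R
    g := g'
    i := i'
    B := B'
    F := .arc none 0 β δ F'
    word_eq := by simp [Fo.word, h1]
    rel := hR
    rel_ne_nil := ?_
    val := ⟨⟨hβ, by simp [R], ?_, by simpa using h4, ?_, ?_⟩, ?_⟩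
    counts := ⟨fun j => ?_, fun j => ?_⟩ }, ?_, by simp⟩
  · rintro (_ | j)
    · simp [R, hβ]
    · exact f.rel_ne_nil j
  · exact h5 _ (by simp [B])
  · simp [vx, g', g, pi_rel hr]
  · refine ⟨m, hmn, ?_⟩
    simpa [h1, fg_append, fg_wordInv] using hA
  · simpa [fg_append, fg_wordInv] using hval
  · have := h3.card_le j
    simp only [Fo.cnt, Pi.single_apply, Pi.zero_apply] at this ⊢
    omega
  · obtain ⟨gl, h, h'⟩ := h3.length_eq j
    refine ⟨gl, ?_, h'⟩
    simp only [Fo.expo, Pi.single_apply, Pi.zero_apply] at h ⊢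
    omega
  · simp only [phi, Fo.cost, Fintype.card_option]
    have hsum : ∑ j, i j = ∑ j, f.i j := by simp [Fintype.sum_option, i]
    rw [hsum, Fo.cost_map] at h6
    push_cast
    split_ifs at h6 ⊢ <;> zify at h6 <;> linarith

theorem exists_fil {k m : ℕ} {h b c : Word S} (hh : h ≠ []) (hkm : k + m ≤ n)
    (hb : Ar P.rels k (fg b)) (hc : Ar P.rels m (fg c)) (f₁ : Forest P k b) (f₂ : Forest P m c) :
    ∃ f : Forest P n (h ++ b ++ wordInv h ++ c), f.phi = f₁.phi + f₂.phi - 2 ∧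
      ∃ κ κ', f.F = .fil h (f₁.F.map κ) (f₂.F.map κ') := by
  let R : f₁.ι ⊕ f₂.ι → Word S := Sum.elim f₁.R f₂.R
  let g : f₁.ι ⊕ f₂.ι → P.Grp := Sum.elim (fun j => P.pi (fg h) * f₁.g j)
    (fun j => P.pi (fg h * fg b * (fg h)⁻¹) * f₂.g j)
  have hV₁ := f₁.val.map (R' := R) (g' := g) (B' := Sum.elim f₁.B f₂.B)
    (Q' := fun _ z => ∃ m < n, Ar P.rels m z)
    (T' := fun u v => ∃ i j, i + j ≤ n ∧ Ar P.rels i u ∧ Ar P.rels j v)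
    Sum.inl (fg h) ((fg h)⁻¹ * fg c) (fun _ => rfl) (fun _ => rfl) (fun _ => subset_rfl)
    (fun j z ⟨a, ha, hz⟩ => ⟨a + m, by omega, by
      have := (hz.conj (fg h)).mul hc
      simpa only [mul_assoc] using this⟩)
    (fun u v ⟨a, a', haa, h1, h2⟩ => ⟨a, a' + m, by omega, h1, by
      have := (h2.conj (fg h)).mul hc
      simpa only [mul_assoc] using this⟩)
  have hV₂ := f₂.val.map (R' := R) (g' := g) (B' := Sum.elim f₁.B f₂.B)
    (Q' := fun _ z => ∃ m < n, Ar P.rels m z)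
    (T' := fun u v => ∃ i j, i + j ≤ n ∧ Ar P.rels i u ∧ Ar P.rels j v)
    Sum.inr (fg h * fg b * (fg h)⁻¹) 1 (fun _ => rfl) (fun _ => rfl) (fun _ => subset_rfl)
    (fun j z ⟨a, ha, hz⟩ => ⟨k + a, by omega, by
      simpa using (hb.conj (fg h)).mul hz⟩)
    (fun u v ⟨a, a', haa, h1, h2⟩ => ⟨a, k + a', by omega, h1, by
      simpa using (hb.conj (fg h)).mul h2⟩)
  refine ⟨{
    ι := f₁.ι ⊕ f₂.ι
    R := R
    g := g
    i := Sum.elim f₁.i f₂.i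
    B := Sum.elim f₁.B f₂.B
    F := .fil h (f₁.F.map Sum.inl) (f₂.F.map Sum.inr)
    word_eq := by simp [Fo.word, f₁.word_eq, f₂.word_eq]
    rel := ?_
    rel_ne_nil := ?_
    val := ⟨hh, ⟨k, m, hkm, by simpa [f₁.word_eq] using hb, by simpa [f₂.word_eq] using hc⟩, ?_, ?_⟩
    counts := ⟨?_, ?_⟩ }, ?_, _, _, rfl⟩
  · rintro (j | j)
    · exact f₁.rel j
    · exact f₂.rel j
  · rintro (j | j)
    · exact f₁.rel_ne_nil j
    · exact f₂.rel_ne_nil j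
  · simpa [f₂.word_eq] using hV₁
  · simpa [f₁.word_eq] using hV₂
  · rintro (j | j)
    · have := f₁.counts.card_le j
      simpa [Fo.cnt, Fo.cnt_map Sum.inl_injective,
        Fo.cnt_map_of_notMem (f := Sum.inr) (k := Sum.inl j)] using this
    · have := f₂.counts.card_le j
      simpa [Fo.cnt, Fo.cnt_map Sum.inr_injective,
        Fo.cnt_map_of_notMem (f := Sum.inl) (k := Sum.inr j)] using this
  · rintro (j | j)
    · have := f₁.counts.length_eq j
      simpa [R, Fo.expo, Fo.expo_map Sum.inl_injective,
        Fo.expo_map_of_notMem (f := Sum.inr) (k := Sum.inl j)] using this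
    · have := f₂.counts.length_eq j
      simpa [R, Fo.expo, Fo.expo_map Sum.inr_injective,
        Fo.expo_map_of_notMem (f := Sum.inl) (k := Sum.inr j)] using this
  · simp [phi, Fo.cost]
    ring

theorem exists_merge (f : Forest P n x) {h h₀ : Word S} {inner rest : Fo S f.ι}
    (hF : f.F = .fil h (.fil h₀ inner .nil) rest) :
    ∃ f' : Forest P n x, f'.phi = f.phi + 2 ∧
      (rest = .nil → ∃ h inner, f'.F = .fil h inner .nil) := by
  have hw := f.word_eq
  have hV := f.val
  have hC := f.counts
  rw [hF] at hw hV hC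
  obtain ⟨hh, -, ⟨hh₀, hT, hV₁, -⟩, hV₂⟩ := hV
  refine ⟨{
    ι := f.ι
    R := f.R
    g := f.g
    i := f.i
    B := f.B
    F := .fil (h ++ h₀) inner rest
    word_eq := by simpa [Fo.word] using hw
    rel := f.rel
    rel_ne_nil := f.rel_ne_nil
    val := ⟨by simp [hh], ?_, ?_, ?_⟩
    counts := ⟨fun j => ?_, fun j => ?_⟩ }, ?_, fun h => ⟨_, _, congrArg _ h⟩⟩
  · simpa [Fo.word, fg_nil] using hT
  · simpa [fg_append, fg_nil, Fo.word, mul_assoc] using hV₁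
  · simpa [fg_append, fg_nil, Fo.word, fg_wordInv, mul_assoc] using hV₂
  · simpa [Fo.cnt] using hC.card_le j
  · simpa [Fo.expo] using hC.length_eq j
  · simp [phi, Fo.cost, hF]
    ring

end Forest

lemma Ar.exists_min {n : ℕ} {x : FreeGroup S} (h : Ar P.rels n x) :
    ∃ m ≤ n, Ar P.rels m x ∧ ∀ k < m, ¬ Ar P.rels k x := by
  classical
  exact ⟨Nat.find ⟨n, h⟩, Nat.find_min' _ h, Nat.find_spec (⟨n, h⟩ : ∃ n, Ar P.rels n x),
    fun k hk => Nat.find_min _ hk⟩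

/-- A reduced word left after cancelling the maximal common prefix of two reduced words. -/
lemma rd_cancel {β γ δ : Word S} (h₁ : Rd (β ++ γ)) (h₂ : Rd (β ++ δ))
    (h : ∀ x ∈ γ.head?, ∀ y ∈ δ.head?, x ≠ y) : Rd (wordInv δ ++ γ) := by
  rw [rd_append]
  refine ⟨h₂.right.wordInv, h₁.right, fun x hx y hy => ?_⟩
  rw [getLast?_wordInv, Option.mem_def, Option.map_eq_some_iff] at hx
  obtain ⟨z, hz, rfl⟩ := hx
  simpa using h y hy z hz

theorem exists_forest (n : ℕ) (x : Word S) (hx : Rd x) (hne : x ≠ []) (hA : Ar P.rels n (fg x))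
    (hmin : ∀ m < n, ¬ Ar P.rels m (fg x)) : ∃ f : Forest P n x, 2 ≤ f.phi ∧
      (4 ≤ f.phi ∨ ∃ h inner, f.F = .fil h inner .nil) := by
  obtain ⟨s, t, rfl⟩ := List.exists_cons_of_ne_nil hne
  obtain ⟨m, hm⟩ := hA
  rcases firstLetter m n hx hm with ⟨r', hr, n', hn', hA'⟩ |
    ⟨b, c, i, j, m₁, m₂, rfl, hb, hij, -, hA₁, hA₂⟩
  · obtain ⟨β, γ, δ, h1, h2, h3⟩ := exists_common_prefix (s :: t) (s :: r')
    have hβ : β ≠ [] := by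
      rintro rfl
      rw [List.nil_append] at h1 h2
      subst h1 h2
      simp at h3
    rw [h1] at hx hmin hA' ⊢
    rw [h2] at hr hA'
    have hy := rd_cancel hx (rd_rel hr) h3
    have hA'' : Ar P.rels n' (fg (wordInv δ ++ γ)) := by
      simpa [fg_append, fg_wordInv] using hA'
    obtain ⟨k, hk, hAk, hkmin⟩ := hA''.exists_min
    obtain ⟨f, hf⟩ : ∃ f : Forest P k (wordInv δ ++ γ), 0 ≤ f.phi ∧ (2 ≤ f.phi ∨ γ = []) := by
      by_cases h0 : wordInv δ ++ γ = []
      · rw [h0]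
        refine ⟨.nil P k, by simp, Or.inr ?_⟩
        simp at h0
        exact h0.2
      · obtain ⟨f, hf, -⟩ := exists_forest k _ hy h0 hAk hkmin
        exact ⟨f, by omega, Or.inl hf⟩
    obtain ⟨f', hf', -⟩ := Forest.exists_cell hβ hr hmin (by omega) hAk f
    have : 4 ≤ f'.phi := by
      split_ifs at hf' with h
      · omega
      · rcases hf.2 with h' | h'
        · omega
        · exact absurd h' h
    exact ⟨f', by omega, Or.inl this⟩
  · obtain ⟨k, hk, hAk, hkmin⟩ := Ar.exists_min ⟨_, hA₁⟩
    obtain ⟨l, hl, hAl, hlmin⟩ := Ar.exists_min ⟨_, hA₂⟩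
    have hx' : Rd ([s] ++ (b ++ ([letterInv s] ++ c))) := by simpa using hx
    have hlen : (s :: (b ++ letterInv s :: c)).length = b.length + c.length + 2 := by
      simp; omega
    obtain ⟨f₁, hf₁, hf₁'⟩ := exists_forest k b hx'.right.left hb hAk hkmin
    have key : ∀ f₂ : Forest P l c, ∃ f : Forest P n (s :: (b ++ letterInv s :: c)),
        2 + f₂.phi ≤ f.phi ∧ (c = [] → f₂.F = .nil → ∃ h inner, f.F = .fil h inner .nil) := by
      intro f₂
      obtain ⟨f, hf, κ, κ', hF⟩ := Forest.exists_fil (n := n) (h := [s]) (by simp) (by omega)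
        hAk hAl f₁ f₂
      have hw : [s] ++ b ++ wordInv [s] ++ c = s :: (b ++ letterInv s :: c) := by simp
      rw [← hw]
      rcases hf₁' with h4 | ⟨h, inner, hF₁⟩
      · exact ⟨f, by omega, fun _ h => ⟨_, _, by rw [hF, h]; rfl⟩⟩
      · rw [hF₁] at hF
        obtain ⟨f', hf', h'⟩ := f.exists_merge hF
        exact ⟨f', by omega, fun _ h => h' (by rw [h]; rfl)⟩
    rcases eq_or_ne c [] with rfl | hc
    · obtain rfl : l = 0 := by
        by_contra h
        exact hlmin 0 (by omega) (by rw [fg_nil]; exact Ar.one)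
      obtain ⟨f, hf, h⟩ := key (.nil P 0)
      rw [Forest.phi_nil] at hf
      exact ⟨f, by omega, Or.inr (h rfl rfl)⟩
    · obtain ⟨f₂, hf₂, -⟩ := exists_forest l c hx'.right.right.right hc hAl hlmin
      obtain ⟨f, hf, -⟩ := key f₂
      exact ⟨f, by omega, Or.inl (by omega)⟩
termination_by (n, x.length)
decreasing_by
  · simp_wf
    left; omega
  all_goals
    rw [Prod.lex_def]
    subst_vars
    simp only [List.length_cons, List.length_append]
    omega

end GSC

namespace GSC

variable {S : Type} {P : C6Presentation S}

variable (P) in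
/-- A nonempty reduced trivial word without proper nonempty trivial subwords. -/
structure PrimeWord (z : Word S) : Prop where
  ne_nil : z ≠ []
  rd : Rd z
  elt_eq : P.elt z = 1
  eq_of_infix : ∀ a b c, z = a ++ b ++ c → P.elt b = 1 → b = [] ∨ b = z

namespace PrimeWord

variable {z : Word S}

lemma eq_nil_of_infix (hz : PrimeWord P z) {a b c : Word S} (h : z = a ++ b ++ c)
    (hb : P.elt b = 1) (hac : a ++ c ≠ []) : b = [] := by
  refine (hz.eq_of_infix a b c h hb).resolve_right fun hbz => hac ?_
  have := congrArg List.length h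
  rw [hbz] at this
  simp only [List.length_append] at this
  rw [← List.length_eq_zero_iff, List.length_append]
  omega

lemma rotate_append {a b : Word S} (hz : PrimeWord P (a ++ b)) : PrimeWord P (b ++ a) := by
  rcases eq_or_ne a [] with rfl | ha
  · simpa using hz
  rcases eq_or_ne b [] with rfl | hb
  · simpa using hz
  have helt : P.elt (b ++ a) = 1 := by
    have := hz.elt_eq
    rw [elt_append] at this ⊢
    exact mul_eq_one_comm.1 this
  refine ⟨by simp [hb], ?_, helt, ?_⟩
  · rw [rd_append]
    refine ⟨hz.rd.right, hz.rd.left, fun x hx y hy hxy => ?_⟩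
    obtain ⟨b', rfl⟩ : ∃ b', b = b' ++ [x] := ⟨_, (List.dropLast_append_getLast? x hx).symm⟩
    obtain ⟨a', rfl⟩ : ∃ a', a = y :: a' := by
      cases a with
      | nil => simp at hy
      | cons s a => exact ⟨a, by simpa using hy⟩
    have h1 := hz.elt_eq
    have h2 : P.elt (a' ++ b') = 1 := by
      have h3 : y :: a' ++ (b' ++ [x]) = [y] ++ (a' ++ b') ++ wordInv [y] := by simp [hxy]
      rw [h3, elt_append, elt_append, elt_wordInv, mul_inv_eq_one, mul_eq_left] at h1
      exact h1
    have h3 := hz.eq_nil_of_infix (a := [y]) (c := [x]) (by simp) h2 (by simp)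
    simp only [List.append_eq_nil_iff] at h3
    obtain ⟨rfl, rfl⟩ := h3
    have := hz.rd
    simp [rd_cons_cons, hxy] at this
  · intro u w v h hw
    by_contra! hcon
    obtain ⟨hw0, hw1⟩ := hcon
    -- the complementary subword is also trivial
    have hvu : P.elt (v ++ u) = 1 := by
      rw [h, elt_append, elt_append, hw, mul_one] at helt
      rw [elt_append]
      exact mul_eq_one_comm.1 helt
    rw [List.append_assoc] at h
    rcases List.append_eq_append_iff.1 h with ⟨c, rfl, h2⟩ | ⟨c, rfl, h2⟩
    · exact hw0 (hz.eq_nil_of_infix (a := c) (b := w) (c := v ++ b) (by rw [h2]; simp) hw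
        (by simp [hb]))
    · rcases List.append_eq_append_iff.1 h2 with ⟨d, rfl, h3⟩ | ⟨d, rfl, rfl⟩
      · exact hw0 (hz.eq_nil_of_infix (a := a ++ u) (b := w) (c := d) (by simp) hw (by simp [ha]))
      · have h4 := hz.eq_nil_of_infix (a := d) (b := v ++ u) (c := c) (by simp) hvu
          (by simpa [and_comm] using hw0)
        simp only [List.append_eq_nil_iff] at h4
        obtain ⟨rfl, rfl⟩ := h4
        simp at hw1

lemma rotate {z : Word S} (hz : PrimeWord P z) (k : ℕ) : PrimeWord P (z.rotate k) := by
  rw [← List.rotate_mod, List.rotate_eq_drop_append_take (Nat.mod_lt _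
    (List.length_pos_iff.2 hz.ne_nil)).le]
  exact rotate_append (by rwa [List.take_append_drop])

end PrimeWord

namespace Fo

variable {ι : Type}

/-- There are no filaments. -/
def NoFil : Fo S ι → Prop
  | nil => True
  | arc _ _ _ _ rest => rest.NoFil
  | fil _ _ _ => False

/-- The cell owning the letter at a given position. -/
def owner : Fo S ι → ℕ → Option ι
  | nil, _ => none
  | arc j _ a _ rest, x => if x < a.length then some j else rest.owner (x - a.length)
  | fil _ _ _, _ => none

lemma owner_append {A : Fo S ι} (hA : A.NoFil) {j : ι} {o : ℕ} {a e : Word S} {C : Fo S ι} {x : ℕ}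
    (h₁ : A.word.length ≤ x) (h₂ : x < A.word.length + a.length) :
    (A.append (.arc j o a e C)).owner x = some j := by
  induction A generalizing x with
  | nil => simp_all [append, owner, word]
  | arc k o' a' e' rest ih =>
    simp only [append, owner, word, List.length_append] at h₁ h₂ ⊢
    rw [if_neg (by omega)]
    exact ih hA (by omega) (by omega)
  | fil => exact hA.elim

lemma noFil_append {A C : Fo S ι} : (A.append C).NoFil ↔ A.NoFil ∧ C.NoFil := by
  induction A with
  | nil => simp [append, NoFil]
  | arc k o' a' e' rest ih => simpa [append, NoFil] using ih
  | fil => simp [append, NoFil]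

variable [DecidableEq ι]

lemma expo_eq_zero {F : Fo S ι} {j : ι} (h : F.cnt j = 0) : F.expo j = 0 := by
  induction F with
  | nil => rfl
  | arc k o a e rest ih =>
    simp only [cnt, expo] at h ⊢
    split_ifs at h ⊢
    · omega
    · rw [ih (by omega)]
  | fil h' inner rest ih ih' =>
    simp only [cnt, expo] at h ⊢
    rw [ih (by omega), ih' (by omega)]

lemma exists_split {F : Fo S ι} (hF : F.NoFil) {j : ι} (h : F.cnt j ≠ 0) :
    ∃ (A : Fo S ι) (o : ℕ) (a e : Word S) (C : Fo S ι), F = A.append (.arc j o a e C) ∧ A.NoFil ∧ C.NoFil ∧ A.cnt j = 0 ∧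
      F.cnt j = 1 + C.cnt j ∧ F.expo j = a.length + C.expo j := by
  induction F with
  | nil => exact absurd rfl h
  | arc k o a e rest ih =>
    by_cases hk : j = k
    · subst hk
      exact ⟨.nil, o, a, e, rest, rfl, trivial, hF, rfl, by simp [cnt], by simp [expo]⟩
    · obtain ⟨A, o', a', e', C, rfl, hA, hC, h1, h2, h3⟩ := ih hF (by simpa [cnt, hk] using h)
      exact ⟨.arc k o a e A, o', a', e', C, rfl, hA, hC, by simpa [cnt, hk] using h1,
        by simpa [cnt, hk] using h2, by simpa [expo, hk] using h3⟩
  | fil => exact hF.elim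

lemma sum_cnt [Fintype ι] {F : Fo S ι} (hF : F.NoFil) : 2 * ∑ j, F.cnt j = F.cost := by
  induction F with
  | nil => simp [cnt, cost]
  | arc k o a e rest ih =>
    simp only [cnt, cost, Finset.sum_add_distrib, ← ih hF]
    simp
    omega
  | fil => exact hF.elim

end Fo

lemma noFil_of_prime {ι : Type} {R : ι → Word S} {g : ι → P.Grp} {B : ι → Finset ℕ}
    {Q : ι → FreeGroup S → Prop} {n : ℕ} {α γ : FreeGroup S} {F : Fo S ι} {z u v : Word S}
    (hz : PrimeWord P z) (h : z = u ++ F.word ++ v)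
    (hV : Val P R g B Q (fun u v => ∃ i j, i + j ≤ n ∧ Ar P.rels i u ∧ Ar P.rels j v) α F γ) :
    F.NoFil := by
  induction F generalizing u α with
  | nil => trivial
  | arc k o a e rest ih =>
    exact ih (u := u ++ a) (by simpa [Fo.word] using h) hV.2
  | fil k inner rest =>
    obtain ⟨hk, ⟨i, j, -, hi, -⟩, -, -⟩ := hV
    have h1 : inner.word = [] := hz.eq_nil_of_infix (a := u ++ k)
      (c := wordInv k ++ rest.word ++ v) (by simpa [Fo.word] using h)
      (by rw [elt_eq_pi]; exact hi.pi_eq_one) (by simp [hk])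
    have h2 : Rd (k ++ wordInv k) := by
      refine hz.rd.infix ⟨u, rest.word ++ v, ?_⟩
      simp [h, Fo.word, h1]
    have h3 := h2.eq_of_fg_eq rd_nil (by simp [fg_append, fg_wordInv, fg_nil])
    simp [hk] at h3

end GSC

namespace GSC

variable {S : Type} {P : C6Presentation S}

lemma vx_congr {g : P.Grp} {r : Word S} {k l : ℕ} (h : k % r.length = l % r.length) :
    vx P g r k = vx P g r l := by rw [vx, vx, h]

lemma Tok.vertex_end {ι : Type} {R : ι → Word S} {g : ι → P.Grp} {B : ι → Finset ℕ}
    {Q : ι → FreeGroup S → Prop} {j : ι} {o : ℕ} {a e : Word S} {α ρ : FreeGroup S}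
    (h : Tok P R g B Q j o a e α ρ) (hR : R j ∈ P.rels) :
    P.pi (α * fg a) = vx P (g j) (R j) (o + a.length) := by
  have hl := congrArg List.length h.append_eq
  rw [List.length_append, List.length_rotate] at hl
  rw [vx_add hR o (by omega), ← h.append_eq, List.take_left, map_mul, h.vertex, elt_eq_pi]

lemma eq_of_card_le_three {B : Finset ℕ} (hB : B.card ≤ 3) {a b c d : ℕ} (ha : a ∈ B) (hb : b ∈ B)
    (hc : c ∈ B) (hd : d ∈ B) : a = b ∨ c = d ∨ a = c ∨ b = d ∨ b = c ∨ d = a := by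
  by_contra! h
  have : ({a, b, c, d} : Finset ℕ) ⊆ B := by
    intro x hx
    simp only [Finset.mem_insert, Finset.mem_singleton] at hx
    rcases hx with rfl | rfl | rfl | rfl <;> assumption
  have := Finset.card_le_card this
  rw [Finset.card_insert_of_notMem, Finset.card_insert_of_notMem, Finset.card_insert_of_notMem,
    Finset.card_singleton] at this
  · omega
  all_goals simp; tauto

lemma eq_of_pi_eq {w : Word S} {x : FreeGroup S} (h : P.pi x = P.pi (x * fg w)) : P.elt w = 1 := by
  rw [map_mul, left_eq_mul] at h
  rw [elt_eq_pi, h]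

variable (P) in
/-- The cyclic subword of `z` of length `l` at position `s` is a long subword of a relator, of weight
`k`, all of whose letters are marked by `j`. -/
def LongArc {ι : Type} (z : Word S) (own : ℕ → Option ι) (j : ι) (k : ℤ) (s l : ℕ) (ρ : Word S) :
    Prop :=
  ρ ∈ P.rels ∧ l ≤ z.length ∧ (z.rotate s).take l <+: ρ ∧ (k + 2) * ρ.length < 6 * l ∧
    ∀ x, s ≤ x → x < s + l → own (x % z.length) = some j

lemma rotate_rel {r : Word S} (hr : r ∈ P.rels) (k : ℕ) : r.rotate k ∈ P.rels := P.rotate_mem _ hr _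

lemma take_rotate_append (u v w : Word S) :
    ((u ++ (v ++ w)).rotate u.length).take v.length = v := by
  rw [List.rotate_append_length_eq, List.append_assoc, List.take_left]

lemma append_prefix_rotate {r a₁ a₂ e₁ e₂ : Word S} {o₁ o₂ : ℕ} (h₁ : a₁ ++ e₁ = r.rotate o₁)
    (h₂ : a₂ ++ e₂ = r.rotate o₂) (h : (o₁ + a₁.length) % r.length = o₂ % r.length)
    (hl : a₁.length + a₂.length ≤ r.length) : a₁ ++ a₂ <+: r.rotate o₁ := by
  have hl₁ := congrArg List.length h₁
  rw [List.length_append, List.length_rotate] at hl₁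
  rw [← List.rotate_mod, ← h, List.rotate_mod, ← List.rotate_rotate, ← h₁,
    List.rotate_append_length_eq] at h₂
  rw [← h₁, List.prefix_append_right_inj]
  exact List.prefix_of_prefix_length_le ⟨e₂, h₂⟩ (List.prefix_append _ _) (by omega)

lemma Fo.append_assoc {ι : Type} (F G H : Fo S ι) :
    (F.append G).append H = F.append (G.append H) := by
  induction F with
  | nil => rfl
  | arc j o a e rest ih => simp [append, ih]
  | fil h inner rest _ ih => simp [append, ih]

lemma Forest.exists_longArc {n : ℕ} {z : Word S} (hz : PrimeWord P z) (f : Forest P n z) (j : f.ι)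
    (hpos : 0 < 6 - 2 * (f.F.cnt j : ℤ) - f.i j) : z ∈ P.rels ∨
      ∃ s l ρ, LongArc P z f.F.owner j (6 - 2 * (f.F.cnt j : ℤ) - f.i j) s l ρ := by
  have hF : f.F.NoFil := noFil_of_prime hz (u := []) (v := []) (by simp [f.word_eq]) f.val
  have hlen := List.length_pos_iff.2 (f.rel_ne_nil j)
  obtain ⟨gl, h1, h2⟩ := f.counts.length_eq j
  have hcard := f.counts.card_le j
  simp only [Pi.zero_apply, add_zero] at h1 hcard
  by_cases hc0 : f.F.cnt j = 0
  · rw [Fo.expo_eq_zero hc0] at h1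
    have : 6 * gl < f.i j * gl := by
      rcases h2 with h | h
      · omega
      · rwa [show gl = (f.R j).length by omega] at h ⊢
    have := lt_of_mul_lt_mul_right this (by omega)
    omega
  obtain ⟨A, o₁, a₁, e₁, C, hAF, hA, hC, -, hcnt, hexpo⟩ := Fo.exists_split hF hc0
  have hw := f.word_eq
  have hV := f.val
  rw [hAF] at hV hw
  rw [Fo.word_append, Fo.word] at hw
  rw [val_append] at hV
  obtain ⟨-, ht₁, hV₂⟩ := hV
  have hstart₁ := ht₁.vertex
  have hend₁ := ht₁.vertex_end (f.rel j)
  have hlen₁ := congrArg List.length ht₁.append_eq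
  have ha₁ := List.length_pos_iff.2 ht₁.ne_nil
  rw [List.length_append, List.length_rotate] at hlen₁
  by_cases hc1 : C.cnt j = 0
  · rw [Fo.expo_eq_zero hc1] at hexpo
    rcases h2 with h2 | h2
    · left
      have he : e₁ = [] := List.length_eq_zero_iff.1 (by omega)
      have har : a₁ ∈ P.rels := by
        have := ht₁.append_eq
        rw [he, List.append_nil] at this
        rw [this]; exact rotate_rel (f.rel j) _
      rwa [← (hz.eq_of_infix A.word a₁ C.word (by simp [← hw]) (elt_rel har)).resolve_left
        ht₁.ne_nil]
    · right
      refine ⟨A.word.length, a₁.length, (f.R j).rotate o₁, rotate_rel (f.rel j) _, ?_, ?_, ?_, ?_⟩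
      · rw [← hw]; simp; omega
      · have : (z.rotate A.word.length).take a₁.length = a₁ := by
          have h := take_rotate_append A.word a₁ C.word
          rwa [hw] at h
        rw [this, ← ht₁.append_eq]
        exact List.prefix_append _ _
      · rw [List.length_rotate, hcnt, hc1]
        push_cast
        zify at h1 h2 hexpo
        nlinarith
      · intro x hx hx'
        have hxz : x < z.length := by rw [← hw]; simp; omega
        rw [Nat.mod_eq_of_lt hxz, hAF]
        exact Fo.owner_append hA hx hx'
  obtain ⟨C, o₂, a₂, e₂, D, rfl, hC, hD, -, hcnt', hexpo'⟩ := Fo.exists_split hC hc1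
  have hc2 : D.cnt j = 0 := by omega
  have hB : (f.B j).card ≤ 3 := by omega
  rw [Fo.expo_eq_zero hc2] at hexpo'
  rw [val_append] at hV₂
  obtain ⟨-, ht₂, -⟩ := hV₂
  rw [Fo.word_append, Fo.word] at hw
  have hstart₂ := ht₂.vertex
  have hend₂ := ht₂.vertex_end (f.rel j)
  have hlen₂ := congrArg List.length ht₂.append_eq
  have ha₂ := List.length_pos_iff.2 ht₂.ne_nil
  rw [List.length_append, List.length_rotate] at hlen₂
  rw [one_mul] at *
  rcases eq_of_card_le_three hB ht₁.start_mem ht₁.end_mem ht₂.start_mem ht₂.end_mem with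
    h | h | h | h | h | h
  · rw [vx_congr h, ← hend₁] at hstart₁
    exact absurd (hz.eq_nil_of_infix (a := A.word) (b := a₁) (c := C.word ++ (a₂ ++ D.word))
      (by simp [← hw]) (eq_of_pi_eq hstart₁) (by simp [ht₂.ne_nil])) ht₁.ne_nil
  · rw [vx_congr h, ← hend₂] at hstart₂
    exact absurd (hz.eq_nil_of_infix (a := A.word ++ a₁ ++ C.word) (b := a₂) (c := D.word)
      (by simp [← hw]) (eq_of_pi_eq hstart₂) (by simp [ht₁.ne_nil])) ht₂.ne_nil
  · rw [vx_congr h, ← hstart₂, mul_assoc, ← fg_append] at hstart₁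
    have := hz.eq_nil_of_infix (a := A.word) (b := a₁ ++ C.word) (c := a₂ ++ D.word)
      (by simp [← hw]) (eq_of_pi_eq hstart₁) (by simp [ht₂.ne_nil])
    simp [ht₁.ne_nil] at this
  · rw [vx_congr h, ← hend₂, mul_assoc _ (fg C.word), ← fg_append] at hend₁
    have := hz.eq_nil_of_infix (a := A.word ++ a₁) (b := C.word ++ a₂) (c := D.word)
      (by simp [← hw]) (eq_of_pi_eq hend₁) (by simp [ht₁.ne_nil])
    simp [ht₂.ne_nil] at this
  · have hpre := append_prefix_rotate ht₁.append_eq ht₂.append_eq h (by omega)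
    rw [vx_congr h, ← hstart₂] at hend₁
    have hC0 := hz.eq_nil_of_infix (a := A.word ++ a₁) (b := C.word) (c := a₂ ++ D.word)
      (by simp [← hw]) (eq_of_pi_eq hend₁) (by simp [ht₁.ne_nil])
    rw [hC0, List.nil_append] at hw
    rcases h2 with h2 | h2
    · left
      have har : a₁ ++ a₂ ∈ P.rels := by
        rw [hpre.eq_of_length (by simp; omega)]; exact rotate_rel (f.rel j) _
      rwa [← (hz.eq_of_infix A.word (a₁ ++ a₂) D.word (by simp [← hw]) (elt_rel har)).resolve_left
        (by simp [ht₁.ne_nil])]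
    · right
      refine ⟨A.word.length, (a₁ ++ a₂).length, (f.R j).rotate o₁, rotate_rel (f.rel j) _, ?_, ?_,
        ?_, ?_⟩
      · rw [← hw]; simp; omega
      · have : (z.rotate A.word.length).take (a₁ ++ a₂).length = a₁ ++ a₂ := by
          have h := take_rotate_append A.word (a₁ ++ a₂) D.word
          rwa [List.append_assoc, hw] at h
        rwa [this]
      · rw [List.length_rotate, hcnt, hcnt', hc2, List.length_append]
        push_cast
        zify at h1 h2 hexpo hexpo'
        nlinarith
      · intro x hx hx'
        rw [List.length_append] at hx'
        have hxz : x < z.length := by rw [← hw]; simp; omega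
        rw [Nat.mod_eq_of_lt hxz, hAF]
        by_cases hx1 : x < A.word.length + a₁.length
        · exact Fo.owner_append hA hx hx1
        · have : A.append (.arc j o₁ a₁ e₁ (C.append (.arc j o₂ a₂ e₂ D))) =
              (A.append (.arc j o₁ a₁ e₁ C)).append (.arc j o₂ a₂ e₂ D) := by
            rw [Fo.append_assoc]; rfl
          rw [this]
          refine Fo.owner_append
            (Fo.noFil_append.2 ⟨hA, hC⟩ : (A.append (.arc j o₁ a₁ e₁ C)).NoFil) ?_ ?_ <;>
            simp [Fo.word, hC0] <;> omega
  · have hpre := append_prefix_rotate ht₂.append_eq ht₁.append_eq h (by omega)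
    rw [← vx_congr h, ← hend₂, mul_assoc, mul_assoc, ← fg_append, ← fg_append]
      at hstart₁
    have hz' := (hz.eq_of_infix A.word (a₁ ++ (C.word ++ a₂)) D.word (by simp [← hw])
      (eq_of_pi_eq hstart₁)).resolve_left (by simp [ht₁.ne_nil])
    obtain ⟨hA0, hD0⟩ : A.word = [] ∧ D.word = [] := by
      have h3 := congrArg List.length hz'
      have h4 := congrArg List.length hw
      simp only [List.length_append] at h3 h4
      constructor <;> rw [← List.length_eq_zero_iff] <;> omega
    rcases h2 with h2 | h2
    · left
      have har : a₂ ++ a₁ ∈ P.rels := by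
        rw [hpre.eq_of_length (by simp; omega)]; exact rotate_rel (f.rel j) _
      have hz'' : PrimeWord P (a₂ ++ (a₁ ++ C.word)) :=
        PrimeWord.rotate_append (by simpa [hz'] using hz)
      have h3 := (hz''.eq_of_infix [] (a₂ ++ a₁) C.word (by simp) (elt_rel har)).resolve_left
        (by simp [ht₁.ne_nil])
      have h4 : C.word = [] := by simpa using h3
      rw [← hz', h4, List.nil_append]
      exact rotate_mem' har
    · right
      refine ⟨a₁.length + C.word.length, (a₂ ++ a₁).length, (f.R j).rotate o₂,
        rotate_rel (f.rel j) _, ?_, ?_, ?_, ?_⟩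
      · rw [← hz']; simp; omega
      · have : (z.rotate (a₁.length + C.word.length)).take (a₂ ++ a₁).length = a₂ ++ a₁ := by
          have h := take_rotate_append (a₁ ++ C.word) a₂ []
          rw [List.append_nil, List.append_assoc, hz'] at h
          have h' : (z.rotate (a₁.length + C.word.length)) = a₂ ++ (a₁ ++ C.word) := by
            have := List.rotate_append_length_eq (a₁ ++ C.word) a₂
            rwa [List.append_assoc, hz', List.length_append] at this
          rw [h', ← List.append_assoc, List.take_left]
        rwa [this]
      · rw [List.length_rotate, hcnt, hcnt', hc2, List.length_append]
        push_cast
        zify at h1 h2 hexpo hexpo'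
        nlinarith
      · intro x hx hx'
        rw [List.length_append] at hx'
        have hzl : z.length = a₁.length + C.word.length + a₂.length := by
          have := congrArg List.length hz'
          simp only [List.length_append] at this
          omega
        rw [hAF]
        by_cases hx1 : x < z.length
        · have : A.append (.arc j o₁ a₁ e₁ (C.append (.arc j o₂ a₂ e₂ D))) =
              (A.append (.arc j o₁ a₁ e₁ C)).append (.arc j o₂ a₂ e₂ D) := by
            rw [Fo.append_assoc]; rfl
          rw [this, Nat.mod_eq_of_lt hx1]
          refine Fo.owner_append
            (Fo.noFil_append.2 ⟨hA, hC⟩ : (A.append (.arc j o₁ a₁ e₁ C)).NoFil) ?_ ?_ <;>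
            simp [Fo.word, hA0] <;> omega
        · rw [Nat.mod_eq_sub_mod (by omega), Nat.mod_eq_of_lt (by omega)]
          refine Fo.owner_append hA ?_ ?_ <;> simp [hA0] <;> omega

end GSC

namespace GSC

variable {S : Type} {P : C6Presentation S}

lemma of_rotate_mem {z : Word S} {k : ℕ} (h : z.rotate k ∈ P.rels) : z ∈ P.rels := by
  rcases eq_or_ne z [] with rfl | hz
  · simpa using h
  have := List.length_pos_iff.2 hz
  have hk := (Nat.mod_lt k this).le
  have := P.rotate_mem _ h (z.length - k % z.length)
  rw [← List.rotate_mod z k, List.rotate_rotate] at this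
  rwa [show k % z.length + (z.length - k % z.length) = z.length by omega,
    List.rotate_length] at this

lemma fg_append_comm (a b : Word S) : fg (b ++ a) = (fg a)⁻¹ * fg (a ++ b) * fg a := by
  simp only [fg_append]; group

lemma Ar.append_comm {n : ℕ} {a b : Word S} (h : Ar P.rels n (fg (a ++ b))) :
    Ar P.rels n (fg (b ++ a)) := by
  rw [fg_append_comm]
  simpa using h.conj (fg a)⁻¹

lemma rotate_eq_append (z : Word S) (k : ℕ) : ∃ a b, z = a ++ b ∧ z.rotate k = b ++ a := by
  rcases eq_or_ne z [] with rfl | hz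
  · exact ⟨[], [], rfl, by simp⟩
  refine ⟨z.take (k % z.length), z.drop (k % z.length), by simp, ?_⟩
  rw [← List.rotate_mod, List.rotate_eq_drop_append_take (Nat.mod_lt _ (List.length_pos_iff.2 hz)).le]

lemma ar_rotate_iff {n : ℕ} {z : Word S} {k : ℕ} :
    Ar P.rels n (fg (z.rotate k)) ↔ Ar P.rels n (fg z) := by
  obtain ⟨a, b, rfl, h⟩ := rotate_eq_append z k
  rw [h]
  exact ⟨Ar.append_comm, Ar.append_comm⟩

/-- A cyclic conjugate of a prime word either is a relator or bounds a forest of curvature at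
least six. -/
theorem PrimeWord.exists_forest {z : Word S} (hz : PrimeWord P z) :
    z ∈ P.rels ∨ ∃ k n, ∃ f : Forest P n (z.rotate k), 6 ≤ f.phi := by
  obtain ⟨n₀, hn₀⟩ := (pi_eq_one_iff P).1 (by rw [← elt_eq_pi]; exact hz.elt_eq : P.pi (fg z) = 1)
  obtain ⟨n, -, hn, hmin⟩ := hn₀.exists_min
  let Q : ℕ → Prop := fun ℓ => ∃ k β γ δ, z.rotate k = β ++ γ ∧ β ++ δ ∈ P.rels ∧ β.length = ℓ ∧
    1 ≤ ℓ ∧ ∃ m < n, Ar P.rels m (fg (wordInv δ ++ γ))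
  have hQbd : ∀ ℓ, Q ℓ → ℓ ≤ z.length := by
    rintro ℓ ⟨k, β, γ, δ, h1, -, rfl, -⟩
    have := congrArg List.length h1
    simp at this; omega
  have hQ : Q 1 := by
    obtain ⟨s, t, rfl⟩ := List.exists_cons_of_ne_nil hz.ne_nil
    obtain ⟨m, hm⟩ := hn
    rcases firstLetter m n hz.rd hm with ⟨r', hr, n', hn', hA'⟩ |
      ⟨b, c, i, j, m₁, m₂, rfl, hb, hij, -, hA₁, hA₂⟩
    · refine ⟨0, [s], t, r', by simp, hr, rfl, le_rfl, n', hn', ?_⟩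
      rw [fg_append, fg_wordInv]
      rw [fg_cons, fg_cons s t] at hA'
      convert hA' using 1
      group
    · refine absurd (hz.eq_nil_of_infix (a := [s]) (b := b) (c := letterInv s :: c) (by simp) ?_
        (by simp)) hb
      rw [elt_eq_pi]
      exact Ar.pi_eq_one ⟨_, hA₁⟩
  classical
  have hbd := hQbd 1 hQ
  obtain ⟨k, β, γ, δ, h1, h2, h3, h4, m, hmn, h5⟩ : Q (Nat.findGreatest Q z.length) :=
    Nat.findGreatest_spec hbd hQ
  have hmax : ∀ ℓ, Q ℓ → ℓ ≤ β.length := fun ℓ hℓ => h3 ▸ Nat.le_findGreatest (hQbd ℓ hℓ) hℓ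
  clear h3 h4
  have hβ : β ≠ [] := by
    rintro rfl
    have := hmax 1 hQ
    simp at this
  have hz' := hz.rotate k
  have hmin' : ∀ m < n, ¬ Ar P.rels m (fg (β ++ γ)) := by
    intro m hm h
    rw [← h1, ar_rotate_iff] at h
    exact hmin m hm h
  rw [h1] at hz'
  rcases eq_or_ne δ [] with rfl | hδ
  · left
    rw [List.append_nil] at h2
    have := hz'.eq_of_infix [] β γ rfl (elt_rel h2)
    have := this.resolve_left hβ
    rw [this, ← h1] at h2
    exact of_rotate_mem h2
  right
  have hy : Rd (wordInv δ ++ γ) := by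
    refine rd_cancel hz'.rd (rd_rel h2) fun x hx y hy hxy => ?_
    subst hxy
    obtain ⟨γ', rfl⟩ : ∃ γ', γ = x :: γ' := by
      cases γ with
      | nil => simp at hx
      | cons a γ => exact ⟨γ, by simpa using hx⟩
    obtain ⟨δ', rfl⟩ : ∃ δ', δ = x :: δ' := by
      cases δ with
      | nil => simp at hy
      | cons a γ => exact ⟨γ, by simpa using hy⟩
    have := hmax (β.length + 1) ⟨k, β ++ [x], γ', δ', by simpa using h1, by simpa using h2,
      by simp, by omega, m, hmn, ?_⟩
    · omega
    · convert h5 using 1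
      rw [← List.singleton_append (l := γ'), ← List.singleton_append (l := δ')]
      simp only [fg_append, fg_wordInv]
      group
  obtain ⟨l, hl, hAl, hlmin⟩ := h5.exists_min
  obtain ⟨f, hf⟩ := GSC.exists_forest (P := P) l _ hy (by simp [wordInv_eq_nil, hδ]) hAl hlmin
  obtain ⟨f', hf', -⟩ := Forest.exists_cell hβ h2 hmin' (by omega) hAl f
  suffices h6 : 6 ≤ f'.phi by
    refine ⟨k, n, ?_⟩
    rw [h1]
    exact ⟨f', h6⟩
  split_ifs at hf' with hγ
  · omega
  suffices 4 ≤ f.phi by omega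
  refine hf.2.resolve_right ?_
  rintro ⟨h, inner, hF⟩
  have hV := f.val
  have hw := f.word_eq
  rw [hF] at hV hw
  have hh : h ≠ [] := hV.1
  obtain ⟨s, h', rfl⟩ := List.exists_cons_of_ne_nil hh
  obtain ⟨γ', x, rfl⟩ : ∃ γ' x, γ = γ' ++ [x] :=
    ⟨_, _, (List.dropLast_append_getLast hγ).symm⟩
  obtain ⟨δ', y, rfl⟩ : ∃ γ' x, δ = γ' ++ [x] :=
    ⟨_, _, (List.dropLast_append_getLast hδ).symm⟩
  have e1 := congrArg List.head? hw
  have e2 := congrArg List.getLast? hw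
  simp [Fo.word] at e1 e2
  subst e1
  simp [List.getLast?_cons] at e2
  subst e2
  have := hmax (β.length + 1) ⟨k + (β ++ γ').length, y :: β, γ', δ', ?_, ?_, by simp, by omega, m, hmn, ?_⟩
  · omega
  · rw [← List.rotate_rotate, h1, ← List.append_assoc, List.rotate_append_length_eq]; simp
  · rw [← List.append_assoc] at h2
    simpa using rotate_mem' h2
  · convert h5.conj (fg [y]) using 1
    simp only [fg_append, fg_wordInv]
    group

/-- The version of Greendlinger's lemma for prime words: the curvature is concentrated on cells
with long arcs. -/
theorem PrimeWord.exists_longArc {z : Word S} (hz : PrimeWord P z) :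
    z ∈ P.rels ∨ ∃ (ι : Type) (_ : Fintype ι) (κ : ι → ℤ) (own : ℕ → Option ι), 6 ≤ ∑ j, κ j ∧
      ∀ j, 0 < κ j → ∃ s l ρ, LongArc P z own j (κ j) s l ρ := by
  rcases hz.exists_forest with h | ⟨k, n, f, hf⟩
  · exact Or.inl h
  have hz' := hz.rotate k
  by_cases hzr : z.rotate k ∈ P.rels
  · exact Or.inl (of_rotate_mem hzr)
  right
  have hF : f.F.NoFil := noFil_of_prime hz' (u := []) (v := []) (by simp [f.word_eq]) f.val
  have hL := List.length_pos_iff.2 hz.ne_nil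
  refine ⟨f.ι, f.fin, fun j => 6 - 2 * (f.F.cnt j : ℤ) - f.i j,
    fun x => f.F.owner ((x + (z.length - k % z.length)) % z.length), ?_, fun j hj => ?_⟩
  · have := Fo.sum_cnt hF
    rw [Forest.phi, ← this] at hf
    simp only [Finset.sum_sub_distrib, ← Finset.mul_sum]
    push_cast at hf
    simpa [mul_comm] using hf
  · obtain ⟨s, l, ρ, h1, h2, h3, h4, h5⟩ := (f.exists_longArc hz' j hj).resolve_left hzr
    simp only [List.length_rotate] at h2 h5
    refine ⟨k + s, l, ρ, h1, h2, by rwa [List.rotate_rotate] at h3, h4, fun x hx hx' => ?_⟩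
    have := h5 (x - k) (by omega) (by omega)
    rw [← this]
    have hk := Nat.mod_lt k hL
    have hk' := Nat.div_add_mod k z.length
    beta_reduce
    rw [Nat.mod_add_mod]
    rw [show x + (z.length - k % z.length) = (x - k) + (k / z.length + 1) * z.length by
      have : z.length * (k / z.length) = k / z.length * z.length := mul_comm _ _
      rw [add_mul]; omega]
    simp

end GSC

namespace GSC

variable {S : Type} {P : C6Presentation S}

variable (P) in
/-- Subwords of relators contained in `w` take up at most `k` sixths of the relator. -/
def Bd (k : ℕ) (w : Word S) : Prop :=
  ∀ t, t <:+: w → ∀ ρ ∈ P.rels, t <+: ρ → 6 * t.length ≤ k * ρ.length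

lemma Bd.of_infix {k : ℕ} {v w : Word S} (h : Bd P k w) (hv : v <:+: w) : Bd P k v :=
  fun t ht => h t (ht.trans hv)

lemma Bd.infix_rel {k : ℕ} {w t ρ : Word S} (h : Bd P k w) (ht : t <:+: w) (hρ : ρ ∈ P.rels)
    (htρ : t <:+: ρ) : 6 * t.length ≤ k * ρ.length := by
  obtain ⟨a, b, rfl⟩ := htρ
  have h1 : t ++ (b ++ a) ∈ P.rels := by
    rw [List.append_assoc] at hρ
    simpa using rotate_mem' hρ
  have := h t ht _ h1 (List.prefix_append _ _)
  simpa [add_comm, add_left_comm, add_assoc] using this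

lemma infix_wordInv_iff {u v : Word S} : wordInv u <:+: wordInv v ↔ u <:+: v := by
  have h : ∀ {u v : Word S}, u <:+: v → wordInv u <:+: wordInv v := by
    rintro u _ ⟨a, b, rfl⟩
    exact ⟨wordInv b, wordInv a, by simp⟩
  exact ⟨fun h' => by simpa using h h', h⟩

lemma Bd.wordInv {k : ℕ} {w : Word S} (h : Bd P k w) : Bd P k (wordInv w) := by
  intro t ht ρ hρ htρ
  have h1 : GSC.wordInv t <:+: w := by rw [← infix_wordInv_iff]; simpa using ht
  have := h.infix_rel h1 (P.inv_mem ρ hρ) (infix_wordInv_iff.2 htρ.isInfix)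
  simpa using this

lemma bd_nil (k : ℕ) : Bd P k ([] : Word S) := by
  intro t ht ρ _ _
  simp [List.infix_nil.1 ht]

/-- A subword of a relator occupying at most `k` sixths satisfies `Bd k`. -/
lemma bd_of_rel {k : ℕ} (hk : 1 ≤ k) {x y : Word S} (h : x ++ y ∈ P.rels)
    (hl : 6 * x.length ≤ k * (x ++ y).length) : Bd P k x := by
  rintro t ⟨a, b, rfl⟩ ρ hρ htρ
  by_cases hne : t ++ (b ++ y ++ a) = ρ
  · subst hne
    simp only [List.length_append] at hl ⊢
    have : t.length + (b.length + y.length + a.length) = a.length + t.length + b.length + y.length := by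
      ring
    rw [this]
    omega
  · have h1 : t ++ (b ++ y ++ a) ∈ P.rels := by
      have : a ++ (t ++ (b ++ y)) ∈ P.rels := by simpa using h
      simpa using rotate_mem' this
    have := P.small_cancellation ρ hρ t htρ ⟨_, h1, ρ, hρ, hne, List.prefix_append _ _, htρ⟩
    nlinarith

section Arc

variable {ι : Type} {z : Word S} {own : ℕ → Option ι} {j : ι} {k : ℤ} {s l : ℕ} {ρ : Word S}

lemma LongArc.mod (h : LongArc P z own j k s l ρ) :
    LongArc P z own j k (s % z.length) l ρ := by
  obtain ⟨h1, h2, h3, h4, h5⟩ := h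
  refine ⟨h1, h2, by rwa [List.rotate_mod], h4, fun x hx hx' => ?_⟩
  have hd := Nat.mod_add_div s z.length
  have := h5 (x + z.length * (s / z.length)) (by omega) (by omega)
  simpa using this

lemma LongArc.take_eq (h : LongArc P z own j k s l ρ) (hs : s < z.length) :
    (z.rotate s).take l = ((z ++ z).drop s).take l := by
  rw [List.rotate_eq_drop_append_take hs.le, List.drop_append_of_le_length hs.le]
  conv_rhs => rw [← List.take_append_drop s z, List.drop_append_of_le_length (by simp; omega)]
  rw [← List.append_assoc, List.take_append_of_le_length (l₂ := z.drop s)]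
  · simp
  · have := h.2.1
    simp; omega

lemma LongArc.length_le (h : LongArc P z own j k s l ρ) : l ≤ ρ.length := by
  have := h.2.2.1.length_le
  have h2 := h.2.1
  simp only [List.length_take, List.length_rotate] at this
  omega

lemma LongArc.weight_le (h : LongArc P z own j k s l ρ) : k ≤ 3 := by
  have h1 := h.length_le
  have h2 := h.2.2.2.1
  by_contra! hk
  zify at h1
  nlinarith

lemma LongArc.block (h : LongArc P z own j k s l ρ) (hs : s < z.length) {m : ℕ}
    (X W Y : Word S) (hzz : z ++ z = X ++ (W ++ Y)) (hW : Bd P m W) :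
    6 * (min (s + l) (X.length + W.length) - max s X.length) ≤ m * ρ.length := by
  set a := max s X.length
  set e := min (s + l) (X.length + W.length)
  rcases le_or_gt e a with hea | hea
  · simp [Nat.sub_eq_zero_of_le hea]
  have hlen := congrArg List.length hzz
  simp only [List.length_append] at hlen
  have ht : (((z ++ z).drop a).take (e - a)).length = e - a := by
    simp only [List.length_take, List.length_drop, List.length_append]
    omega
  rw [← ht]
  refine hW.infix_rel ?_ h.1 ?_
  · rw [hzz, List.drop_append, List.drop_eq_nil_of_le (by omega), List.nil_append,
      List.drop_append_of_le_length (by omega), List.take_append_of_le_length (by simp; omega)]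
    exact (List.take_prefix _ _).isInfix.trans (List.drop_suffix _ _).isInfix
  · have h3 := h.2.2.1
    rw [h.take_eq hs] at h3
    refine List.IsInfix.trans ?_ h3.isInfix
    have : ((z ++ z).drop a).take (e - a) =
        ((((z ++ z).drop s).take l).drop (a - s)).take (e - a) := by
      rw [List.drop_take, List.drop_drop, List.take_take, show s + (a - s) = a by omega,
        show min (e - a) (l - (a - s)) = e - a by omega]
    rw [this]
    exact (List.take_prefix _ _).isInfix.trans (List.drop_suffix _ _).isInfix

variable (P) in
/-- The cell `j` has a long arc with the position `c` in its interior. -/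
def Corner (z : Word S) (own : ℕ → Option ι) (κ : ι → ℤ) (c : ℕ) (j : ι) : Prop :=
  ∃ s l ρ, LongArc P z own j (κ j) s l ρ ∧
    (s < c ∧ c < s + l ∨ s < c + z.length ∧ c + z.length < s + l)

lemma Corner.own_eq {κ : ι → ℤ} {c : ℕ} (h : Corner P z own κ c j) :
    own (c % z.length) = some j := by
  obtain ⟨s, l, ρ, h1, h2 | h2⟩ := h
  · exact h1.2.2.2.2 c h2.1.le h2.2
  · simpa using h1.2.2.2.2 (c + z.length) h2.1.le h2.2

open Classical in
lemma sum_corner_le [Fintype ι] (κ : ι → ℤ) (c : ℕ) :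
    ∑ j, (if Corner P z own κ c j then (1 : ℤ) else 0) ≤ 1 := by
  by_cases h : ∃ j, Corner P z own κ c j
  · obtain ⟨j, hj⟩ := h
    rw [Finset.sum_eq_single j]
    · split_ifs <;> simp
    · intro i _ hij
      rw [if_neg]
      intro hi
      have := hi.own_eq.symm.trans hj.own_eq
      simp_all
    · simp
  · push Not at h
    simp [h]

end Arc

open Classical in
lemma not_primeWord_append {p u : Word S} (hp : Bd P 1 p) (hu : Bd P 3 u) :
    ¬ PrimeWord P (p ++ u) := by
  intro hz
  have hL := List.length_pos_iff.2 hz.ne_nil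
  rcases hz.exists_longArc with h | ⟨ι, _, κ, own, h6, h⟩
  · have h1 := hp.infix_rel (List.infix_refl _) h (List.prefix_append _ _).isInfix
    have h2 := hu.infix_rel (List.infix_refl _) h (List.suffix_append _ _).isInfix
    simp only [List.length_append] at h1 h2 hL
    omega
  · have : ∀ j, κ j ≤ 3 * (if Corner P (p ++ u) own κ 0 j then (1 : ℤ) else 0) +
        if Corner P (p ++ u) own κ p.length j then (1 : ℤ) else 0 := by
      intro j
      rcases le_or_gt (κ j) 0 with hj | hj
      · split_ifs <;> omega
      obtain ⟨s, l, ρ, ha⟩ := h j hj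
      replace ha := ha.mod
      set t := s % (p ++ u).length
      have ht : t < (p ++ u).length := Nat.mod_lt _ hL
      have b1 := ha.block ht [] p (u ++ (p ++ u)) (by simp) hp
      have b2 := ha.block ht p u (p ++ u) (by simp) hu
      have b3 := ha.block ht (p ++ u) p u (by simp) hp
      have b4 := ha.block ht (p ++ (u ++ p)) u [] (by simp) hu
      have h1 := ha.length_le
      have h2 := ha.weight_le
      have h3 := ha.2.2.2.1
      have h4 := ha.2.1
      simp only [List.length_append, List.length_nil] at *
      have c1 : ¬ Corner P (p ++ u) own κ 0 j → ¬ (p.length + u.length < t + l) := by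
        intro hc hc'
        refine hc ⟨t, l, ρ, ha, ?_⟩
        simp only [List.length_append]
        omega
      have c2 : ¬ Corner P (p ++ u) own κ p.length j → ¬ (t < p.length ∧ p.length < t + l) := by
        intro hc hc'
        exact hc ⟨t, l, ρ, ha, by omega⟩
      clear_value t
      obtain hk | hk | hk : κ j = 1 ∨ κ j = 2 ∨ κ j = 3 := by omega
      all_goals
        rw [hk] at h3 ⊢
        split_ifs with i1 i2 i2
        all_goals
          try have := c1 i1
          try have := c2 i2
          omega
    have h7 := Finset.sum_le_sum fun j (_ : j ∈ Finset.univ) => this j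
    rw [Finset.sum_add_distrib, ← Finset.mul_sum] at h7
    have := sum_corner_le (P := P) (z := p ++ u) (own := own) κ 0
    have := sum_corner_le (P := P) (z := p ++ u) (own := own) κ p.length
    omega

end GSC

namespace GSC

variable {S : Type} {P : C6Presentation S}

lemma exists_primeWord_infix {y t : Word S} (hy : Rd y) (ht : t <:+: y) (ht0 : t ≠ [])
    (h1 : P.elt t = 1) : ∃ z, z <:+: y ∧ PrimeWord P z := by
  induction hn : t.length using Nat.strong_induction_on generalizing t with
  | _ n ih =>
  by_cases hp : PrimeWord P t
  · exact ⟨t, ht, hp⟩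
  by_contra! hcon
  refine hp ⟨ht0, hy.infix ht, h1, fun a b c habc hb => ?_⟩
  by_contra! hb'
  obtain ⟨z, hz, hz'⟩ := ih b.length (by
    rw [← hn]
    have := congrArg List.length habc
    simp only [List.length_append] at this
    rcases Nat.lt_or_ge b.length t.length with h | h
    · exact h
    · exact absurd (List.IsInfix.eq_of_length (⟨a, c, habc.symm⟩ : b <:+: t) (by omega)) hb'.2)
    (List.IsInfix.trans ⟨a, c, habc.symm⟩ ht) hb'.1 hb rfl
  exact hcon z hz hz'

lemma exists_of_infix_append {α : Type*} {x y t : List α} (h : t <:+: x ++ y) :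
    ∃ t₁ t₂, t = t₁ ++ t₂ ∧ t₁ <:+: x ∧ t₂ <:+: y := by
  rcases List.infix_append_iff.1 h with h | h | ⟨t₁, t₂, rfl, h₁, h₂⟩
  · exact ⟨t, [], by simp, h, List.nil_infix⟩
  · exact ⟨[], t, by simp, List.nil_infix, h⟩
  · exact ⟨t₁, t₂, rfl, h₁.isInfix, h₂.isInfix⟩

/-- Words that are close to geodesic embed. -/
theorem eq_nil_of_infix_of_bd {p u t : Word S} (hp : Bd P 1 p) (hu : Bd P 3 u) (hr : Rd (p ++ u))
    (ht : t <:+: p ++ u) (h1 : P.elt t = 1) : t = [] := by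
  by_contra h0
  obtain ⟨z, hz, hz'⟩ := exists_primeWord_infix hr ht h0 h1
  obtain ⟨t₁, t₂, rfl, h₁, h₂⟩ := exists_of_infix_append hz
  exact not_primeWord_append (hp.of_infix h₁) (hu.of_infix h₂) hz'

open Classical in
lemma arc_weight_le {A U V Z t l r : ℕ} {k : ℤ} {C₀ C₁ C₂ : Prop} (h1 : l ≤ r)
    (hZ : Z = A + U + V) (ht : t < Z) (h3 : (k + 2) * (r : ℤ) < 6 * l) (h2 : k ≤ 3)
    (b1 : 6 * (min (t + l) (0 + A) - max t 0) ≤ 1 * r)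
    (b2 : 6 * (min (t + l) (A + U) - max t A) ≤ 3 * r)
    (b3 : 6 * (min (t + l) (A + U + V) - max t (A + U)) ≤ 3 * r)
    (b4 : 6 * (min (t + l) (Z + A) - max t Z) ≤ 1 * r)
    (c0 : ¬ C₀ → ¬ Z < t + l)
    (c1 : ¬ C₁ → ¬ (t < A ∧ A < t + l) ∧ ¬ (t < A + Z ∧ A + Z < t + l))
    (c2 : ¬ C₂ → ¬ (t < A + U ∧ A + U < t + l) ∧ ¬ (t < A + U + Z ∧ A + U + Z < t + l))
    (key : k = 3 → A + U ≤ t → Z < t + l → Z + A < t + l → t + l ≤ Z + A + U → False) :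
    k ≤ (if C₀ then (1 : ℤ) else 0) + (if C₁ then (1 : ℤ) else 0) +
      3 * (if C₂ then (1 : ℤ) else 0) := by
  have i0 : (0 : ℤ) ≤ if C₀ then (1 : ℤ) else 0 := by split_ifs <;> simp
  have i1 : (0 : ℤ) ≤ if C₁ then (1 : ℤ) else 0 := by split_ifs <;> simp
  by_cases d2 : C₂
  · simp only [d2, if_true]; omega
  obtain ⟨e1, e2⟩ := c2 d2
  simp only [d2, if_false]
  rcases le_or_gt k 0 with hk | hk
  · omega
  obtain hk | hk | hk : k = 1 ∨ k = 2 ∨ k = 3 := by omega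
  all_goals
    subst hk
    rcases lt_or_ge t (A + U) with hh | hh
    · clear b3 b4 key c0
      by_cases d1 : C₁
      · simp only [d1, if_true]
        omega
      · obtain ⟨f1, f2⟩ := c1 d1
        exfalso
        clear c1 c2 i0 i1
        omega
    · clear b1 b2
      have g0 : Z < t + l := by
        clear key b4 c0 c1 c2
        omega
      have d0 : C₀ := by
        by_contra d0
        exact c0 d0 g0
      by_cases d1 : C₁
      · simp only [d0, d1, if_true]
        clear c0 c1 c2
        first
        | omega
        | rw [min_eq_right (by omega), max_eq_left hh] at b3
          rw [max_eq_right ht.le] at b4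
          have g1 : Z + A < t + l := by
            by_contra g1
            rw [min_eq_left (by omega)] at b4
            clear key
            omega
          exact (key rfl hh (by omega) g1 (by omega)).elim
      · obtain ⟨f1, f2⟩ := c1 d1
        simp only [d0, if_true]
        clear key c0 c1 c2
        omega

open Classical in
/-- The curvature of a triangle with short base is concentrated on cells at the base and at the top. -/
theorem exists_step {p u v : Word S} (hp : Bd P 1 p) (hu : Bd P 3 u) (hv : Bd P 3 v)
    (hu0 : u ≠ []) (hv0 : v ≠ []) (hz : PrimeWord P (p ++ (u ++ wordInv v))) :
    ∃ a b q, a ≠ [] ∧ b ≠ [] ∧ a <+: u ∧ b <+: v ∧ wordInv b ++ (p ++ (a ++ q)) ∈ P.rels ∧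
      6 * q.length < b.length + p.length + a.length + q.length := by
  rcases hz.exists_longArc with h | ⟨ι, _, κ, own, h6, h⟩
  · refine ⟨u, v, [], hu0, hv0, List.prefix_refl _, List.prefix_refl _, ?_, ?_⟩
    · rw [← List.append_assoc] at h
      simpa using rotate_mem' h
    · have := List.length_pos_iff.2 hu0
      simp; omega
  have hL := List.length_pos_iff.2 hz.ne_nil
  have hv' := List.length_pos_iff.2 hv0
  by_contra! hcon
  set z := p ++ (u ++ wordInv v) with hzdef
  have hzl : z.length = p.length + u.length + v.length := by simp [hzdef]; omega
  have : ∀ j, κ j ≤ (if Corner P z own κ 0 j then (1 : ℤ) else 0) +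
      (if Corner P z own κ p.length j then (1 : ℤ) else 0) +
      3 * (if Corner P z own κ (p.length + u.length) j then (1 : ℤ) else 0) := by
    intro j
    rcases le_or_gt (κ j) 0 with hj | hj
    · split_ifs <;> omega
    obtain ⟨s, l, ρ, ha⟩ := h j hj
    replace ha := ha.mod
    set t := s % z.length
    have ht : t < z.length := Nat.mod_lt _ hL
    have b1 := ha.block ht [] p (u ++ wordInv v ++ z) (by simp [hzdef]) hp
    have b2 := ha.block ht p u (wordInv v ++ z) (by simp [hzdef]) hu
    have b3 := ha.block ht (p ++ u) (wordInv v) z (by simp [hzdef]) hv.wordInv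
    have b4 := ha.block ht z p (u ++ wordInv v) (by simp [hzdef]) hp
    have h1 := ha.length_le
    have h2 := ha.weight_le
    have h3 := ha.2.2.2.1
    have h4 := ha.2.1
    have key : κ j = 3 → p.length + u.length ≤ t → z.length < t + l →
        z.length + p.length < t + l → t + l ≤ z.length + p.length + u.length → False := by
      intro e1 e2 e3 e4 e5
      obtain ⟨q, hq⟩ := ha.2.2.1
      have hdrop : z.drop t = (wordInv v).drop (t - (p.length + u.length)) := by
        rw [hzdef, ← List.append_assoc, List.drop_append, List.drop_eq_nil_of_le (by simp; omega)]
        simp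
      have htake : (z.rotate t).take l = z.drop t ++ (p ++ u.take (t + l - z.length - p.length)) := by
        rw [List.rotate_eq_drop_append_take ht.le, List.take_append, List.take_of_length_le
          (by simp; omega), List.take_take, min_eq_left (by simp; omega), hzdef, List.take_append,
          List.take_of_length_le (by simp; omega), List.take_append_of_le_length]
        · congr 3
          simp; omega
        · simp; omega
      have hb : ∃ b, b <+: v ∧ wordInv b = z.drop t := by
        obtain ⟨c, hc⟩ := List.drop_suffix (t - (p.length + u.length)) (wordInv v)
        refine ⟨wordInv (z.drop t), ⟨wordInv c, ?_⟩, by simp⟩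
        rw [hdrop, ← wordInv_append, hc, wordInv_wordInv]
      obtain ⟨b, hb, hbt⟩ := hb
      have hbl := congrArg List.length hbt
      simp only [length_wordInv, List.length_drop] at hbl
      have hal : (u.take (t + l - z.length - p.length)).length = t + l - z.length - p.length := by
        simp; omega
      have := hcon (u.take (t + l - z.length - p.length)) b q
        (by rw [← List.length_pos_iff]; omega) (by rw [← List.length_pos_iff]; omega)
        (List.take_prefix _ _) hb (by
          rw [htake] at hq
          rw [hbt]
          have hρ := ha.1
          rw [← hq] at hρ
          simpa using hρ)
      have hql := congrArg List.length hq
      rw [htake] at hql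
      simp only [List.length_append, List.length_drop] at hql
      rw [e1] at h3
      omega
    simp only [List.length_append, List.length_nil, length_wordInv] at *
    have c1 : ¬ Corner P z own κ 0 j → ¬ (z.length < t + l) :=
      fun hc hc' => hc ⟨t, l, ρ, ha, by omega⟩
    have c2 : ¬ Corner P z own κ p.length j → ¬ (t < p.length ∧ p.length < t + l) ∧
        ¬ (t < p.length + z.length ∧ p.length + z.length < t + l) :=
      fun hc => ⟨fun hc' => hc ⟨t, l, ρ, ha, by omega⟩, fun hc' => hc ⟨t, l, ρ, ha, by omega⟩⟩
    have c3 : ¬ Corner P z own κ (p.length + u.length) j →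
        ¬ (t < p.length + u.length ∧ p.length + u.length < t + l) ∧
        ¬ (t < p.length + u.length + z.length ∧ p.length + u.length + z.length < t + l) :=
      fun hc => ⟨fun hc' => hc ⟨t, l, ρ, ha, by omega⟩, fun hc' => hc ⟨t, l, ρ, ha, by omega⟩⟩
    clear_value t
    exact arc_weight_le (by simpa using h1) hzl ht h3 h2 b1 b2 b3 b4 c1 c2 c3 key
  have h7 := Finset.sum_le_sum fun j (_ : j ∈ Finset.univ) => this j
  rw [Finset.sum_add_distrib, Finset.sum_add_distrib, ← Finset.mul_sum] at h7
  have := sum_corner_le (P := P) (z := z) (own := own) κ 0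
  have := sum_corner_le (P := P) (z := z) (own := own) κ p.length
  have := sum_corner_le (P := P) (z := z) (own := own) κ (p.length + u.length)
  omega

end GSC

namespace GSC

variable {S : Type} {P : C6Presentation S}

lemma eq_concat_of_mem_getLast? {α : Type*} {l : List α} {x : α} (h : x ∈ l.getLast?) :
    ∃ l', l = l' ++ [x] :=
  ⟨_, (List.dropLast_append_getLast? x h).symm⟩

lemma primeWord_of_minimal {p u v : Word S} (hp : Bd P 1 p) (hu : Bd P 3 u) (hv : Bd P 3 v)
    (hru : Rd (p ++ u)) (hrv : Rd (wordInv p ++ v))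
    (hd : p = [] → ∀ x ∈ u.head?, x ∉ v.head?) (h : P.elt (p ++ u) = P.elt v)
    (hu0 : u ≠ []) (hv0 : v ≠ [])
    (hmin : ∀ u₁ u₂ v₁ v₂, u = u₁ ++ u₂ → v = v₁ ++ v₂ → P.elt (p ++ u₁) = P.elt v₁ →
      (u₁ = [] ∧ v₁ = []) ∨ (u₂ = [] ∧ v₂ = [])) :
    PrimeWord P (p ++ (u ++ wordInv v)) := by
  have hp1 : P.elt p = 1 → p = [] := fun h1 =>
    eq_nil_of_infix_of_bd hp hu hru (List.prefix_append _ _).isInfix h1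
  have hsplit : ∀ u₁ u₂ v₁ v₂, u = u₁ ++ u₂ → v = v₁ ++ v₂ → P.elt u₂ = P.elt v₂ →
      (p = [] ∧ u₁ = [] ∧ v₁ = []) ∨ (u₂ = [] ∧ v₂ = []) := by
    rintro u₁ u₂ v₁ v₂ rfl rfl h2
    have h3 : P.elt (p ++ u₁) = P.elt v₁ := by
      rw [← List.append_assoc, elt_append, elt_append (P := P) v₁, h2] at h
      exact mul_right_cancel h
    rcases hmin _ _ _ _ rfl rfl h3 with ⟨rfl, rfl⟩ | h4
    · exact Or.inl ⟨hp1 (by simpa using h3), rfl, rfl⟩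
    · exact Or.inr h4
  refine ⟨by simp [hu0], ?_, ?_, ?_⟩
  · rw [← List.append_assoc, rd_append]
    refine ⟨hru, hrv.right.wordInv, fun x hx y hy hxy => ?_⟩
    rw [List.getLast?_append_of_ne_nil _ hu0] at hx
    rw [head?_wordInv] at hy
    obtain ⟨w, hw, hwy⟩ := Option.map_eq_some_iff.1 hy
    have hwx : w = x := by rw [← hwy] at hxy; simpa [letterInv_eq_comm] using hxy
    subst hwx
    obtain ⟨u₁, rfl⟩ := eq_concat_of_mem_getLast? hx
    obtain ⟨v₁, rfl⟩ := eq_concat_of_mem_getLast? hw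
    rcases hsplit _ _ _ _ rfl rfl rfl with ⟨h5, rfl, rfl⟩ | h5
    · exact hd h5 w (by simp) (by simp)
    · simp at h5
  · rw [← List.append_assoc, elt_append, elt_wordInv, h, mul_inv_cancel]
  · intro x b y hb h1
    have hb' : b <:+: (p ++ u) ++ wordInv v := ⟨x, y, by rw [← hb]; simp⟩
    rcases List.infix_append_iff.1 hb' with h2 | h2 | ⟨t₁, t₂, rfl, h₁, h₂⟩
    · exact Or.inl (eq_nil_of_infix_of_bd hp hu hru h2 h1)
    · exact Or.inl (eq_nil_of_infix_of_bd (p := []) (bd_nil 1) hv.wordInv (by simpa using hrv.right)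
        (by simpa using h2) h1)
    · obtain ⟨v₁, v₂, rfl, rfl⟩ : ∃ v₁ v₂, v = v₁ ++ v₂ ∧ t₂ = wordInv v₂ := by
        obtain ⟨s, hs⟩ := h₂
        exact ⟨wordInv s, wordInv t₂, by rw [← wordInv_append, hs, wordInv_wordInv], by simp⟩
      rw [elt_append, elt_wordInv, mul_inv_eq_one] at h1
      obtain ⟨x₀, hx₀⟩ := h₁
      rcases List.append_eq_append_iff.1 hx₀ with ⟨p₂, h3, h4⟩ | ⟨u₁, h3, h4⟩
      · right
        have h5 : P.elt x₀ = P.elt v₁ := by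
          rw [← hx₀, elt_append, elt_append, h1] at h
          exact mul_right_cancel h
        have h6 : wordInv x₀ ++ v₁ = [] := by
          refine eq_nil_of_infix_of_bd hp.wordInv hv hrv (t := wordInv x₀ ++ v₁)
            ⟨wordInv p₂, v₂, ?_⟩ ?_
          · rw [h3]; simp
          · rw [elt_append, elt_wordInv, h5, inv_mul_cancel]
        simp only [List.append_eq_nil_iff, wordInv_eq_nil] at h6
        rw [h4]
        simp [h3, h6.1, h6.2]
      · rcases hsplit _ _ _ _ h4 rfl h1 with ⟨h5, h6, h7⟩ | ⟨h5, h6⟩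
        · right
          simp [h5, h7, h4, h6]
        · left
          simp [h5, h6]

/-- The cell at the base of a thin triangle. -/
theorem exists_cell {p u v : Word S} (hp : Bd P 1 p) (hu : Bd P 3 u) (hv : Bd P 3 v)
    (hru : Rd (p ++ u)) (hrv : Rd (wordInv p ++ v))
    (hd : p = [] → ∀ x ∈ u.head?, x ∉ v.head?) (h : P.elt (p ++ u) = P.elt v)
    (h0 : u ≠ [] ∨ v ≠ []) :
    ∃ a b q u' v', u = a ++ u' ∧ v = b ++ v' ∧ a ≠ [] ∧ b ≠ [] ∧
      wordInv b ++ (p ++ (a ++ q)) ∈ P.rels ∧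
      6 * q.length < b.length + p.length + a.length + q.length ∧
      Rd (wordInv q ++ u') ∧ Rd (q ++ v') := by
  classical
  have hnil : ∀ u₁ u₂ v₁ v₂, u = u₁ ++ u₂ → v = v₁ ++ v₂ → P.elt (p ++ u₁) = P.elt v₁ →
      (u₁ = [] ↔ v₁ = []) := by
    rintro u₁ u₂ v₁ v₂ rfl rfl h1
    constructor
    · rintro rfl
      have := eq_nil_of_infix_of_bd hp.wordInv hv hrv (t := wordInv p ++ v₁)
        ⟨[], v₂, by simp⟩ (by rw [elt_append, elt_wordInv, ← h1]; simp)
      simp_all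
    · rintro rfl
      have := eq_nil_of_infix_of_bd hp hu hru (t := p ++ u₁) ⟨[], u₂, by simp⟩ h1
      simp_all
  have hne : {x : Word S × Word S | ∃ u₂ v₂, u = x.1 ++ u₂ ∧ v = x.2 ++ v₂ ∧
      P.elt (p ++ x.1) = P.elt x.2 ∧ x.1 ≠ []}.Nonempty := by
    refine ⟨(u, v), [], [], by simp, by simp, h, ?_⟩
    have := hnil u [] v [] (by simp) (by simp) h
    tauto
  obtain ⟨⟨u₁, v₁⟩, ⟨u₂, v₂, rfl, rfl, h1, hu1⟩, hmin⟩ :=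
    (measure fun x : Word S × Word S => x.1.length + x.2.length).wf.has_min _ hne
  dsimp only at h1 hu1 hmin hnil
  have hv1 : v₁ ≠ [] := fun h2 => hu1 ((hnil _ _ _ _ rfl rfl h1).2 h2)
  have hu' : Bd P 3 u₁ := hu.of_infix (List.prefix_append _ _).isInfix
  have hv' : Bd P 3 v₁ := hv.of_infix (List.prefix_append _ _).isInfix
  have hz : PrimeWord P (p ++ (u₁ ++ wordInv v₁)) := by
    refine primeWord_of_minimal hp hu' hv' (hru.infix ⟨[], u₂, by simp⟩)
      (hrv.infix ⟨[], v₂, by simp⟩) (fun h2 x hx hx' => ?_) h1 hu1 hv1 ?_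
    · refine hd h2 x ?_ ?_
      · rwa [List.head?_append_of_ne_nil _ hu1]
      · rwa [List.head?_append_of_ne_nil _ hv1]
    · rintro u₃ u₄ v₃ v₄ rfl rfl h3
      by_contra! hcon
      have h4 := hnil u₃ (u₄ ++ u₂) v₃ (v₄ ++ v₂) (by simp) (by simp) h3
      refine hmin (u₃, v₃) ⟨u₄ ++ u₂, v₄ ++ v₂, by simp, by simp, h3, fun h5 => ?_⟩ ?_
      · exact hcon.1 h5 (h4.1 h5)
      · change u₃.length + v₃.length < (u₃ ++ u₄).length + (v₃ ++ v₄).length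
        have : 0 < u₄.length + v₄.length := by
          rcases eq_or_ne u₄ [] with h6 | h6
          · have := List.length_pos_iff.2 (hcon.2 h6); omega
          · have := List.length_pos_iff.2 h6; omega
        simp only [List.length_append]
        omega
  have hex : ∃ n, ∃ a b q u' v', u₁ ++ u₂ = a ++ u' ∧ v₁ ++ v₂ = b ++ v' ∧ a ≠ [] ∧ b ≠ [] ∧
      wordInv b ++ (p ++ (a ++ q)) ∈ P.rels ∧
      6 * q.length < b.length + p.length + a.length + q.length ∧ q.length = n := by
    obtain ⟨a, b, q, ha, hb, ⟨a', rfl⟩, ⟨b', rfl⟩, hr, hl⟩ := exists_step hp hu' hv' hu1 hv1 hz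
    exact ⟨_, a, b, q, a' ++ u₂, b' ++ v₂, by simp, by simp, ha, hb, hr, hl, rfl⟩
  obtain ⟨a, b, q, u', v', hau, hbv, ha, hb, hr, hl, hq⟩ := Nat.find_spec hex
  have hm := fun n (hn : n < q.length) => Nat.find_min hex (m := n) (by omega)
  have hq1 : Rd q := (rd_rel_append hr).left.right.right.right
  refine ⟨a, b, q, u', v', hau, hbv, ha, hb, hr, hl, ?_, ?_⟩
  · rw [rd_append]
    refine ⟨hq1.wordInv, ?_, fun x hx y hy hxy => ?_⟩
    · rw [hau] at hru
      exact hru.right.right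
    · rcases q with _ | ⟨c, q⟩
      · simp at hx
      obtain ⟨u'', rfl⟩ : ∃ u'', u' = y :: u'' := by
        rcases u' with _ | ⟨c, u'⟩
        · simp at hy
        · exact ⟨u', by simpa using hy⟩
      have hc : y = c := by
        simp only [getLast?_wordInv, List.head?_cons, Option.map_some, Option.mem_some_iff] at hx
        rw [hxy, ← hx, letterInv_letterInv]
      subst hc
      refine hm q.length (by simp) ⟨a ++ [y], b, q, u'', v', by simp [hau], hbv, by simp, hb,
        by simpa using hr, ?_, rfl⟩
      simp only [List.length_append, List.length_cons, List.length_nil] at hl ⊢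
      omega
  · rw [rd_append]
    refine ⟨hq1, ?_, fun x hx y hy hxy => ?_⟩
    · rw [hbv] at hrv
      exact hrv.right.right
    · obtain ⟨q, rfl⟩ := eq_concat_of_mem_getLast? hx
      obtain ⟨v'', rfl⟩ : ∃ v'', v' = y :: v'' := by
        rcases v' with _ | ⟨c, v'⟩
        · simp at hy
        · exact ⟨v', by simpa using hy⟩
      subst hxy
      refine hm q.length (by simp) ⟨a, b ++ [letterInv x], q, u', v'', hau, by simp [hbv], ha,
        by simp, ?_, ?_, rfl⟩
      · have h2 : (wordInv b ++ (p ++ (a ++ q))) ++ [x] ∈ P.rels := by simpa using hr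
        simpa using rotate_mem' h2
      · simp only [List.length_append, List.length_cons, List.length_nil] at hl ⊢
        omega

end GSC

namespace GSC

variable {S : Type} {P : C6Presentation S}

/-- The `N`-th power of a word. -/
def wpow (h : Word S) (N : ℕ) : Word S := (List.replicate N h).flatten

@[simp] lemma wpow_zero (h : Word S) : wpow h 0 = [] := rfl

lemma wpow_succ (h : Word S) (N : ℕ) : wpow h (N + 1) = h ++ wpow h N := by
  simp [wpow, List.replicate_succ]

lemma wpow_append_self (x y : Word S) (N : ℕ) :
    wpow (x ++ y) N ++ x = x ++ wpow (y ++ x) N := by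
  induction N with
  | zero => simp
  | succ N ih => simp only [wpow_succ, List.append_assoc, ih]

lemma wpow_succ' (h : Word S) (N : ℕ) : wpow h (N + 1) = wpow h N ++ h := by
  have := wpow_append_self h [] N
  simp only [List.append_nil, List.nil_append] at this
  rw [this, wpow_succ]

lemma wpow_add (h : Word S) (M N : ℕ) : wpow h (M + N) = wpow h M ++ wpow h N := by
  induction M with
  | zero => simp
  | succ M ih => rw [add_right_comm, wpow_succ, ih, wpow_succ, List.append_assoc]

@[simp] lemma length_wpow (h : Word S) (N : ℕ) : (wpow h N).length = N * h.length := by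
  simp [wpow]

lemma elt_wpow (h : Word S) (N : ℕ) : P.elt (wpow h N) = P.elt h ^ N := by
  induction N with
  | zero => simp
  | succ N ih => rw [wpow_succ, elt_append, ih, pow_succ']

lemma exists_prefix_wpow_rotate {h a : Word S} {N : ℕ} (ha : a <:+: wpow h N) :
    ∃ x y, h = x ++ y ∧ a <+: wpow (y ++ x) N := by
  obtain ⟨c, d, hcd⟩ := ha
  induction c generalizing h d with
  | nil => exact ⟨[], h, by simp, d, by simpa using hcd⟩
  | cons s c ih =>
    rcases N with _ | N
    · simp at hcd
    rcases h with _ | ⟨s', h⟩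
    · simp [wpow] at hcd
    have hs : s' = s := by
      rw [wpow_succ] at hcd
      simp only [List.cons_append, List.cons.injEq] at hcd
      exact hcd.1.symm
    subst hs
    have h1 := wpow_append_self [s'] h (N + 1)
    rw [List.singleton_append, ← hcd] at h1
    obtain ⟨x, y, hxy, hpre⟩ := ih (h := h ++ [s']) (d ++ [s']) (by simpa using h1)
    rcases List.eq_nil_or_concat' y with rfl | ⟨y, t, rfl⟩
    · refine ⟨[s'], h, by simp, ?_⟩
      simp only [List.append_nil] at hxy
      simpa [hxy] using hpre
    · rw [← List.append_assoc] at hxy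
      obtain ⟨rfl, h2⟩ := List.append_inj' hxy rfl
      obtain rfl : s' = t := by simpa using h2
      exact ⟨s' :: x, y, by simp, by simpa using hpre⟩

lemma elt_pow_eq_of_comm {x y : Word S} (h : x ++ y = y ++ x) :
    P.elt x ^ y.length = P.elt y ^ x.length := by
  induction hn : x.length + y.length using Nat.strong_induction_on generalizing x y with
  | _ n ih =>
  subst hn
  have key : ∀ x y : Word S, x ++ y = y ++ x → x.length ≤ y.length → x ≠ [] →
      (∀ x' y' : Word S, x'.length + y'.length < x.length + y.length → x' ++ y' = y' ++ x' →
        P.elt x' ^ y'.length = P.elt y' ^ x'.length) →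
      P.elt x ^ y.length = P.elt y ^ x.length := by
    intro x y h hl hx ih
    obtain ⟨z, rfl⟩ : x <+: y :=
      List.prefix_of_prefix_length_le (List.prefix_append x y) (h ▸ List.prefix_append y x) hl
    have hz : x ++ z = z ++ x := by simpa using h
    have hc : Commute (P.elt x) (P.elt z) := by
      change P.elt x * P.elt z = P.elt z * P.elt x
      rw [← elt_append, hz, elt_append]
    rw [elt_append, hc.mul_pow, ← ih x z (by have := List.length_pos_iff.2 hx; simp; omega) hz,
      ← pow_add, List.length_append]
  rcases eq_or_ne x [] with rfl | hx
  · simp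
  rcases eq_or_ne y [] with rfl | hy
  · simp
  rcases le_total x.length y.length with hl | hl
  · exact key x y h hl hx fun x' y' hlt h' => ih _ hlt h' rfl
  · exact (key y x h.symm hl hy fun x' y' hlt h' => ih _ (by omega) h' rfl).symm

lemma isOfFinOrder_append_comm {x y : Word S} (h : IsOfFinOrder (P.elt (x ++ y))) :
    IsOfFinOrder (P.elt (y ++ x)) := by
  have : P.elt (y ++ x) = (P.elt x)⁻¹ * P.elt (x ++ y) * P.elt x := by
    simp only [elt_append]; group
  rw [this, isOfFinOrder_iff_pow_eq_one] at *
  obtain ⟨n, hn, h1⟩ := h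
  refine ⟨n, hn, ?_⟩
  have := conj_pow (i := n) (a := (P.elt x)⁻¹) (b := P.elt (x ++ y))
  rw [inv_inv] at this
  rw [this, h1]
  simp

/-- A word of infinite order is not a period of a relator. -/
lemma rotate_ne_of_not_isOfFinOrder {h s : Word S} (hinf : ¬ IsOfFinOrder (P.elt h))
    (hr : h ++ s ∈ P.rels) : h ++ s ≠ s ++ h := by
  intro heq
  have h1 : h ++ (h ++ s) = (h ++ s) ++ h := by
    conv_lhs => rw [heq]
    simp
  have h2 := elt_pow_eq_of_comm (P := P) h1
  rw [elt_rel hr, one_pow] at h2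
  refine hinf (isOfFinOrder_iff_pow_eq_one.2 ⟨_, ?_, h2⟩)
  rw [List.length_pos_iff]
  rintro h3
  simp only [List.append_eq_nil_iff] at h3
  simp [h3.1] at hinf

/-- A subword of a periodic line covers at most a sixth of a relator and a period. -/
lemma six_mul_length_le_of_infix_wpow {h a s : Word S} {N : ℕ} (ha : a <:+: wpow h N)
    (hr : a ++ s ∈ P.rels) (hinf : ¬ IsOfFinOrder (P.elt h)) :
    6 * a.length ≤ (a ++ s).length + 6 * h.length := by
  rcases le_or_gt a.length h.length with hl | hl
  · omega
  obtain ⟨x, y, rfl, hpre⟩ := exists_prefix_wpow_rotate ha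
  have hinf' : ¬ IsOfFinOrder (P.elt (y ++ x)) := fun h' => hinf (isOfFinOrder_append_comm h')
  obtain ⟨b, rfl⟩ : y ++ x <+: a := by
    refine List.prefix_of_prefix_length_le (l₃ := wpow (y ++ x) N) ?_ hpre ?_
    · rcases N with _ | N
      · simp at hpre
        simp [hpre] at hl
      · rw [wpow_succ]
        exact List.prefix_append _ _
    · simp at hl ⊢
      omega
  have hb : b <+: y ++ x ++ b := by
    rcases N with _ | N
    · simp at hpre
      simp [hpre] at hl
    have h1 : b <+: wpow (y ++ x) N := by
      rwa [wpow_succ, List.prefix_append_right_inj] at hpre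
    refine List.prefix_of_prefix_length_le (h1.trans ?_) hpre (by simp; omega)
    rw [wpow_succ']
    exact List.prefix_append _ _
  have hr1 : (y ++ x) ++ (b ++ s) ∈ P.rels := by simpa using hr
  have := piece_lt hr1 (rotate_mem' hr1) (rotate_ne_of_not_isOfFinOrder hinf' hr1)
    (hb.trans ⟨s, by simp⟩) ⟨s ++ (y ++ x), by simp⟩
  simp only [List.length_append] at this ⊢
  omega

variable (P) in
/-- All subwords of `v` are geodesic. -/
def Geod (v : Word S) : Prop := ∀ b, b <:+: v → ∀ c, P.elt b = P.elt c → b.length ≤ c.length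

lemma Geod.of_infix {v w : Word S} (h : Geod P v) (hw : w <:+: v) : Geod P w :=
  fun b hb => h b (hb.trans hw)

lemma Geod.bd {v : Word S} (h : Geod P v) : Bd P 3 v := by
  rintro t ht _ hρ ⟨s, rfl⟩
  have h1 := elt_rel hρ
  rw [elt_append, mul_eq_one_iff_eq_inv, ← elt_wordInv] at h1
  have := h t ht _ h1
  simp only [length_wordInv, List.length_append] at this ⊢
  omega

lemma Geod.rd {v : Word S} (h : Geod P v) : Rd v := by
  induction v with
  | nil => exact rd_nil
  | cons s v ih =>
    rcases v with _ | ⟨t, v⟩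
    · exact rd_singleton s
    rw [rd_cons_cons]
    refine ⟨fun hst => ?_, ih (h.of_infix ⟨[s], [], by simp⟩)⟩
    have := h [s, t] ⟨[], v, by simp⟩ [] (by
      rw [hst, elt_eq_pi, elt_eq_pi, fg_cons, fg_cons, fg_letterInv]
      simp [fg_nil])
    simp at this

variable (P) in
/-- The word `p` is the top of a cell whose base is short. -/
def Cap (M : ℕ) (p v : Word S) : Prop :=
  ∃ r₀ β₀ π₀ α₀ : ℕ, r₀ = β₀ + π₀ + α₀ + p.length ∧ r₀ ≤ 24 * M ∧ 6 * p.length ≤ r₀ ∧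
    6 * π₀ ≤ r₀ ∧ 6 * α₀ ≤ r₀ + 6 * M ∧
    ∀ b, b <+: v → ∀ c, P.elt b = P.elt (p ++ c) → β₀ + b.length ≤ π₀ + α₀ + c.length

/-- A geodesic side of a thin triangle stays close to the periodic side. -/
theorem exists_prefix_near {h : Word S} (hinf : ¬ IsOfFinOrder (P.elt h)) {p u v : Word S}
    (hp : Bd P 1 p) (hN : ∃ N, u <:+: wpow h N) (hu : Bd P 3 u) (hv : Geod P v)
    (hru : Rd (p ++ u)) (hrv : Rd (wordInv p ++ v)) (he : P.elt (p ++ u) = P.elt v)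
    (hcap : p = [] ∨ Cap P h.length p v) (v' : Word S) (hv' : v' <+: v) :
    ∃ u', u' <+: u ∧ ∃ c, c.length ≤ 24 * h.length ∧ P.elt v' = P.elt (p ++ (u' ++ c)) := by
  induction hn : u.length + v.length using Nat.strong_induction_on generalizing p u v v' with
  | _ n ih =>
  subst hn
  have hpl : p.length ≤ 24 * h.length := by
    rcases hcap with rfl | ⟨r₀, β₀, π₀, α₀, h1, h2, h3, -⟩
    · simp
    · omega
  rcases eq_or_ne v' [] with rfl | hv0
  · exact ⟨[], List.nil_prefix, wordInv p, by simpa using hpl, by simp [elt_append, elt_wordInv]⟩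
  by_cases hd : p = [] → ∀ x ∈ u.head?, x ∉ v.head?
  · obtain ⟨a, b, q, u₁, v₁, rfl, rfl, ha, hb, hr, hq, hq1, hq2⟩ :=
      exists_cell hp hu hv.bd hru hrv hd he (Or.inr (by rintro rfl; simp at hv'; exact hv0 hv'))
    have hr1 : a ++ (q ++ (wordInv b ++ p)) ∈ P.rels := by
      have : (wordInv b ++ p) ++ (a ++ q) ∈ P.rels := by simpa using hr
      simpa using rotate_mem' this
    have hr2 : p ++ (a ++ q ++ wordInv b) ∈ P.rels := by simpa using rotate_mem' hr
    have hr3 : q ++ (wordInv b ++ p ++ a) ∈ P.rels := by simpa using rotate_mem' hr1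
    have hel : P.elt b = P.elt (p ++ (a ++ q)) := by
      have := elt_rel hr
      rwa [elt_append, elt_wordInv, inv_mul_eq_one] at this
    obtain ⟨N, hN⟩ := hN
    have la := six_mul_length_le_of_infix_wpow ((List.prefix_append a u₁).isInfix.trans hN) hr1 hinf
    have lp := hp p (List.infix_refl _) _ hr2 (List.prefix_append _ _)
    have lb : p = [] → b.length ≤ a.length + q.length := by
      rintro rfl
      simpa using hv b (List.prefix_append _ _).isInfix _ hel
    have lr : b.length + p.length + a.length + q.length ≤ 24 * h.length := by
      simp only [List.length_append, length_wordInv] at la lp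
      rcases hcap with hp0 | ⟨r₀, β₀, π₀, α₀, h1, h2, h3, h4, h5, h6⟩
      · have := lb hp0
        omega
      · have := h6 b (List.prefix_append _ _) _ hel
        simp only [List.length_append] at this
        omega
    rcases List.prefix_or_prefix_of_prefix hv' (List.prefix_append b v₁) with h7 | ⟨v'', rfl⟩
    · refine ⟨[], List.nil_prefix, wordInv p ++ v', ?_, by simp [elt_append, elt_wordInv]⟩
      have := h7.length_le
      simp only [List.length_append, length_wordInv]
      omega
    · have h8 : v'' <+: v₁ := by simpa using hv'
      have h9 : P.elt (wordInv q ++ u₁) = P.elt v₁ := by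
        have h10 : P.elt p * (P.elt a * P.elt u₁) = P.elt b * P.elt v₁ := by
          simpa only [elt_append] using he
        rw [eq_inv_mul_of_mul_eq h10.symm, hel]
        simp only [elt_append, elt_wordInv]
        group
      have h11 : wordInv q = [] ∨ Cap P h.length (wordInv q) v₁ := by
        right
        simp only [List.length_append, length_wordInv] at la lp
        refine ⟨b.length + p.length + a.length + q.length, b.length, p.length, a.length,
          by simp, lr, by simp; omega, by omega, by omega, fun b' hb' c' hc' => ?_⟩
        have := hv (b ++ b') (List.IsPrefix.isInfix (by simpa using hb')) (p ++ (a ++ c')) (by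
          rw [elt_append, hel, hc']
          simp only [elt_append, elt_wordInv]
          group)
        simp only [List.length_append] at this
        omega
      obtain ⟨u', hu', c, hc, hc'⟩ := ih (u₁.length + v₁.length) (by
          have := List.length_pos_iff.2 ha
          simp only [List.length_append]; omega) (p := wordInv q) (u := u₁) (v := v₁)
        (bd_of_rel le_rfl hr3 (by simp only [List.length_append, length_wordInv]; omega)).wordInv
        ⟨N, (List.suffix_append a u₁).isInfix.trans hN⟩
        (hu.of_infix (List.suffix_append _ _).isInfix)
        (hv.of_infix (List.suffix_append _ _).isInfix) hq1 (by simpa using hq2) h9 h11 v'' h8 rfl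
      · refine ⟨a ++ u', by simpa using hu', c, hc, ?_⟩
        rw [elt_append, hel, hc']
        simp only [elt_append, elt_wordInv]
        group
  · push Not at hd
    obtain ⟨rfl, x, hx, hx'⟩ := hd
    obtain ⟨u₁, rfl⟩ : ∃ u₁, u = x :: u₁ := by
      rcases u with _ | ⟨c, u⟩
      · simp at hx
      · exact ⟨u, by simpa using hx⟩
    obtain ⟨v₁, rfl⟩ : ∃ v₁, v = x :: v₁ := by
      rcases v with _ | ⟨c, v⟩
      · simp at hx'
      · exact ⟨v, by simpa using hx'⟩
    obtain ⟨v'', rfl⟩ : ∃ v₁, v' = x :: v₁ := by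
      rcases v' with _ | ⟨c, v'⟩
      · simp at hv0
      · exact ⟨v', by simpa using (List.cons_prefix_cons.1 hv').1⟩
    have hcons : ∀ w : Word S, P.elt (x :: w) = P.elt [x] * P.elt w := fun w => by
      rw [← elt_append]; rfl
    obtain ⟨N, hN⟩ := hN
    obtain ⟨u', hu', c, hc, hc'⟩ := ih (u₁.length + v₁.length) (by simp; omega) (p := [])
      (u := u₁) (v := v₁) hp ⟨N, (List.suffix_cons x u₁).isInfix.trans hN⟩
      (hu.of_infix (List.suffix_cons _ _).isInfix) (hv.of_infix (List.suffix_cons _ _).isInfix)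
      (hru.infix (List.suffix_cons _ _).isInfix) (hrv.infix (List.suffix_cons _ _).isInfix)
      (by simpa [hcons u₁, hcons v₁] using he) (Or.inl rfl) v'' (by simpa using hv') rfl
    refine ⟨x :: u', by simpa using hu', c, hc, ?_⟩
    simp only [List.nil_append, List.cons_append] at hc' ⊢
    rw [hcons v'', hc', hcons (u' ++ c)]

end GSC

namespace GSC

variable {S : Type} {P : C6Presentation S}

lemma exists_geod (x : P.Grp) : ∃ v, Geod P v ∧ P.elt v = x := by
  obtain ⟨v, hv, hmin⟩ := (measure fun v : Word S => v.length).wf.has_min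
    {v | P.elt v = x} (elt_surjective P x)
  refine ⟨v, ?_, hv⟩
  rintro b ⟨s, t, rfl⟩ c hc
  by_contra! hlt
  refine hmin (s ++ c ++ t) ?_ ?_
  · rw [Set.mem_ofPred_eq, ← hv]
    simp only [elt_append, hc]
  · change (s ++ c ++ t).length < (s ++ b ++ t).length
    simp only [List.length_append]
    omega

lemma exists_wpow_append_of_prefix {h u : Word S} {N : ℕ} (hu : u <+: wpow h N) :
    ∃ k y, u = wpow h k ++ y ∧ y.length ≤ h.length := by
  induction N generalizing u with
  | zero => exact ⟨0, [], by simpa using hu, by simp⟩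
  | succ N ih =>
    rw [wpow_succ] at hu
    rcases List.prefix_or_prefix_of_prefix hu (List.prefix_append h (wpow h N)) with h1 | ⟨u', rfl⟩
    · exact ⟨0, u, by simp, h1.length_le⟩
    · obtain ⟨k, y, rfl, hy⟩ := ih (by simpa using hu)
      exact ⟨k + 1, y, by simp [wpow_succ], hy⟩

/-- Geodesics between points of a good periodic line stay close to the line. -/
theorem exists_near_pow {h v : Word S} (hinf : ¬ IsOfFinOrder (P.elt h)) {N : ℕ}
    (hr : Rd (wpow h N)) (hb : Bd P 3 (wpow h N)) (hv : Geod P v) (he : P.elt v = P.elt h ^ N)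
    (v' : Word S) (hv' : v' <+: v) :
    ∃ (k : ℕ) (c : Word S), c.length ≤ 25 * h.length ∧ P.elt v' = P.elt h ^ k * P.elt c := by
  obtain ⟨u', hu', c, hc, hc'⟩ := exists_prefix_near hinf (p := []) (bd_nil 1)
    ⟨N, List.infix_refl _⟩ hb hv hr (by simpa [wordInv_nil] using hv.rd)
    (by rw [he, List.nil_append, elt_wpow]) (Or.inl rfl) v' hv'
  obtain ⟨k, y, rfl, hy⟩ := exists_wpow_append_of_prefix hu'
  refine ⟨k, y ++ c, by simp; omega, ?_⟩
  rw [hc', ← elt_wpow, ← elt_append]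
  simp

lemma piece_of_head_ne {x X Y ρ : Word S} {e : S × Bool} (hx : x <:+ X) (hXY : X ++ Y ∈ P.rels)
    (hY : Y ≠ []) (hρ : ρ ∈ P.rels) (hxe : x ++ [e] <:+: ρ) (he : e ∉ Y.head?) :
    6 * x.length < ρ.length ∧ 6 * x.length < (X ++ Y).length := by
  obtain ⟨X₀, rfl⟩ := hx
  obtain ⟨a, b, rfl⟩ := hxe
  have h1 : x ++ (Y ++ X₀) ∈ P.rels := by
    rw [List.append_assoc] at hXY
    simpa using rotate_mem' hXY
  have h2 : x ++ ([e] ++ b ++ a) ∈ P.rels := by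
    have : a ++ (x ++ ([e] ++ b)) ∈ P.rels := by simpa using hρ
    simpa using rotate_mem' this
  have := piece_lt h2 h1 (c := x) (fun h => he ?_) (List.prefix_append _ _) (List.prefix_append _ _)
  · simp only [List.length_append] at this ⊢
    omega
  · have h3 := congrArg List.head? (List.append_cancel_left h)
    rw [List.head?_append_of_ne_nil _ hY] at h3
    simpa using h3.symm

lemma piece_of_getLast_ne {y X Y ρ : Word S} {f : S × Bool} (hy : y <+: X)
    (hXY : X ++ Y ∈ P.rels) (hY : Y ≠ []) (hρ : ρ ∈ P.rels) (hyf : f :: y <:+: ρ)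
    (hf : f ∉ Y.getLast?) :
    6 * y.length < ρ.length ∧ 6 * y.length < (X ++ Y).length := by
  obtain ⟨X', rfl⟩ := hy
  have := piece_of_head_ne (P := P) (x := wordInv y) (X := wordInv (y ++ X')) (Y := wordInv Y)
    (ρ := wordInv ρ) (e := letterInv f) ⟨wordInv X', by simp⟩
    (by rw [← wordInv_append]; exact P.inv_mem _ (rotate_mem' hXY)) (by simpa using hY)
    (P.inv_mem _ hρ) (by rw [← wordInv_cons]; exact infix_wordInv_iff.2 hyf) (by
      rw [head?_wordInv]
      intro h
      obtain ⟨z, hz, hz'⟩ := Option.map_eq_some_iff.1 h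
      rw [letterInv_eq_comm, letterInv_letterInv] at hz'
      exact hf (hz' ▸ hz))
  simpa only [length_wordInv, List.length_append] using this

lemma infix_of_infix_wpow_append {A B t : Word S} {N : ℕ} (hB : B ≠ [])
    (ht : t <:+: wpow (A ++ B) N ++ A) :
    t <:+: A ++ B ++ A ∨ ∃ f ∈ B.getLast?, f :: A <:+: t := by
  induction N with
  | zero => exact Or.inl (List.IsInfix.trans (by simpa using ht) ⟨[], B ++ A, by simp⟩)
  | succ N ih =>
    rw [wpow_succ, List.append_assoc] at ht
    rcases List.infix_append_iff.1 ht with h | h | ⟨t₁, t₂, rfl, h₁, h₂⟩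
    · exact Or.inl (h.trans ⟨[], A, by simp⟩)
    · exact ih h
    · rcases eq_or_ne t₁ [] with rfl | h0
      · exact ih (by simpa using h₂.isInfix)
      have hA : A <+: wpow (A ++ B) N ++ A := by
        rw [wpow_append_self]
        exact List.prefix_append _ _
      rcases List.prefix_or_prefix_of_prefix h₂ hA with h3 | ⟨t₃, rfl⟩
      · left
        obtain ⟨a, ha⟩ := h₁
        obtain ⟨b, hb⟩ := h3
        exact ⟨a, b, by rw [← ha, ← hb]; simp⟩
      · right
        obtain ⟨t₀, f, rfl⟩ := (List.eq_nil_or_concat' t₁).resolve_left h0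
        refine ⟨f, ?_, t₀, t₃, by simp⟩
        obtain ⟨a, ha⟩ := h₁
        have := congrArg List.getLast? ha
        rw [List.getLast?_append_of_ne_nil _ hB] at this
        simpa using this.symm

/-- A periodic word made of two alternating blocks of small cancellation type. -/
lemma bd_wpow_of_blocks {A B A' B' : Word S} (hA0 : A ≠ []) (hB0 : B ≠ []) (hA'0 : A' ≠ [])
    (hB'0 : B' ≠ []) (hA : A ++ A' ∈ P.rels) (hB : B ++ B' ∈ P.rels)
    (hA2 : 2 * A.length ≤ (A ++ A').length) (hA6 : (A ++ A').length ≤ 6 * A.length)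
    (hB2 : 2 * B.length ≤ (B ++ B').length)
    (h1 : ∀ e ∈ B.head?, e ∉ A'.head?) (h2 : ∀ e ∈ B.getLast?, e ∉ A'.getLast?)
    (h3 : ∀ e ∈ A.head?, e ∉ B'.head?) (h4 : ∀ e ∈ A.getLast?, e ∉ B'.getLast?) (N : ℕ) :
    Bd P 3 (wpow (A ++ B) N) := by
  intro t ht ρ hρ htρ
  have bA : Bd P 3 A := bd_of_rel (by simp) hA (by omega)
  have bB : Bd P 3 B := bd_of_rel (by simp) hB (by omega)
  have hh : ∀ {C t₂ : Word S}, t₂ ≠ [] → t₂ <+: C → ∃ e t', t₂ = e :: t' ∧ e ∈ C.head? := by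
    rintro C t₂ h0 ⟨s, rfl⟩
    rcases t₂ with _ | ⟨e, t'⟩
    · simp at h0
    · exact ⟨e, t', rfl, by simp⟩
  have hl : ∀ {C t₁ : Word S}, t₁ ≠ [] → t₁ <:+ C → ∃ e t', t₁ = t' ++ [e] ∧ e ∈ C.getLast? := by
    rintro C t₁ h0 ⟨s, rfl⟩
    obtain ⟨t', e, rfl⟩ := (List.eq_nil_or_concat' t₁).resolve_left h0
    exact ⟨e, t', rfl, by simp⟩
  -- a suffix of one block followed by a nonempty prefix of the next one
  have right : ∀ {C C' D x y : Word S}, C ++ C' ∈ P.rels → C' ≠ [] →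
      (∀ e ∈ D.head?, e ∉ C'.head?) → x <:+ C → y ≠ [] → y <+: D → x ++ y <:+: ρ →
      6 * x.length < ρ.length := by
    intro C C' D x y hC hC' hne hx hy0 hy hxy
    obtain ⟨e, y', rfl, he⟩ := hh hy0 hy
    exact (piece_of_head_ne hx hC hC' hρ (e := e) (List.IsInfix.trans ⟨[], y', by simp⟩ hxy)
      (hne e he)).1
  have left : ∀ {C C' D x y : Word S}, C ++ C' ∈ P.rels → C' ≠ [] →
      (∀ e ∈ D.getLast?, e ∉ C'.getLast?) → x <+: C → y ≠ [] → y <:+ D → y ++ x <:+: ρ →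
      6 * x.length < ρ.length := by
    intro C C' D x y hC hC' hne hx hy0 hy hxy
    obtain ⟨e, y', rfl, he⟩ := hl hy0 hy
    exact (piece_of_getLast_ne hx hC hC' hρ (f := e) (List.IsInfix.trans ⟨y', [], by simp⟩ hxy)
      (hne e he)).1
  rcases infix_of_infix_wpow_append hB0 (ht.trans (List.prefix_append _ A).isInfix) with h | h
  swap
  · obtain ⟨f, hf, hfA⟩ := h
    have := (piece_of_getLast_ne (List.prefix_refl A) hA hA'0 hρ (hfA.trans htρ.isInfix)
      (h2 f hf)).2
    omega
  have two : ∀ t, t <:+: A ++ B → t <+: ρ → 6 * t.length ≤ 3 * ρ.length := by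
    intro t h htρ
    rcases List.infix_append_iff.1 h with h | h | ⟨t₁, t₂, rfl, h₁, h₂⟩
    · exact bA t h ρ hρ htρ
    · exact bB t h ρ hρ htρ
    · rcases eq_or_ne t₁ [] with rfl | e₁
      · exact bB _ (by simpa using h₂.isInfix) ρ hρ htρ
      rcases eq_or_ne t₂ [] with rfl | e₂
      · exact bA _ (by simpa using h₁.isInfix) ρ hρ (by simpa using htρ)
      have := right hA hA'0 h1 h₁ e₂ h₂ htρ.isInfix
      have := left hB hB'0 h4 h₂ e₁ h₁ htρ.isInfix
      simp only [List.length_append]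
      omega
  rcases List.infix_append_iff.1 h with h | h | ⟨t₁, t₂, rfl, h₁, h₂⟩
  · exact two t h htρ
  · exact bA t h ρ hρ htρ
  · rcases eq_or_ne t₂ [] with rfl | e₂
    · exact two _ (by simpa using h₁.isInfix) htρ
    obtain ⟨a, ha⟩ := h₁
    rcases List.append_eq_append_iff.1 ha with ⟨x, rfl, rfl⟩ | ⟨c, rfl, rfl⟩
    · have e₃ := left hA hA'0 h2 h₂ hB0 (List.suffix_refl B)
        (List.IsInfix.trans ⟨x, [], by simp⟩ htρ.isInfix)
      have e₄ := right hB hB'0 h3 (List.suffix_refl B) e₂ h₂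
        (List.IsInfix.trans ⟨x, [], by simp⟩ htρ.isInfix)
      have e₅ := right hA hA'0 h1 (List.suffix_append a x) hB0 (List.prefix_refl B)
        (List.IsInfix.trans ⟨[], t₂, by simp⟩ htρ.isInfix)
      simp only [List.length_append]
      omega
    · rcases eq_or_ne t₁ [] with rfl | e₁
      · exact bA _ (by simpa using h₂.isInfix) ρ hρ htρ
      have e₃ := left hA hA'0 h2 h₂ e₁ (List.suffix_append c t₁) htρ.isInfix
      have e₄ := right hB hB'0 h3 (List.suffix_append c t₁) e₂ h₂ htρ.isInfix
      simp only [List.length_append]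
      omega

end GSC

namespace GSC

variable {S : Type} {P : C6Presentation S}

variable (P) in
/-- `w` is a shortest word representing a conjugate of its element, which has infinite order. -/
structure MinConj (w : Word S) : Prop where
  inf : ¬ IsOfFinOrder (P.elt w)
  le : ∀ y w', P.elt w' = y * P.elt w * y⁻¹ → w.length ≤ w'.length

namespace MinConj

variable {w x y : Word S}

lemma append_comm (h : MinConj P (x ++ y)) : MinConj P (y ++ x) := by
  refine ⟨fun h' => h.inf (isOfFinOrder_append_comm h'), fun z w' hw' => ?_⟩
  have := h.le (z * (P.elt x)⁻¹) w' (by rw [hw']; simp only [elt_append]; group)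
  simp only [List.length_append] at this ⊢
  omega

lemma geod (h : MinConj P w) : Geod P w := by
  rintro b ⟨s, t, rfl⟩ c hc
  have := h.le 1 (s ++ c ++ t) (by simp only [elt_append, hc]; simp)
  simp only [List.length_append] at this
  omega

lemma rd_append_self (h : MinConj P w) : Rd (w ++ w) := by
  rw [rd_append]
  refine ⟨h.geod.rd, h.geod.rd, fun a ha b hb => ?_⟩
  rcases w with _ | ⟨c, w⟩
  · simp at ha
  obtain rfl : c = b := by simpa using hb
  rcases eq_or_ne w [] with rfl | hw
  · obtain rfl : c = a := by simpa using ha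
    exact (letterInv_ne c).symm
  · have := (append_comm (x := [c]) (y := w) h).geod.rd
    rw [rd_append] at this
    refine this.2.2 a ?_ c (by simp)
    rw [← List.singleton_append, List.getLast?_append_of_ne_nil _ hw] at ha
    exact ha

end MinConj

lemma rd_wpow {w : Word S} (h : Rd (w ++ w)) (N : ℕ) : Rd (wpow w N) := by
  rcases eq_or_ne w [] with rfl | hw
  · simp [wpow, rd_nil]
  induction N with
  | zero => exact rd_nil
  | succ N ih =>
    rcases N with _ | N
    · simpa [wpow_succ] using h.left
    · rw [wpow_succ] at ih ⊢
      rw [wpow_succ, ← List.append_assoc]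
      exact h.append_overlap ih hw

lemma exists_minConj {g : P.Grp} (hg : ¬ IsOfFinOrder g) :
    ∃ w y, MinConj P w ∧ P.elt w = y * g * y⁻¹ := by
  obtain ⟨w, ⟨y, hw⟩, hmin⟩ := (measure fun v : Word S => v.length).wf.has_min
    {v | ∃ y, P.elt v = y * g * y⁻¹} (by
      obtain ⟨v, hv⟩ := elt_surjective P g
      exact ⟨v, 1, by simp [hv]⟩)
  refine ⟨w, y, ⟨?_, fun z w' hw' => ?_⟩, hw⟩
  · rw [hw, isOfFinOrder_iff_pow_eq_one] at *
    rintro ⟨n, hn, h⟩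
    rw [conj_pow, conj_eq_one_iff] at h
    exact hg ⟨n, hn, h⟩
  · by_contra! hlt
    exact hmin w' ⟨z * y, by rw [hw', hw]; group⟩ hlt

lemma infix_wpow_succ {x y t : Word S} {N : ℕ} (h : t <:+: wpow (y ++ x) N) :
    t <:+: wpow (x ++ y) (N + 1) := by
  refine h.trans ⟨x, y, ?_⟩
  rw [← wpow_append_self, List.append_assoc, ← wpow_succ']

variable (P) in
/-- A subword of the periodic line `w` that covers more than half of a relator. -/
def Viol (w v : Word S) : Prop :=
  ∃ N, v <:+: wpow w N ∧ ∃ ρ ∈ P.rels, v <:+: ρ ∧ ρ.length < 2 * v.length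

lemma exists_max_viol {w v : Word S} (hw : ¬ IsOfFinOrder (P.elt w)) (hv : Viol P w v) :
    ∃ v₀, Viol P w v₀ ∧ ∀ v', Viol P w v' → v'.length ≤ v₀.length := by
  classical
  have hbd : ∀ v', Viol P w v' → v'.length ≤ 2 * w.length := by
    rintro v' ⟨N, h1, ρ, hρ, ⟨a, b, rfl⟩, h3⟩
    have h4 : v' ++ (b ++ a) ∈ P.rels := by
      rw [List.append_assoc] at hρ
      simpa using rotate_mem' hρ
    have := six_mul_length_le_of_infix_wpow h1 h4 hw
    simp only [List.length_append] at this h3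
    omega
  have hP : ∃ n, ∃ v', Viol P w v' ∧ v'.length = n := ⟨_, v, hv, rfl⟩
  obtain ⟨v₀, h1, h2⟩ := Nat.findGreatest_spec (P := fun n => ∃ v', Viol P w v' ∧ v'.length = n)
    (hbd v hv) ⟨v, hv, rfl⟩
  refine ⟨v₀, h1, fun v' hv' => ?_⟩
  rw [h2]
  exact Nat.le_findGreatest (hbd v' hv') ⟨v', hv', rfl⟩

lemma exists_maxViol_prefix {w v : Word S} (hw : MinConj P w) (hv : Viol P w v) :
    ∃ x y v₁ v₂ c, w = x ++ y ∧ y ++ x = v₁ ++ v₂ ∧ v₁ ≠ [] ∧ v₁ ++ v₂ ++ v₁ ++ c ∈ P.rels ∧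
      (v₁ ++ v₂ ++ v₁ ++ c).length < 2 * (v₁ ++ v₂ ++ v₁).length ∧
      ∀ v', Viol P (v₁ ++ v₂) v' → v'.length ≤ (v₁ ++ v₂ ++ v₁).length := by
  obtain ⟨v₀, ⟨N, h1, ρ, hρ, ⟨a, b, rfl⟩, h2⟩, hmax⟩ := exists_max_viol hw.inf hv
  obtain ⟨x, y, rfl, hpre⟩ := exists_prefix_wpow_rotate h1
  have hw' := hw.append_comm
  have hmax' : ∀ v', Viol P (y ++ x) v' → v'.length ≤ v₀.length := by
    rintro v' ⟨N, h3, h4⟩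
    exact hmax v' ⟨N + 1, infix_wpow_succ h3, h4⟩
  have hr : v₀ ++ (b ++ a) ∈ P.rels := by
    rw [List.append_assoc] at hρ
    simpa using rotate_mem' hρ
  generalize hwy : y ++ x = w' at *
  have hlt : w'.length < v₀.length := by
    by_contra! hle
    have h5 : v₀ <+: w' := by
      rcases N with _ | N
      · simp at hpre
        simp [hpre]
      · rw [wpow_succ] at hpre
        exact List.prefix_of_prefix_length_le hpre (List.prefix_append _ _) hle
    have := hw'.geod.bd v₀ h5.isInfix _ hr (List.prefix_append _ _)
    simp only [List.length_append] at this h2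
    omega
  obtain ⟨v₁, rfl⟩ : w' <+: v₀ := by
    rcases N with _ | N
    · simp at hpre
      simp [hpre] at hlt
    · rw [wpow_succ] at hpre
      exact List.prefix_of_prefix_length_le (List.prefix_append _ _) hpre hlt.le
  obtain ⟨v₂, rfl⟩ : v₁ <+: w' := by
    have := six_mul_length_le_of_infix_wpow hpre.isInfix hr hw'.inf
    have h6 : v₁ <+: wpow w' (N + 1) := by
      rcases N with _ | N
      · simp at hpre
        simp [hpre.2]
      · rw [wpow_succ, List.prefix_append_right_inj] at hpre
        rw [wpow_succ', wpow_succ']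
        exact hpre.trans ⟨w' ++ w', by simp⟩
    rw [wpow_succ] at h6
    refine List.prefix_of_prefix_length_le h6 (List.prefix_append _ _) ?_
    simp only [List.length_append] at this h2
    omega
  refine ⟨x, y, v₁, v₂, b ++ a, rfl, hwy, ?_, by simpa using hr, ?_, hmax'⟩
  · rintro rfl
    simp at hlt
  · simp only [List.length_append] at h2 ⊢
    omega

/-- Some power of a conjugate of `g` is represented by a word all of whose powers are almost
geodesic. -/
theorem exists_good_word {g : P.Grp} (hg : ¬ IsOfFinOrder g) :
    ∃ (h : Word S) (y : P.Grp) (k : ℕ), 0 < k ∧ P.elt h = y * g ^ k * y⁻¹ ∧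
      ∀ N, Rd (wpow h N) ∧ Bd P 3 (wpow h N) := by
  obtain ⟨w, y₀, hw, hwg⟩ := exists_minConj hg
  by_cases hv : ∃ v, Viol P w v
  swap
  · refine ⟨w, y₀, 1, one_pos, by simpa using hwg, fun N => ⟨rd_wpow hw.rd_append_self N, ?_⟩⟩
    intro t ht ρ hρ htρ
    by_contra! hlt
    exact hv ⟨t, N, ht, ρ, hρ, htρ.isInfix, by omega⟩
  obtain ⟨v, hv⟩ := hv
  obtain ⟨x, y, v₁, v₂, c, rfl, hyx, hv1, hr, hl, hmax⟩ := exists_maxViol_prefix hw hv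
  have hw' := hw.append_comm
  rw [hyx] at hw'
  have hv1l := List.length_pos_iff.2 hv1
  have hr' : (v₁ ++ v₂) ++ (v₁ ++ c) ∈ P.rels := by simpa using hr
  have f2 := piece_lt hr' (rotate_mem' hr') (rotate_ne_of_not_isOfFinOrder hw'.inf hr')
    (c := v₁) ⟨v₂ ++ (v₁ ++ c), by simp⟩
    ⟨c ++ (v₁ ++ v₂), by simp⟩
  have f3 : (v₁ ++ v₂).length ≤ (v₁ ++ c).length := by
    have h1 := elt_rel hr'
    rw [elt_append, mul_eq_one_iff_eq_inv, ← elt_wordInv] at h1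
    have := hw'.geod _ (List.infix_refl _) _ h1
    rwa [length_wordInv] at this
  have hvv := hw'.rd_append_self
  have hrr := rd_rel_append hr
  simp only [List.length_append] at f2 f3 hl
  have hv2 : v₂ ≠ [] := by
    rw [← List.length_pos_iff]; omega
  have hc : c ≠ [] := by
    rw [← List.length_pos_iff]; omega
  have r12 : Rd (v₁ ++ v₂) := hvv.left
  have r21 : Rd (v₂ ++ v₁) := hvv.infix ⟨v₁, v₂, by simp⟩
  have r1c : Rd (v₁ ++ c) := hrr.infix ⟨v₁ ++ v₂, v₁ ++ v₂ ++ v₁ ++ c, by simp⟩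
  have rc1 : Rd (c ++ v₁) := hrr.infix ⟨v₁ ++ v₂ ++ v₁, v₂ ++ v₁ ++ c, by simp⟩
  rw [rd_append] at r12 r21 r1c rc1
  have hmap : ∀ {z : S × Bool} {o : Option (S × Bool)}, z ∈ o.map letterInv → ∃ z' ∈ o, z = letterInv z' := by
    intro z o hz
    obtain ⟨z', h1, h2⟩ := Option.map_eq_some_iff.1 hz
    exact ⟨z', h1, h2.symm⟩
  have g1 : ∀ z ∈ v₂.head?, z ∉ c.head? := by
    intro z hz hz'
    obtain ⟨v₃, rfl⟩ := List.head?_eq_some_iff.1 hz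
    obtain ⟨c', rfl⟩ := List.head?_eq_some_iff.1 hz'
    have := hmax (v₁ ++ z :: v₃ ++ v₁ ++ [z]) ⟨2, ⟨[], v₃, by simp [wpow_succ]⟩, _, hr,
      ⟨[], c', by simp⟩, by simp only [List.length_append, List.length_singleton]; omega⟩
    simp at this
  have g2 : ∀ z ∈ v₂.getLast?, z ∉ c.getLast? := by
    intro z hz hz'
    obtain ⟨v₃, rfl⟩ := eq_concat_of_mem_getLast? hz
    obtain ⟨c', rfl⟩ := eq_concat_of_mem_getLast? hz'
    have h1 : (v₁ ++ (v₃ ++ [z]) ++ v₁ ++ c') ++ [z] ∈ P.rels := by simpa using hr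
    have := hmax ([z] ++ (v₁ ++ (v₃ ++ [z]) ++ v₁)) ⟨3,
      ⟨v₁ ++ v₃, v₃ ++ [z], by simp [wpow_succ]⟩, _, rotate_mem' h1, ⟨[], c', by simp⟩, by
        simp only [List.length_append, List.length_singleton] at hl ⊢; omega⟩
    simp at this
  refine ⟨wordInv c ++ v₂, (P.elt x)⁻¹ * y₀, 2, two_pos, ?_, fun N => ⟨rd_wpow ?_ N, ?_⟩⟩
  · have h1 := elt_rel hr
    rw [elt_append, mul_eq_one_iff_inv_eq, eq_comm] at h1
    have h2 : P.elt y * P.elt x = P.elt v₁ * P.elt v₂ := by rw [← elt_append, hyx, elt_append]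
    have h3 : P.elt y = (P.elt x)⁻¹ * (y₀ * g * y₀⁻¹) := by
      rw [← hwg, elt_append, inv_mul_cancel_left]
    have h4 : P.elt (wordInv c ++ v₂) = (P.elt v₁ * P.elt v₂) * (P.elt v₁ * P.elt v₂) := by
      rw [elt_append, elt_wordInv, h1]
      simp only [elt_append]
      group
    rw [h4, ← h2, h3, pow_two]
    group
  · have h1 : Rd (wordInv c ++ v₂) := by
      rw [rd_append]
      refine ⟨r1c.2.1.wordInv, r12.2.1, fun z hz z' hz' e => ?_⟩
      rw [getLast?_wordInv] at hz
      obtain ⟨z₁, hz₁, rfl⟩ := hmap hz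
      rw [letterInv_letterInv] at e
      exact g1 z' hz' (e ▸ hz₁)
    rw [rd_append]
    refine ⟨h1, h1, fun z hz z' hz' e => ?_⟩
    rw [List.getLast?_append_of_ne_nil _ hv2] at hz
    rw [List.head?_append_of_ne_nil _ (by simpa), head?_wordInv] at hz'
    obtain ⟨z₁, hz₁, e'⟩ := hmap hz'
    have : z₁ = z := by simpa [letterInv_eq_comm] using e'.symm.trans e
    exact g2 z hz (this ▸ hz₁)
  · refine bd_wpow_of_blocks (A' := wordInv (v₁ ++ v₂ ++ v₁)) (B' := v₁ ++ c ++ v₁) (by simpa) hv2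
      (by simp [hv1]) (by simp [hv1]) ?_ ?_ ?_ ?_ ?_ ?_ ?_ ?_ ?_ N
    · rw [← wordInv_append]
      exact P.inv_mem _ hr
    · have : v₁ ++ (v₂ ++ v₁ ++ c) ∈ P.rels := by simpa using hr
      simpa using rotate_mem' this
    · simp only [List.length_append, length_wordInv]; omega
    · simp only [List.length_append, length_wordInv]; omega
    · simp only [List.length_append]; omega
    · intro e he he'
      rw [head?_wordInv, List.getLast?_append_of_ne_nil _ hv1] at he'
      obtain ⟨z, hz, hz'⟩ := hmap he'
      exact r12.2.2 z hz e he hz'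
    · intro e he he'
      rw [getLast?_wordInv, List.append_assoc, List.head?_append_of_ne_nil _ hv1] at he'
      obtain ⟨z, hz, rfl⟩ := hmap he'
      exact r21.2.2 _ he z hz (by simp)
    · intro e he he'
      rw [head?_wordInv] at he
      rw [List.append_assoc, List.head?_append_of_ne_nil _ hv1] at he'
      obtain ⟨z, hz, rfl⟩ := hmap he
      exact rc1.2.2 z hz _ he' rfl
    · intro e he he'
      rw [getLast?_wordInv] at he
      rw [List.getLast?_append_of_ne_nil _ hv1] at he'
      obtain ⟨z, hz, rfl⟩ := hmap he
      exact r1c.2.2 _ he' z hz (by simp)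

end GSC

namespace GSC

variable {S : Type} {P : C6Presentation S}

/-- The word length of an element of the group of the presentation `P`. -/
noncomputable abbrev len (P : C6Presentation S) (x : P.Grp) : ℕ := wordLength P.gens x

lemma elt_singleton_mem (P : C6Presentation S) (a : S × Bool) :
    P.elt [a] ∈ P.gens ∨ (P.elt [a])⁻¹ ∈ P.gens := by
  obtain ⟨a, b⟩ := a
  cases b
  · exact Or.inr ⟨a, by simp [C6Presentation.elt]⟩
  · exact Or.inl ⟨a, by simp [C6Presentation.elt]⟩

lemma exists_elt_singleton {x : P.Grp} (hx : x ∈ P.gens ∨ x⁻¹ ∈ P.gens) :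
    ∃ a, P.elt [a] = x := by
  rcases hx with ⟨a, ha⟩ | ⟨a, ha⟩
  · exact ⟨(a, true), by simpa [C6Presentation.elt] using ha⟩
  · exact ⟨(a, false), by simpa [C6Presentation.elt, inv_eq_iff_eq_inv] using ha⟩

lemma len_elt_le (P : C6Presentation S) (w : Word S) : len P (P.elt w) ≤ w.length := by
  refine Nat.sInf_le ⟨w.map fun a => P.elt [a], by simp, ?_, ?_⟩
  · simp only [List.mem_map]
    rintro _ ⟨a, -, rfl⟩
    exact elt_singleton_mem P a
  · simp [C6Presentation.elt]

lemma exists_elt_eq_of_prod (l : List P.Grp) (hl : ∀ x ∈ l, x ∈ P.gens ∨ x⁻¹ ∈ P.gens) :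
    ∃ w : Word S, w.length = l.length ∧ P.elt w = l.prod := by
  induction l with
  | nil => exact ⟨[], rfl, elt_nil P⟩
  | cons x l ih =>
    obtain ⟨w, h1, h2⟩ := ih fun y hy => hl y (List.mem_cons_of_mem _ hy)
    obtain ⟨a, ha⟩ := exists_elt_singleton (hl x List.mem_cons_self)
    exact ⟨[a] ++ w, by simp [h1], by rw [elt_append, ha, h2, List.prod_cons]⟩

lemma exists_elt_eq_length (x : P.Grp) : ∃ w : Word S, w.length = len P x ∧ P.elt w = x := by
  obtain ⟨w, hw⟩ := elt_surjective P x
  have hne : {n : ℕ | ∃ l : List P.Grp, l.length = n ∧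
      (∀ x ∈ l, x ∈ P.gens ∨ x⁻¹ ∈ P.gens) ∧ l.prod = x}.Nonempty := by
    refine ⟨_, w.map fun a => P.elt [a], rfl, ?_, ?_⟩
    · simp only [List.mem_map]
      rintro _ ⟨a, -, rfl⟩
      exact elt_singleton_mem P a
    · rw [← hw]; simp [C6Presentation.elt]
  obtain ⟨l, h1, h2, h3⟩ := Nat.sInf_mem hne
  obtain ⟨w, h4, h5⟩ := exists_elt_eq_of_prod l h2
  exact ⟨w, h4.trans h1, h5.trans h3⟩

lemma len_mul_le (x y : P.Grp) : len P (x * y) ≤ len P x + len P y := by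
  obtain ⟨v, hv, rfl⟩ := exists_elt_eq_length x
  obtain ⟨w, hw, rfl⟩ := exists_elt_eq_length y
  rw [← elt_append, ← hv, ← hw, ← List.length_append]
  exact len_elt_le P _

lemma len_inv_le (x : P.Grp) : len P x⁻¹ ≤ len P x := by
  obtain ⟨v, hv, rfl⟩ := exists_elt_eq_length x
  rw [← elt_wordInv, ← hv, ← length_wordInv v]
  exact len_elt_le P _

lemma len_inv (x : P.Grp) : len P x⁻¹ = len P x :=
  (len_inv_le x).antisymm (by simpa using len_inv_le x⁻¹)

lemma len_one (P : C6Presentation S) : len P 1 = 0 := by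
  simpa [elt_nil] using len_elt_le P []

lemma len_pow_le (x : P.Grp) (n : ℕ) : len P (x ^ n) ≤ n * len P x := by
  induction n with
  | zero => simp [len_one]
  | succ n ih =>
    rw [pow_succ]
    have := len_mul_le (x ^ n) x
    linarith

lemma Geod.len_eq {v : Word S} (hv : Geod P v) : len P (P.elt v) = v.length := by
  refine (len_elt_le P v).antisymm ?_
  obtain ⟨w, hw, he⟩ := exists_elt_eq_length (P.elt v)
  rw [← hw]
  exact hv v (List.infix_refl _) w he.symm

lemma geod_of_len_eq {v : Word S} (hv : len P (P.elt v) = v.length) : Geod P v := by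
  rintro b ⟨s, t, rfl⟩ c hc
  have h1 : P.elt (s ++ b ++ t) = P.elt (s ++ c ++ t) := by simp [elt_append, hc]
  have h2 := len_elt_le P (s ++ c ++ t)
  rw [← h1, hv] at h2
  simp only [List.length_append] at h2
  omega

lemma finite_len_le [Finite S] (P : C6Presentation S) (K : ℕ) : {x | len P x ≤ K}.Finite := by
  refine ((List.finite_length_le (S × Bool) K).image P.elt).subset fun x hx => ?_
  obtain ⟨w, hw, he⟩ := exists_elt_eq_length x
  exact ⟨w, hw.trans_le hx, he⟩

lemma exists_bound_of_len_zpow_le [Finite S] {a : P.Grp} (ha : ¬ IsOfFinOrder a) (K : ℕ) :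
    ∃ B : ℕ, ∀ k : ℤ, len P (a ^ k) ≤ K → k ≤ B := by
  have h : {k : ℤ | len P (a ^ k) ≤ K}.Finite :=
    (finite_len_le P K).preimage (injective_zpow_iff_not_isOfFinOrder.2 ha).injOn
  obtain ⟨B, hB⟩ := h.bddAbove
  exact ⟨B.toNat, fun k hk => (hB hk).trans (Int.self_le_toNat B)⟩

end GSC

namespace GSC

variable {S : Type} {P : C6Presentation S}

variable (P) in
/-- Every vertex of the path from `1` labelled by `w` is `K`-close to the powers of `a`. -/
def NearPowers (a : P.Grp) (K : ℕ) (w : Word S) : Prop :=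
  ∀ w', w' <+: w → ∃ (k : ℤ) (x : P.Grp), len P x ≤ K ∧ P.elt w' = a ^ k * x

lemma NearPowers.excise {a : P.Grp} {K : ℕ} {w₁ w₂ w₃ : Word S} {k : ℤ}
    (hw : NearPowers P a K (w₁ ++ w₂ ++ w₃))
    (he : P.elt (w₁ ++ w₂) = a ^ k * P.elt w₁) : NearPowers P a K (w₁ ++ w₃) := by
  intro w' hw'
  rcases List.prefix_or_prefix_of_prefix hw' (List.prefix_append w₁ w₃) with h | ⟨t, rfl⟩
  · exact hw w' (h.trans (by simp [List.append_assoc]))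
  · rw [List.prefix_append_right_inj] at hw'
    obtain ⟨j, x, hx, hj⟩ := hw (w₁ ++ w₂ ++ t) ((List.prefix_append_right_inj _).2 hw')
    refine ⟨j - k, x, hx, ?_⟩
    rw [elt_append, he, mul_assoc, ← elt_append] at hj
    rw [sub_eq_neg_add, zpow_add, mul_assoc, ← hj, zpow_neg, inv_mul_cancel_left]

/-- A long path close to the powers of `a` has a short subpath joining two translates, by powers
of `a`, of the same vertex. -/
lemma NearPowers.exists_window [Finite S] {a : P.Grp} {K : ℕ} {w : Word S}
    (hw : NearPowers P a K w) (hl : {x | len P x ≤ K}.ncard ≤ w.length) :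
    ∃ (w₁ w₂ w₃ : Word S) (i b : ℤ) (x : P.Grp), w = w₁ ++ w₂ ++ w₃ ∧ w₂ ≠ [] ∧
      w₂.length ≤ {x | len P x ≤ K}.ncard ∧ len P x ≤ K ∧
      P.elt w₁ = a ^ i * x ∧ P.elt (w₁ ++ w₂) = a ^ (i + b) * x := by
  set B : Set P.Grp := {x | len P x ≤ K} with hB
  have hBf : B.Finite := finite_len_le P K
  choose k x hx he using fun i : ℕ => hw (w.take i) (List.take_prefix i w)
  obtain ⟨i, hi, j, hj, hne, hij⟩ := Finset.exists_ne_map_eq_of_card_lt_of_maps_to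
    (s := Finset.range (B.ncard + 1)) (t := hBf.toFinset) (f := x)
    (by rw [Finset.card_range, ← Set.ncard_eq_toFinset_card B hBf]; omega)
    (fun i _ => by simpa [hB] using hx i)
  wlog hlt : i < j generalizing i j
  · exact this j hj i hi hne.symm hij.symm (by omega)
  rw [Finset.mem_range] at hi hj
  have hsplit : w.take j = w.take i ++ (w.take j).drop i := by
    conv_lhs => rw [← List.take_append_drop i (w.take j), List.take_take, min_eq_left hlt.le]
  have hlen : ((w.take j).drop i).length = j - i := by
    rw [List.length_drop, List.length_take]; omega
  refine ⟨w.take i, (w.take j).drop i, w.drop j, k i, k j - k i, x i, ?_, ?_, ?_, hx i, he i, ?_⟩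
  · rw [← hsplit, List.take_append_drop]
  · rw [← List.length_pos_iff, hlen]; omega
  · rw [hlen]; omega
  · rw [← hsplit, he j, add_sub_cancel, hij]

/-- If short translations by powers of `a` satisfy a linear lower bound, then so do paths close to
the powers of `a`, up to an additive constant. -/
lemma exists_linear_bound [Finite S] {a : P.Grp} (ha : ¬ IsOfFinOrder a) (K m n : ℕ)
    (H : ∀ (b : ℤ) (x : P.Grp) (l : ℕ), len P x ≤ K → len P (x⁻¹ * a ^ b * x) ≤ l →
      l ≤ {x | len P x ≤ K}.ncard → m * b ≤ n * l) :
    ∃ C : ℕ, ∀ (w : Word S) (k : ℤ) (x : P.Grp), NearPowers P a K w → len P x ≤ K →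
      P.elt w = a ^ k * x → m * k ≤ n * w.length + C := by
  obtain ⟨B, hB⟩ := exists_bound_of_len_zpow_le ha ({x | len P x ≤ K}.ncard + K)
  refine ⟨m * B, fun w => ?_⟩
  induction hN : w.length using Nat.strong_induction_on generalizing w with
  | _ N ih =>
  subst hN
  intro k x hw hx he
  by_cases hl : {x | len P x ≤ K}.ncard ≤ w.length
  · obtain ⟨w₁, w₂, w₃, i, b, y, rfl, h2, h2l, hy, e1, e2⟩ := hw.exists_window hl
    have h3 : P.elt (w₁ ++ w₂) = a ^ b * P.elt w₁ := by
      rw [e2, e1, ← mul_assoc, ← zpow_add, add_comm]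
    have h4 : P.elt w₂ = y⁻¹ * a ^ b * y := by
      rw [elt_append, e1, ← eq_inv_mul_iff_mul_eq] at e2
      rw [e2, zpow_add]; group
    have h5 := H b y w₂.length hy (h4 ▸ len_elt_le P w₂) h2l
    have h2p := List.length_pos_iff.2 h2
    have h6 := ih (w₁ ++ w₃).length (by simp only [List.length_append]; omega) (w₁ ++ w₃) rfl
      (k - b) x (hw.excise h3) hx (by
        rw [elt_append, h3, mul_assoc, ← elt_append, ← eq_inv_mul_iff_mul_eq] at he
        rw [he, ← mul_assoc, ← zpow_neg, ← zpow_add, neg_add_eq_sub])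
    simp only [List.length_append] at h6 ⊢
    push_cast at h6 ⊢
    linarith
  · have h1 : len P (a ^ k) ≤ {x | len P x ≤ K}.ncard + K := by
      have := len_mul_le (P.elt w) x⁻¹
      rw [he, mul_inv_cancel_right, ← he, len_inv] at this
      have := len_elt_le P w
      omega
    have h2 : (m : ℤ) * k ≤ m * B := mul_le_mul_of_nonneg_left (hB k h1) (by positivity)
    push_cast
    nlinarith

/-- If the powers of `a` are joined to `1` by geodesics uniformly close to `⟨a⟩`, then a conjugate
of a power of `a` has a representative all of whose powers are geodesic. -/
lemma exists_straight_word [Finite S] {a : P.Grp} (ha : ¬ IsOfFinOrder a) {K : ℕ}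
    (H : ∀ N : ℕ, ∃ v, Geod P v ∧ P.elt v = a ^ N ∧ NearPowers P a K v) :
    ∃ (u : Word S) (n : ℕ) (x : P.Grp), 0 < n ∧ P.elt u = x⁻¹ * a ^ n * x ∧ u ≠ [] ∧
      ∀ t, Geod P (wpow u t) := by
  set L := {x | len P x ≤ K}.ncard with hL
  have lin : ∀ (m n : ℕ), (∀ (b : ℤ) (x : P.Grp) (l : ℕ), len P x ≤ K →
      len P (x⁻¹ * a ^ b * x) ≤ l → l ≤ L → m * b ≤ n * l) →
      ∃ C : ℕ, ∀ N : ℕ, m * N ≤ n * len P (a ^ N) + C := by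
    intro m n h
    obtain ⟨C, hC⟩ := exists_linear_bound ha K m n h
    refine ⟨C, fun N => ?_⟩
    obtain ⟨v, hv, he, hn⟩ := H N
    have := hC v N 1 hn (by simp [len_one]) (by simp [he])
    rw [← he, hv.len_eq]
    exact_mod_cast this
  let F : Set (ℤ × P.Grp) := {p | 1 ≤ p.1 ∧ len P p.2 ≤ K ∧ len P (p.2⁻¹ * a ^ p.1 * p.2) ≤ L}
  have hF : F.Finite := by
    obtain ⟨B, hB⟩ := exists_bound_of_len_zpow_le ha (L + 2 * K)
    refine ((Set.finite_Icc 1 (B : ℤ)).prod (finite_len_le P K)).subset ?_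
    rintro ⟨b, x⟩ ⟨h1, h2, h3⟩
    refine ⟨⟨h1, hB b ?_⟩, h2⟩
    have h4 := len_mul_le x (x⁻¹ * a ^ b * x * x⁻¹)
    have h5 := len_mul_le (x⁻¹ * a ^ b * x) x⁻¹
    rw [len_inv] at h5
    rw [show x * (x⁻¹ * a ^ b * x * x⁻¹) = a ^ b by group] at h4
    dsimp only at h2 h3
    omega
  have hFne : F.Nonempty := by
    by_contra hne
    rw [Set.not_nonempty_iff_eq_empty] at hne
    obtain ⟨C, hC⟩ := lin 1 0 (fun b x l hx hl hlL => by
      by_contra! hb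
      have : (b, x) ∈ F := ⟨by simp at hb; omega, hx, hl.trans hlL⟩
      simp [hne] at this)
    have := hC (C + 1)
    omega
  obtain ⟨⟨n, x⟩, ⟨hn, hx, hxl⟩, hmin⟩ := Set.exists_min_image F
    (fun p => (len P (p.2⁻¹ * a ^ p.1 * p.2) : ℚ) / p.1) hF hFne
  dsimp only at hn hx hxl hmin
  lift n to ℕ using by omega
  rw [zpow_natCast] at hmin hxl
  set y := x⁻¹ * a ^ n * x with hy
  set m := len P y with hm
  obtain ⟨u, hu, hue⟩ := exists_elt_eq_length y
  obtain ⟨C, hC⟩ := lin m n (fun b z l hz hl hlL => by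
    rcases le_or_gt b 0 with hb | hb
    · have : (m : ℤ) * b ≤ 0 := mul_nonpos_of_nonneg_of_nonpos (by positivity) hb
      exact this.trans (by positivity)
    · have h1 := hmin (b, z) ⟨by dsimp only; omega, hz, hl.trans hlL⟩
      have hn' : (0 : ℚ) < (n : ℤ) := by exact_mod_cast (by omega : (0 : ℤ) < n)
      have hb' : (0 : ℚ) < b := by exact_mod_cast hb
      rw [div_le_div_iff₀ hn' hb'] at h1
      have h2 : (m : ℤ) * b ≤ len P (z⁻¹ * a ^ b * z) * n := by exact_mod_cast h1
      have h3 : (len P (z⁻¹ * a ^ b * z) : ℤ) * n ≤ l * n :=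
        mul_le_mul_of_nonneg_right (by exact_mod_cast hl) (by positivity)
      linarith)
  have hn0 : 0 < n := by omega
  have hyp : ∀ t : ℕ, y ^ t = x⁻¹ * a ^ (n * t) * x := fun t => by
    rw [pow_mul]
    simpa using conj_pow (a := x⁻¹) (b := a ^ n) (i := t)
  have low : ∀ t : ℕ, m * (n * t) ≤ n * len P (y ^ t) + (2 * n * K + C) := by
    intro t
    have h1 := hC (n * t)
    have h2 := len_mul_le x (y ^ t * x⁻¹)
    have h3 := len_mul_le (y ^ t) x⁻¹
    rw [len_inv] at h3
    rw [show x * (y ^ t * x⁻¹) = a ^ (n * t) by rw [hyp]; group] at h2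
    have h4 : n * len P (a ^ (n * t)) ≤ n * (len P (y ^ t) + 2 * K) :=
      Nat.mul_le_mul_left n (by omega)
    linarith
  refine ⟨u, n, x, hn0, hue, ?_, fun t => geod_of_len_eq ?_⟩
  · rintro rfl
    rw [elt_nil] at hue
    have h1 : a ^ n = 1 := by
      have : x * y * x⁻¹ = a ^ n := by rw [hy]; group
      rw [← this, ← hue]; group
    exact ha (isOfFinOrder_iff_pow_eq_one.2 ⟨n, hn0, h1⟩)
  · rw [elt_wpow, hue, length_wpow, hu]
    refine (len_pow_le y t).antisymm ?_
    by_contra! hlt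
    set D := 2 * n * K + C
    have h1 := low (t * (D + 1))
    have h2 := len_pow_le (y ^ t) (D + 1)
    rw [← pow_mul] at h2
    have h3 : (D + 1) * (len P (y ^ t) + 1) ≤ (D + 1) * (t * m) := Nat.mul_le_mul_left _ hlt
    have h4 : n * (len P (y ^ (t * (D + 1))) + (D + 1)) ≤ n * ((D + 1) * (t * m)) :=
      Nat.mul_le_mul_left n (by linarith)
    have h5 : D + 1 ≤ n * (D + 1) := Nat.le_mul_of_pos_left _ hn0
    nlinarith

end GSC

namespace GSC

variable {S : Type} {P : C6Presentation S}

variable (P) in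
/-- The vertices of the bi-infinite path through `1` labelled by the powers of `u`. -/
def axis (u : Word S) (i : ℤ) : P.Grp :=
  P.elt u ^ (i / u.length) * P.elt (u.take (i % u.length).toNat)

lemma axis_add {u : Word S} (hu : u ≠ []) (i q : ℤ) :
    axis P u (i + q * u.length) = P.elt u ^ q * axis P u i := by
  have h0 : (u.length : ℤ) ≠ 0 := by simpa using hu
  rw [axis, axis, Int.add_mul_ediv_right _ _ h0, Int.add_mul_emod_self_right, add_comm, zpow_add,
    mul_assoc]

lemma exists_prefix_axis {u : Word S} (hu : u ≠ []) {i : ℤ} (hi : 0 ≤ i) {t : ℕ}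
    (ht : i < t) : ∃ w, w <+: wpow u t ∧ (w.length : ℤ) = i ∧ P.elt w = axis P u i := by
  have h0 : (0 : ℤ) < u.length := by exact_mod_cast List.length_pos_iff.2 hu
  obtain ⟨q, hq⟩ := Int.eq_ofNat_of_zero_le (Int.ediv_nonneg hi h0.le)
  obtain ⟨r, hr⟩ := Int.eq_ofNat_of_zero_le (Int.emod_nonneg i h0.ne')
  have hlt := Int.emod_lt_of_pos i h0
  have hdiv := Int.mul_ediv_add_emod i u.length
  rw [hr] at hlt
  rw [hq, hr] at hdiv
  have hqt : q < t := by
    have : (q : ℤ) ≤ i := by nlinarith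
    omega
  obtain ⟨s, rfl⟩ : ∃ s, t = q + (s + 1) := ⟨t - q - 1, by omega⟩
  refine ⟨wpow u q ++ u.take r, ?_, ?_, ?_⟩
  · rw [wpow_add, wpow_succ, List.prefix_append_right_inj]
    exact (List.take_prefix r u).trans (List.prefix_append _ _)
  · rw [List.length_append, length_wpow, List.length_take, min_eq_left (by omega), ← hdiv]
    push_cast; ring
  · rw [axis, elt_append, elt_wpow, hq, hr]; simp

lemma wdist_axis {u : Word S} (hu : u ≠ []) (hg : ∀ t, Geod P (wpow u t)) (m n : ℤ) :
    wdist P.gens (axis P u m) (axis P u n) = |(m : ℝ) - (n : ℝ)| := by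
  wlog hmn : m ≤ n generalizing m n
  · rw [abs_sub_comm, ← this n m (by omega), wdist, wdist]
    have := len_inv ((axis P u n)⁻¹ * axis P u m)
    rw [mul_inv_rev, inv_inv] at this
    exact_mod_cast this
  have h0 : (0 : ℤ) < u.length := by exact_mod_cast List.length_pos_iff.2 hu
  set q := |m|
  have hmq : 0 ≤ m + q * u.length := by
    have h1 : 0 ≤ |m| := abs_nonneg m
    have h2 := neg_abs_le m
    nlinarith
  obtain ⟨t, ht⟩ := Int.eq_ofNat_of_zero_le (by omega : 0 ≤ n + q * u.length + 1)
  obtain ⟨v, hv, hvl, hve⟩ := exists_prefix_axis (P := P) hu hmq (t := t) (by omega)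
  obtain ⟨w, hw, hwl, hwe⟩ := exists_prefix_axis (P := P) hu
    (i := n + q * u.length) (by omega) (t := t) (by omega)
  obtain ⟨s, rfl⟩ := List.prefix_of_prefix_length_le hv hw (by omega)
  have hs : s <:+: wpow u t := (List.suffix_append v s).isInfix.trans hw.isInfix
  have he : (axis P u m)⁻¹ * axis P u n = P.elt s := by
    rw [axis_add hu] at hve hwe
    rw [elt_append, hve, mul_assoc, mul_right_inj] at hwe
    rw [← hwe, inv_mul_cancel_left]
  have hl : wordLength P.gens (P.elt s) = s.length := ((hg t).of_infix hs).len_eq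
  rw [List.length_append] at hwl
  have hsl : (s.length : ℤ) = n - m := by push_cast at hwl; linarith
  rw [wdist, he, hl, abs_sub_comm, ← Int.cast_sub, ← hsl, Int.cast_natCast, Nat.abs_cast]

/-- An element with a power conjugate to a straight word `u` has a periodic geodesic axis. -/
lemma exists_periodic_geodesic {u : Word S} (hu : u ≠ []) (hg : ∀ t, Geod P (wpow u t))
    {g z : P.Grp} {k : ℕ} (hk : 0 < k) (he : P.elt u = z⁻¹ * g ^ k * z) :
    ∃ (γ : ℤ → P.Grp) (h : P.Grp) (τ : ℤ), 1 ≤ τ ∧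
      (∀ m n : ℤ, wdist P.gens (γ m) (γ n) = |(m : ℝ) - (n : ℝ)|) ∧
      (∀ n : ℤ, h * γ n = γ (n + τ)) ∧
      FinHausdorffDist P.gens (Set.range γ) ((Subgroup.zpowers g : Subgroup P.Grp) : Set P.Grp) := by
  have h0 : 0 < u.length := List.length_pos_iff.2 hu
  have hzu : ∀ q : ℤ, z * P.elt u ^ q = g ^ (k * q) * z := fun q => by
    have := conj_zpow (a := z⁻¹) (b := g ^ k) (i := q)
    rw [inv_inv] at this
    rw [he, this, zpow_mul, zpow_natCast]; group
  refine ⟨fun i => z * axis P u i, g ^ k, u.length, by omega, fun m n => ?_, fun n => ?_, ?_⟩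
  · rw [← wdist_axis hu hg m n, wdist, wdist]
    congr 2
    group
  · have h1 := axis_add (P := P) hu n 1
    have h2 := hzu 1
    rw [mul_one, zpow_one, zpow_natCast] at h2
    rw [one_mul, zpow_one] at h1
    dsimp only
    rw [h1, ← mul_assoc, ← mul_assoc, h2]
  · refine ⟨(len P z + u.length + ∑ r ∈ Finset.range k, len P (g ^ r) : ℕ), ?_, ?_⟩
    · rintro _ ⟨i, rfl⟩
      refine ⟨g ^ (k * (i / u.length)), ⟨_, rfl⟩, ?_⟩
      have h1 : (z * axis P u i)⁻¹ * g ^ (k * (i / u.length)) =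
          (z * P.elt (u.take (i % u.length).toNat))⁻¹ := by
        rw [axis, ← mul_assoc, hzu]; group
      rw [wdist, Nat.cast_le, h1]
      change len P _ ≤ _
      rw [len_inv]
      have h2 := len_mul_le z (P.elt (u.take (i % u.length).toNat))
      have h3 := len_elt_le P (u.take (i % u.length).toNat)
      have h4 := List.length_take_le' (i % u.length).toNat u
      omega
    · rintro _ ⟨j, rfl⟩
      have hk' : (0 : ℤ) < k := by exact_mod_cast hk
      refine ⟨_, ⟨j / k * u.length, rfl⟩, ?_⟩
      obtain ⟨r, hr⟩ := Int.eq_ofNat_of_zero_le (Int.emod_nonneg j hk'.ne')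
      have hrk := Int.emod_lt_of_pos j hk'
      have h1 : axis P u (j / k * u.length) = P.elt u ^ (j / k) := by
        have := axis_add (P := P) hu 0 (j / k)
        rw [zero_add] at this
        rw [this]
        simp [axis, elt_nil]
      have h2 : g ^ j = g ^ (k * (j / k)) * g ^ r := by
        rw [← zpow_natCast g r, ← zpow_add, ← hr, Int.mul_ediv_add_emod]
      beta_reduce
      rw [wdist, Nat.cast_le, h1, hzu, h2, mul_inv_rev, mul_assoc, inv_mul_cancel_left]
      have h3 := len_mul_le z⁻¹ (g ^ r)
      have h4 := Finset.single_le_sum (f := fun r => len P (g ^ r)) (fun _ _ => Nat.zero_le _)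
        (Finset.mem_range.2 (by omega : r < k))
      rw [len_inv] at h3
      change len P _ ≤ _
      omega

lemma exists_periodic_geodesic_of_not_isOfFinOrder [Finite S] {g : P.Grp}
    (hg : ¬ IsOfFinOrder g) :
    ∃ (γ : ℤ → P.Grp) (h : P.Grp) (τ : ℤ), 1 ≤ τ ∧
      (∀ m n : ℤ, wdist P.gens (γ m) (γ n) = |(m : ℝ) - (n : ℝ)|) ∧
      (∀ n : ℤ, h * γ n = γ (n + τ)) ∧
      FinHausdorffDist P.gens (Set.range γ) ((Subgroup.zpowers g : Subgroup P.Grp) : Set P.Grp) := by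
  obtain ⟨h, y, k, hk, he, hh⟩ := exists_good_word hg
  have hinf : ¬ IsOfFinOrder (P.elt h) := by
    rw [he]
    intro hf
    obtain ⟨n, hn, h1⟩ := isOfFinOrder_iff_pow_eq_one.1 hf
    rw [conj_pow, conj_eq_one_iff, ← pow_mul] at h1
    exact hg (isOfFinOrder_iff_pow_eq_one.2 ⟨_, Nat.mul_pos hk hn, h1⟩)
  obtain ⟨u, n, x, hn, hue, hu, hgeo⟩ := exists_straight_word hinf (K := 25 * h.length) (by
    intro N
    obtain ⟨v, hv, hve⟩ := exists_geod (P.elt h ^ N)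
    refine ⟨v, hv, hve, fun v' hv' => ?_⟩
    obtain ⟨j, c, hc, hj⟩ := exists_near_pow hinf (hh N).1 (hh N).2 hv hve v' hv'
    exact ⟨j, P.elt c, (len_elt_le P c).trans hc, by rw [hj, zpow_natCast]⟩)
  refine exists_periodic_geodesic (z := y⁻¹ * x) hu hgeo (Nat.mul_pos hk hn) ?_
  rw [hue, he, conj_pow, ← pow_mul]
  group

end GSC

namespace GSC

/-- In a classical C'(1/6) group over a finite alphabet, every infinite
cyclic subgroup is at finite Hausdorff distance from a periodic bi-infinite geodesic. -/
theorem statement6 {S : Type} [Finite S] (P : C6Presentation S) (g : P.Grp)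
    (hg : ¬ IsOfFinOrder g) :
    ∃ (γ : ℤ → P.Grp) (h : P.Grp) (τ : ℤ), 1 ≤ τ ∧
      (∀ m n : ℤ, wdist P.gens (γ m) (γ n) = |(m : ℝ) - (n : ℝ)|) ∧
      (∀ n : ℤ, h * γ n = γ (n + τ)) ∧
      FinHausdorffDist P.gens (Set.range γ)
        ((Subgroup.zpowers g : Subgroup P.Grp) : Set P.Grp) := by
  exact exists_periodic_geodesic_of_not_isOfFinOrder hg

end GSC
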